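/- arXiv:2512.02428 — 2 statements merged into one kernel-verified Lean document; each statement's English description precedes it below -/
import Mathlib

section
/- Write ∑_{n ≤ x} τ(n) = x log x + (2γ − 1)x + Δ(x) and assume |Δ(x)| ≤ C x^θ for all x ≥ 1, with constants C > 0 and θ > 1/4. Then for every positive integer q and every x ≥ 3, | ∑_{n ≤ x, (n,q)=1} τ(n) − (φ(q)/q)² x log x − (φ(q)/q)² c₂(q) x | ≤ c₃(q) x^θ + c₄(q), where c₂(q) = 2γ + 2∑_{p | q} (log p)/(p−1) − 1, c₃(q) = C (∑_{d | q} μ(d)² d^{−θ})², and c₄(q) = 0 if q = 1 and c₄(q) = (φ(q)/q) 2^{ν(q)+1} if q > 1. -/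
noncomputable def dvK : ℝ := 2 * Real.eulerMascheroniConstant - 1

noncomputable def dvT (Q : Finset ℕ) (x : ℝ) : ℝ :=
  ∑ n ∈ Finset.Icc 1 ⌊x⌋₊, if (∀ p ∈ Q, ¬ p ∣ n) then (n.divisors.card : ℝ) else 0

noncomputable def dvM (Q : Finset ℕ) (x : ℝ) : ℝ :=
  (∏ p ∈ Q, (1 - 1 / (p : ℝ))) ^ 2 *
    (x * (Real.log x + dvK + 2 * ∑ p ∈ Q, Real.log p / ((p : ℝ) - 1)))

noncomputable def dvE (Q : Finset ℕ) (x : ℝ) : ℝ := dvT Q x - dvM Q x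

noncomputable def dvP (Q : Finset ℕ) (θ : ℝ) : ℝ := ∏ p ∈ Q, (1 + (p : ℝ) ^ (-θ)) ^ 2

noncomputable def dvc (Q : Finset ℕ) : ℝ := 2 * ∏ p ∈ Q, (2 - 2 / (p : ℝ))

lemma dv_reindex (h : ℕ → ℝ) (p : ℕ) (hp : 0 < p) (N : ℕ) :
    ∑ m ∈ Finset.Icc 1 (N / p), h m = ∑ n ∈ Finset.Icc 1 N, if p ∣ n then h (n / p) else 0 := by
  rw [← Finset.sum_filter]
  refine Finset.sum_bij' (fun m _ => p * m) (fun n _ => n / p) ?_ ?_ ?_ ?_ ?_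
  · intro m hm
    simp only [Finset.mem_Icc, Finset.mem_filter] at hm ⊢
    refine ⟨⟨Nat.mul_pos hp (by omega), ?_⟩, dvd_mul_right _ _⟩
    rw [mul_comm]; exact (Nat.le_div_iff_mul_le hp).1 hm.2
  · intro n hn
    simp only [Finset.mem_Icc, Finset.mem_filter] at hn ⊢
    exact ⟨Nat.div_pos (Nat.le_of_dvd (by omega) hn.2) hp, Nat.div_le_div_right hn.1.2⟩
  · intro m _; exact Nat.mul_div_cancel_left m hp
  · intro n hn
    simp only [Finset.mem_filter] at hn
    exact Nat.mul_div_cancel' hn.2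
  · intro m _; rw [Nat.mul_div_cancel_left m hp]

lemma dv_card_mul {p m k : ℕ} (hp : p.Prime) (hm : ¬ p ∣ m) :
    (p ^ k * m).divisors.card = (k + 1) * m.divisors.card := by
  have hc : Nat.Coprime (p ^ k) m := Nat.Coprime.pow_left _ ((Nat.Prime.coprime_iff_not_dvd hp).2 hm)
  rw [Nat.Coprime.card_divisors_mul hc, Nat.divisors_prime_pow hp]
  simp

lemma dv_pt {p n : ℕ} (hp : p.Prime) (hn : 0 < n) (Q : Finset ℕ) (hQ : ∀ r ∈ Q, r.Prime)
    (hpQ : p ∉ Q) (F : ℕ → ℝ)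
    (hF : ∀ n, F n = if (∀ r ∈ Q, ¬ r ∣ n) then (n.divisors.card : ℝ) else 0) :
    (if (∀ r ∈ insert p Q, ¬ r ∣ n) then (n.divisors.card : ℝ) else 0) =
      F n - 2 * (if p ∣ n then F (n / p) else 0) + (if p ^ 2 ∣ n then F (n / p ^ 2) else 0) := by
  obtain ⟨k, m, hm, rfl⟩ := Nat.exists_eq_pow_mul_and_not_dvd hn.ne' p hp.ne_one
  have hpp : 0 < p := hp.pos
  have key : ∀ j, (∀ r ∈ Q, ¬ r ∣ p ^ j * m) ↔ (∀ r ∈ Q, ¬ r ∣ m) := by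
    intro j
    refine forall₂_congr fun r hr => not_congr ⟨fun h => ?_, fun h => h.mul_left _⟩
    rcases (hQ r hr).dvd_mul.1 h with h | h
    · have := (Nat.prime_dvd_prime_iff_eq (hQ r hr) hp).1 ((hQ r hr).dvd_of_dvd_pow h)
      subst this; exact absurd hr hpQ
    · exact h
  have hFj : ∀ j : ℕ, F (p ^ j * m) = if (∀ r ∈ Q, ¬ r ∣ m) then ((j : ℝ) + 1) * m.divisors.card else 0 := by
    intro j
    rw [hF]
    simp only [key j, dv_card_mul hp hm]
    push_cast; rfl
  rw [hFj]
  rcases k with _ | _ | k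
  · have h1 : ¬ p ∣ p ^ 0 * m := by simpa using hm
    have h2 : ¬ p ^ 2 ∣ p ^ 0 * m := fun h => h1 ((dvd_pow_self p two_ne_zero).trans h)
    rw [if_neg h1, if_neg h2]
    simp [hm]
  · have h1 : p ∣ p ^ (0 + 1) * m := by simp
    have h2 : ¬ p ^ 2 ∣ p ^ (0 + 1) * m := by
      simp only [zero_add, pow_one, pow_two]
      intro h; exact hm (Nat.dvd_of_mul_dvd_mul_left hpp h)
    have h3 : p ^ (0 + 1) * m / p = p ^ 0 * m := by
      simp [Nat.mul_div_cancel_left m hpp]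
    rw [if_pos h1, if_neg h2, h3, hFj]
    rw [if_neg (by intro h; exact h p (Finset.mem_insert_self _ _) h1)]
    split_ifs <;> push_cast <;> ring
  · have h1 : p ∣ p ^ (k + 1 + 1) * m := (dvd_pow_self p (by omega)).mul_right _
    have h2 : p ^ 2 ∣ p ^ (k + 1 + 1) * m := (pow_dvd_pow p (by omega)).mul_right _
    have h3 : p ^ (k + 1 + 1) * m / p = p ^ (k + 1) * m := by
      rw [pow_succ' p (k+1), mul_assoc, Nat.mul_div_cancel_left _ hpp]
    have h4 : p ^ (k + 1 + 1) * m / p ^ 2 = p ^ k * m := by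
      rw [show k + 1 + 1 = 2 + k by ring, pow_add, mul_assoc,
        Nat.mul_div_cancel_left _ (by positivity)]
    rw [if_pos h1, if_pos h2, h3, h4, hFj, hFj]
    rw [if_neg (by intro h; exact h p (Finset.mem_insert_self _ _) h1)]
    split_ifs <;> push_cast <;> ring

lemma dvT_insert {p : ℕ} (hp : p.Prime) (Q : Finset ℕ) (hQ : ∀ r ∈ Q, r.Prime)
    (hpQ : p ∉ Q) (x : ℝ) :
    dvT (insert p Q) x = dvT Q x - 2 * dvT Q (x / p) + dvT Q (x / (p : ℝ) ^ 2) := by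
  unfold dvT
  have e1 : ⌊x / (p : ℝ)⌋₊ = ⌊x⌋₊ / p := Nat.floor_div_natCast x p
  have e2 : ⌊x / (p : ℝ) ^ 2⌋₊ = ⌊x⌋₊ / p ^ 2 := by
    have := Nat.floor_div_natCast x (p ^ 2)
    push_cast at this; exact this
  rw [e1, e2, dv_reindex _ p hp.pos, dv_reindex _ (p ^ 2) (pow_pos hp.pos 2), Finset.mul_sum,
    ← Finset.sum_sub_distrib, ← Finset.sum_add_distrib]
  refine Finset.sum_congr rfl fun n hn => ?_
  exact dv_pt hp (by simp at hn; omega) Q hQ hpQ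
    (fun n => if (∀ r ∈ Q, ¬ r ∣ n) then (n.divisors.card : ℝ) else 0) (fun _ => rfl)

lemma dvM_insert {p : ℕ} (hp : p.Prime) (Q : Finset ℕ)
    (hpQ : p ∉ Q) (x : ℝ) (hx : 0 < x) :
    dvM (insert p Q) x = dvM Q x - 2 * dvM Q (x / p) + dvM Q (x / (p : ℝ) ^ 2) := by
  unfold dvM
  have hp1 : (1 : ℝ) < p := by exact_mod_cast hp.one_lt
  have hp0 : (p : ℝ) ≠ 0 := by positivity
  have hp2 : (p : ℝ) - 1 ≠ 0 := by linarith
  rw [Finset.prod_insert hpQ, Finset.sum_insert hpQ, Real.log_div hx.ne' hp0,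
    Real.log_div hx.ne' (by positivity), Real.log_pow]
  field_simp
  push_cast
  ring

lemma dvE_insert {p : ℕ} (hp : p.Prime) (Q : Finset ℕ) (hQ : ∀ r ∈ Q, r.Prime)
    (hpQ : p ∉ Q) (x : ℝ) (hx : 0 < x) :
    dvE (insert p Q) x = dvE Q x - 2 * dvE Q (x / p) + dvE Q (x / (p : ℝ) ^ 2) := by
  unfold dvE
  rw [dvT_insert hp Q hQ hpQ, dvM_insert hp Q hpQ x hx]; ring

lemma dvP_pos (Q : Finset ℕ) (θ : ℝ) : 0 < dvP Q θ :=
  Finset.prod_pos fun p _ => by positivity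

lemma dv_pow_div {p : ℕ} (hp : 0 < p) {x θ : ℝ} (hx : 0 < x) :
    (x / p) ^ θ = x ^ θ * (p : ℝ) ^ (-θ) := by
  have : (0 : ℝ) < p := by exact_mod_cast hp
  rw [Real.div_rpow hx.le this.le, Real.rpow_neg this.le]; rfl

lemma dv_pow_div2 {p : ℕ} (hp : 0 < p) {x θ : ℝ} (hx : 0 < x) :
    (x / (p : ℝ) ^ 2) ^ θ = x ^ θ * ((p : ℝ) ^ (-θ)) ^ 2 := by
  have h : (0 : ℝ) < p := by exact_mod_cast hp
  have : x / (p : ℝ) ^ 2 = x / p / p := by field_simp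
  rw [this, dv_pow_div hp (by positivity), dv_pow_div hp hx]; ring

lemma dvE_induct (c θ : ℝ) (R : Finset ℕ)
    (hR : ∀ y : ℝ, 0 < y → |dvE R y| ≤ c * (dvP R θ * y ^ θ)) (S : Finset ℕ) :
    Disjoint R S → (∀ r ∈ R ∪ S, r.Prime) →
    ∀ y : ℝ, 0 < y → |dvE (R ∪ S) y| ≤ c * (dvP (R ∪ S) θ * y ^ θ) := by
  classical
  induction S using Finset.induction_on with
  | empty => intro _ _; simpa using hR
  | insert p S hpS ih =>
    intro hd hpr y hy
    rw [Finset.union_insert] at hpr ⊢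
    rw [Finset.disjoint_insert_right] at hd
    have hp : p.Prime := hpr p (Finset.mem_insert_self _ _)
    have hpr' : ∀ r ∈ R ∪ S, r.Prime := fun r hr => hpr r (Finset.mem_insert_of_mem hr)
    have ih' := ih hd.2 hpr'
    have hpn : p ∉ R ∪ S := by simp [hd.1, hpS]
    have hp0 : (0 : ℝ) < p := by exact_mod_cast hp.pos
    rw [dvE_insert hp _ hpr' hpn y hy]
    have a1 := abs_le.1 (ih' y hy)
    have a2 := abs_le.1 (ih' (y / p) (by positivity))
    have a3 := abs_le.1 (ih' (y / (p : ℝ) ^ 2) (by positivity))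
    rw [dv_pow_div hp.pos hy] at a2
    rw [dv_pow_div2 hp.pos hy] at a3
    have : dvP (insert p (R ∪ S)) θ = (1 + (p : ℝ) ^ (-θ)) ^ 2 * dvP (R ∪ S) θ := by
      unfold dvP; rw [Finset.prod_insert hpn]
    rw [this, abs_le]
    constructor <;> nlinarith

lemma dvE_sub (c θ : ℝ) (R Q : Finset ℕ) (hRQ : R ⊆ Q) (hQ : ∀ r ∈ Q, r.Prime)
    (hR : ∀ y : ℝ, 0 < y → |dvE R y| ≤ c * (dvP R θ * y ^ θ)) :
    ∀ y : ℝ, 0 < y → |dvE Q y| ≤ c * (dvP Q θ * y ^ θ) := by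
  have := dvE_induct c θ R hR (Q \ R) Finset.disjoint_sdiff
  rw [Finset.union_sdiff_of_subset hRQ] at this
  exact this hQ

lemma dvP_eq (q : ℕ) (hq : 0 < q) (θ : ℝ) :
    (∑ d ∈ q.divisors, (ArithmeticFunction.moebius d : ℝ) ^ 2 * (d : ℝ) ^ (-θ)) ^ 2
      = dvP q.primeFactors θ := by
  unfold dvP
  rw [Finset.prod_pow]
  congr 1
  have h1 : ∑ d ∈ q.divisors, (ArithmeticFunction.moebius d : ℝ) ^ 2 * (d : ℝ) ^ (-θ)
      = ∑ d ∈ q.divisors with Squarefree d, (d : ℝ) ^ (-θ) := by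
    rw [Finset.sum_filter]
    refine Finset.sum_congr rfl fun d _ => ?_
    split_ifs with h
    · have := ArithmeticFunction.moebius_sq_eq_one_of_squarefree h
      have : ((ArithmeticFunction.moebius d : ℤ) : ℝ) ^ 2 = 1 := by exact_mod_cast this
      rw [this, one_mul]
    · simp [ArithmeticFunction.moebius_eq_zero_of_not_squarefree h]
  rw [h1, Nat.sum_divisors_filter_squarefree hq.ne', Finset.prod_one_add]
  have h2 : (UniqueFactorizationMonoid.normalizedFactors q).toFinset = q.primeFactors := by
    ext p; rw [Nat.factors_eq]; simp
  rw [h2]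
  refine Finset.sum_congr rfl fun s _ => ?_
  have : s.val.prod = ∏ p ∈ s, p := by simp
  rw [this]; push_cast
  rw [Real.finsetProd_rpow]
  intro i _; positivity

lemma dv_phi (q : ℕ) (hq : 0 < q) :
    (q.totient : ℝ) / q = ∏ p ∈ q.primeFactors, (1 - 1 / (p : ℝ)) := by
  have h := Nat.totient_eq_mul_prod_factors q
  have h' : (q.totient : ℝ) = q * ∏ p ∈ q.primeFactors, (1 - (p : ℝ)⁻¹) := by
    have := congrArg (fun r : ℚ => (r : ℝ)) h
    push_cast at this; exact this
  have : (q : ℝ) ≠ 0 := by exact_mod_cast hq.ne'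
  rw [h']; field_simp

lemma dv_bridge (C θ : ℝ) (q : ℕ) (hq : 0 < q) (x : ℝ)
    (h : |dvE q.primeFactors x| ≤ C * (dvP q.primeFactors θ * x ^ θ)
       + (if q = 1 then 0 else dvc q.primeFactors)) :
    |(∑ n ∈ (Finset.Icc 1 ⌊x⌋₊).filter (fun n => n.Coprime q), (n.divisors.card : ℝ)) -
      ((q.totient : ℝ) / q) ^ 2 * x * Real.log x -
      ((q.totient : ℝ) / q) ^ 2 * (2 * Real.eulerMascheroniConstant +
        2 * ∑ p ∈ q.primeFactors, Real.log p / ((p : ℝ) - 1) - 1) * x| ≤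
      C * (∑ d ∈ q.divisors, (ArithmeticFunction.moebius d : ℝ) ^ 2 * (d : ℝ) ^ (-θ)) ^ 2 * x ^ θ
        + (if q = 1 then 0 else (q.totient : ℝ) / q * 2 ^ (q.primeFactors.card + 1)) := by
  rw [dvP_eq q hq, dv_phi q hq]
  have e1 : (∏ p ∈ q.primeFactors, (1 - 1 / (p : ℝ))) * 2 ^ (q.primeFactors.card + 1)
      = dvc q.primeFactors := by
    unfold dvc
    have : ∀ p ∈ q.primeFactors, (2 - 2 / (p : ℝ)) = 2 * (1 - 1 / (p : ℝ)) := by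
      intro p _; ring
    rw [Finset.prod_congr rfl this, Finset.prod_mul_distrib, Finset.prod_const]; ring
  rw [e1]
  have e2 : (∑ n ∈ (Finset.Icc 1 ⌊x⌋₊).filter (fun n => n.Coprime q), (n.divisors.card : ℝ))
      = dvT q.primeFactors x := by
    unfold dvT
    rw [Finset.sum_filter]
    refine Finset.sum_congr rfl fun n hn => ?_
    have : n.Coprime q ↔ ∀ p ∈ q.primeFactors, ¬ p ∣ n := by
      constructor
      · intro h p hp hpn
        exact Nat.Prime.not_coprime_iff_dvd.2 ⟨p, Nat.prime_of_mem_primeFactors hp, hpn,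
          Nat.dvd_of_mem_primeFactors hp⟩ h
      · intro h
        by_contra hc
        obtain ⟨p, hp, h1, h2⟩ := Nat.Prime.not_coprime_iff_dvd.1 hc
        exact h p (Nat.mem_primeFactors.2 ⟨hp, h2, hq.ne'⟩) h1
    simp only [this]
  rw [e2]
  refine le_trans (le_of_eq ?_) (h.trans (le_of_eq (by ring)))
  congr 1
  unfold dvE dvM dvK; ring


lemma dv_mono_aux (g g' : ℝ → ℝ) (hg : ∀ z : ℝ, 0 ≤ z → HasDerivAt g (g' z) z)
    (hg' : ∀ z : ℝ, 0 ≤ z → 0 ≤ g' z) {z : ℝ} (hz : 0 ≤ z) : g 0 ≤ g z := by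
  have : MonotoneOn g (Set.Ici 0) := by
    apply monotoneOn_of_deriv_nonneg (convex_Ici 0)
    · exact fun z hz => (hg z hz).continuousAt.continuousWithinAt
    · intro z hz
      rw [interior_Ici] at hz
      exact (hg z (le_of_lt hz)).differentiableAt.differentiableWithinAt
    · intro z hz
      rw [interior_Ici] at hz
      rw [(hg z (le_of_lt hz)).deriv]
      exact hg' z (le_of_lt hz)
  exact this (by simp) hz hz

lemma dv_hlog {z : ℝ} (hz : 0 ≤ z) : HasDerivAt (fun z : ℝ => Real.log (1 + z)) (1 / (1 + z)) z := by
  have := (((hasDerivAt_id z).const_add 1)).log (by simp only [id]; positivity)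
  simpa using this

lemma dv_log_ub {z : ℝ} (hz : 0 ≤ z) : Real.log (1 + z) ≤ z - z ^ 2 / 2 + z ^ 3 / 3 := by
  have := dv_mono_aux (fun z => z - z ^ 2 / 2 + z ^ 3 / 3 - Real.log (1 + z))
    (fun z => 1 - 2 * z / 2 + 3 * z ^ 2 / 3 - 1 / (1 + z)) (by
      intro z hz
      have h1 := ((((hasDerivAt_id z).sub ((hasDerivAt_pow 2 z).div_const 2)).add
        ((hasDerivAt_pow 3 z).div_const 3)).sub (dv_hlog hz))
      exact h1.congr_deriv (by norm_num)) (by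
      intro z hz
      have : 1 - 2 * z / 2 + 3 * z ^ 2 / 3 - 1 / (1 + z) = z ^ 3 / (1 + z) := by
        have : 1 + z ≠ 0 := by positivity
        field_simp; ring
      show 0 ≤ 1 - 2 * z / 2 + 3 * z ^ 2 / 3 - 1 / (1 + z)
      rw [this]; positivity) hz
  simp at this; linarith

lemma dv_log_lb {z : ℝ} (hz : 0 ≤ z) :
    z - z ^ 2 / 2 + z ^ 3 / 3 - z ^ 4 / 4 ≤ Real.log (1 + z) := by
  have := dv_mono_aux (fun z => Real.log (1 + z) - (z - z ^ 2 / 2 + z ^ 3 / 3 - z ^ 4 / 4))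
    (fun z => 1 / (1 + z) - (1 - 2 * z / 2 + 3 * z ^ 2 / 3 - 4 * z ^ 3 / 4)) (by
      intro z hz
      have h1 := ((dv_hlog hz).sub ((((hasDerivAt_id z).sub ((hasDerivAt_pow 2 z).div_const 2)).add
        ((hasDerivAt_pow 3 z).div_const 3)).sub ((hasDerivAt_pow 4 z).div_const 4)))
      exact h1.congr_deriv (by norm_num)) (by
      intro z hz
      have : 1 / (1 + z) - (1 - 2 * z / 2 + 3 * z ^ 2 / 3 - 4 * z ^ 3 / 4) = z ^ 4 / (1 + z) := by
        have : 1 + z ≠ 0 := by positivity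
        field_simp; ring
      show 0 ≤ 1 / (1 + z) - (1 - 2 * z / 2 + 3 * z ^ 2 / 3 - 4 * z ^ 3 / 4)
      rw [this]; positivity) hz
  simp at this; linarith

lemma dv_log_trap {z : ℝ} (hz : 0 ≤ z) : Real.log (1 + z) ≤ (z + 1 - 1 / (1 + z)) / 2 := by
  have := dv_mono_aux (fun z => (z + 1 - 1 / (1 + z)) / 2 - Real.log (1 + z))
    (fun z => (1 + 1 / (1 + z) ^ 2) / 2 - 1 / (1 + z)) (by
      intro z hz
      have h0 : HasDerivAt (fun z : ℝ => 1 + z) 1 z := by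
        simpa using (hasDerivAt_id z).const_add (1:ℝ)
      have hne : 1 + z ≠ 0 := by positivity
      have h1 := ((((hasDerivAt_id z).add_const (1:ℝ)).sub (h0.inv hne)).div_const 2).sub (dv_hlog hz)
      refine (h1.congr_deriv ?_).congr_of_eventuallyEq ?_
      · field_simp; ring
      · filter_upwards with w; simp [one_div]) (by
      intro z hz
      have : (1 + 1 / (1 + z) ^ 2) / 2 - 1 / (1 + z) = z ^ 2 / (2 * (1 + z) ^ 2) := by
        have : 1 + z ≠ 0 := by positivity
        field_simp; ring
      show 0 ≤ (1 + 1 / (1 + z) ^ 2) / 2 - 1 / (1 + z)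
      rw [this]; positivity) hz
  simp at this
  rw [one_div]; linarith

lemma dv_harm_ub (N : ℕ) (hN : 1 ≤ N) :
    (harmonic N : ℝ) ≤ Real.eulerMascheroniConstant + Real.log N + 1 / (2 * N) := by
  have hmono : Monotone (fun k : ℕ => (harmonic (k+1) : ℝ) - Real.log ((k + 1 : ℕ)) - 1 / (2 * ((k+1:ℕ):ℝ))) := by
    refine monotone_nat_of_le_succ fun k => ?_
    have h1 := dv_log_trap (z := 1 / ((k+1:ℕ):ℝ)) (by positivity)
    have hpos : (0:ℝ) < ((k+1:ℕ):ℝ) := by positivity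
    have h2 : Real.log (1 + 1 / ((k+1:ℕ):ℝ)) = Real.log ((k+1+1:ℕ)) - Real.log ((k+1:ℕ)) := by
      rw [← Real.log_div (by positivity) (by positivity)]
      congr 1; push_cast; field_simp
    rw [h2] at h1
    have h3 : (harmonic (k+1+1) : ℝ) = harmonic (k+1) + 1 / ((k+1+1:ℕ):ℝ) := by
      rw [harmonic_succ]; push_cast; rw [one_div]
    rw [h3]
    have h4 : 1 / (1 + 1 / ((k+1:ℕ):ℝ)) = 1 - 1 / ((k+1+1:ℕ):ℝ) := by
      push_cast; field_simp; ring
    rw [h4] at h1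
    have e1 : 1 / (2 * ((k+1+1:ℕ):ℝ)) = (1 / ((k+1+1:ℕ):ℝ)) / 2 := by field_simp
    have e2 : 1 / (2 * ((k+1:ℕ):ℝ)) = (1 / ((k+1:ℕ):ℝ)) / 2 := by field_simp
    rw [e1, e2]; linarith
  have hlim : Filter.Tendsto (fun k : ℕ => (harmonic (k+1) : ℝ) - Real.log ((k + 1 : ℕ)) - 1 / (2 * ((k+1:ℕ):ℝ)))
      Filter.atTop (nhds (Real.eulerMascheroniConstant - 0)) := by
    refine Filter.Tendsto.sub ?_ ?_
    · exact (Filter.tendsto_add_atTop_iff_nat (f := fun n : ℕ => (harmonic n : ℝ) - Real.log n) 1).2 Real.tendsto_harmonic_sub_log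
    · have := (tendsto_one_div_add_atTop_nhds_zero_nat (𝕜 := ℝ)).const_mul (1/2)
      refine (this.congr fun k => ?_).trans (by simp)
      push_cast; field_simp
  obtain ⟨k, rfl⟩ : ∃ k, N = k + 1 := ⟨N - 1, by omega⟩
  have := hmono.ge_of_tendsto hlim k
  linarith

lemma dv_harm_lb (N : ℕ) :
    Real.eulerMascheroniConstant + Real.log (N + 1 / 2) ≤ (harmonic N : ℝ) := by
  have hmono : Antitone (fun k : ℕ => (harmonic k : ℝ) - Real.log (k + 1 / 2)) := by
    refine antitone_nat_of_succ_le fun k => ?_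
    have h1 := Real.le_log_one_add_of_nonneg (x := 1 / ((k:ℝ) + 1/2)) (by positivity)
    have h2 : Real.log (1 + 1 / ((k:ℝ) + 1/2)) = Real.log ((k+1:ℕ) + 1/2) - Real.log (k + 1/2) := by
      rw [← Real.log_div (by positivity) (by positivity)]
      congr 1; push_cast; field_simp; ring
    have h3 : (harmonic (k+1) : ℝ) = harmonic k + 1 / ((k:ℝ)+1) := by
      rw [harmonic_succ]; push_cast; rw [one_div]
    have h4 : 2 * (1 / ((k:ℝ) + 1/2)) / (1 / ((k:ℝ) + 1/2) + 2) = 1 / ((k:ℝ)+1) := by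
      field_simp; ring
    rw [h4, h2] at h1
    rw [h3]; linarith
  have hlim : Filter.Tendsto (fun k : ℕ => (harmonic k : ℝ) - Real.log (k + 1 / 2))
      Filter.atTop (nhds (Real.eulerMascheroniConstant)) := by
    refine tendsto_of_tendsto_of_tendsto_of_le_of_le' Real.tendsto_harmonic_sub_log_add_one Real.tendsto_harmonic_sub_log ?_ ?_
    · filter_upwards with k
      have := Real.log_le_log (x := (k:ℝ) + 1/2) (y := k + 1) (by positivity) (by linarith)
      linarith
    · filter_upwards [Filter.eventually_ge_atTop 1] with k hk
      have hk' : (1:ℝ) ≤ k := by exact_mod_cast hk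
      have := Real.log_le_log (x := (k:ℝ)) (y := (k:ℝ) + 1/2) (by positivity) (by linarith)
      linarith
  have := hmono.le_of_tendsto hlim N
  linarith


lemma dv_lg_aux (p m : ℝ) (hm : 0 < m) (hp : 0 < p) (h : p * p = m + 1) :
    Real.log m + ((1 / m) - (1 / m) ^ 2 / 2 + (1 / m) ^ 3 / 3 - (1 / m) ^ 4 / 4) ≤ 2 * Real.log p ∧
    2 * Real.log p ≤ Real.log m + ((1 / m) - (1 / m) ^ 2 / 2 + (1 / m) ^ 3 / 3) := by
  have h1 : 2 * Real.log p = Real.log m + Real.log (1 + 1 / m) := by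
    rw [← Real.log_mul (by positivity) (by positivity), mul_add, mul_one_div_cancel hm.ne', mul_one,
      ← h, Real.log_mul hp.ne' hp.ne']; ring
  have hz : 0 ≤ 1 / m := by positivity
  have h2 := dv_log_ub hz
  have h3 := dv_log_lb hz
  constructor <;> linarith

lemma dvl7 : 1.945909 < Real.log 7 ∧ Real.log 7 < 1.945912 := by
  have h := dv_lg_aux 7 48 (by norm_num) (by norm_num) (by norm_num)
  have hm : Real.log 48 = 4 * Real.log 2 + 1 * Real.log 3 := by
    rw [show (48:ℝ) = ((2:ℝ)^4) * ((3:ℝ)^1) by norm_num]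
    repeat rw [Real.log_mul (by norm_num) (by norm_num)]
    simp only [Real.log_pow]; norm_num
  rw [hm] at h
  have h2 := Real.log_two_gt_d9
  have h2' := Real.log_two_lt_d9
  have h3 := Real.log_three_gt_d9
  have h3' := Real.log_three_lt_d9
  have h5 := Real.log_five_gt_d9
  have h5' := Real.log_five_lt_d9
  norm_num at *
  constructor <;> linarith

lemma dvl11 : 2.397894 < Real.log 11 ∧ Real.log 11 < 2.397897 := by
  have h := dv_lg_aux 11 120 (by norm_num) (by norm_num) (by norm_num)
  have hm : Real.log 120 = 3 * Real.log 2 + 1 * Real.log 3 + 1 * Real.log 5 := by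
    rw [show (120:ℝ) = ((2:ℝ)^3) * ((3:ℝ)^1) * ((5:ℝ)^1) by norm_num]
    repeat rw [Real.log_mul (by norm_num) (by norm_num)]
    simp only [Real.log_pow]; norm_num
  rw [hm] at h
  have h2 := Real.log_two_gt_d9
  have h2' := Real.log_two_lt_d9
  have h3 := Real.log_three_gt_d9
  have h3' := Real.log_three_lt_d9
  have h5 := Real.log_five_gt_d9
  have h5' := Real.log_five_lt_d9
  norm_num at *
  constructor <;> linarith

lemma dvl13 : 2.564946 < Real.log 13 ∧ Real.log 13 < 2.564953 := by
  have h := dv_lg_aux 13 168 (by norm_num) (by norm_num) (by norm_num)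
  have hm : Real.log 168 = 3 * Real.log 2 + 1 * Real.log 3 + 1 * Real.log 7 := by
    rw [show (168:ℝ) = ((2:ℝ)^3) * ((3:ℝ)^1) * ((7:ℝ)^1) by norm_num]
    repeat rw [Real.log_mul (by norm_num) (by norm_num)]
    simp only [Real.log_pow]; norm_num
  rw [hm] at h
  have h2 := Real.log_two_gt_d9
  have h2' := Real.log_two_lt_d9
  have h3 := Real.log_three_gt_d9
  have h3' := Real.log_three_lt_d9
  have h5 := Real.log_five_gt_d9
  have h5' := Real.log_five_lt_d9
  have g7 := dvl7
  norm_num at *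
  constructor <;> linarith

lemma dvl17 : 2.833210 < Real.log 17 ∧ Real.log 17 < 2.833217 := by
  have h := dv_lg_aux 17 288 (by norm_num) (by norm_num) (by norm_num)
  have hm : Real.log 288 = 5 * Real.log 2 + 2 * Real.log 3 := by
    rw [show (288:ℝ) = ((2:ℝ)^5) * ((3:ℝ)^2) by norm_num]
    repeat rw [Real.log_mul (by norm_num) (by norm_num)]
    simp only [Real.log_pow]; norm_num
  rw [hm] at h
  have h2 := Real.log_two_gt_d9
  have h2' := Real.log_two_lt_d9
  have h3 := Real.log_three_gt_d9
  have h3' := Real.log_three_lt_d9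
  have h5 := Real.log_five_gt_d9
  have h5' := Real.log_five_lt_d9
  norm_num at *
  constructor <;> linarith

lemma dvl19 : 2.944435 < Real.log 19 ∧ Real.log 19 < 2.944442 := by
  have h := dv_lg_aux 19 360 (by norm_num) (by norm_num) (by norm_num)
  have hm : Real.log 360 = 3 * Real.log 2 + 2 * Real.log 3 + 1 * Real.log 5 := by
    rw [show (360:ℝ) = ((2:ℝ)^3) * ((3:ℝ)^2) * ((5:ℝ)^1) by norm_num]
    repeat rw [Real.log_mul (by norm_num) (by norm_num)]
    simp only [Real.log_pow]; norm_num
  rw [hm] at h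
  have h2 := Real.log_two_gt_d9
  have h2' := Real.log_two_lt_d9
  have h3 := Real.log_three_gt_d9
  have h3' := Real.log_three_lt_d9
  have h5 := Real.log_five_gt_d9
  have h5' := Real.log_five_lt_d9
  norm_num at *
  constructor <;> linarith

lemma dvl23 : 3.135491 < Real.log 23 ∧ Real.log 23 < 3.135498 := by
  have h := dv_lg_aux 23 528 (by norm_num) (by norm_num) (by norm_num)
  have hm : Real.log 528 = 4 * Real.log 2 + 1 * Real.log 3 + 1 * Real.log 11 := by
    rw [show (528:ℝ) = ((2:ℝ)^4) * ((3:ℝ)^1) * ((11:ℝ)^1) by norm_num]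
    repeat rw [Real.log_mul (by norm_num) (by norm_num)]
    simp only [Real.log_pow]; norm_num
  rw [hm] at h
  have h2 := Real.log_two_gt_d9
  have h2' := Real.log_two_lt_d9
  have h3 := Real.log_three_gt_d9
  have h3' := Real.log_three_lt_d9
  have h5 := Real.log_five_gt_d9
  have h5' := Real.log_five_lt_d9
  have g11 := dvl11
  norm_num at *
  constructor <;> linarith

lemma dvl29 : 3.367292 < Real.log 29 ∧ Real.log 29 < 3.367299 := by
  have h := dv_lg_aux 29 840 (by norm_num) (by norm_num) (by norm_num)
  have hm : Real.log 840 = 3 * Real.log 2 + 1 * Real.log 3 + 1 * Real.log 5 + 1 * Real.log 7 := by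
    rw [show (840:ℝ) = ((2:ℝ)^3) * ((3:ℝ)^1) * ((5:ℝ)^1) * ((7:ℝ)^1) by norm_num]
    repeat rw [Real.log_mul (by norm_num) (by norm_num)]
    simp only [Real.log_pow]; norm_num
  rw [hm] at h
  have h2 := Real.log_two_gt_d9
  have h2' := Real.log_two_lt_d9
  have h3 := Real.log_three_gt_d9
  have h3' := Real.log_three_lt_d9
  have h5 := Real.log_five_gt_d9
  have h5' := Real.log_five_lt_d9
  have g7 := dvl7
  norm_num at *
  constructor <;> linarith

lemma dvl31 : 3.433984 < Real.log 31 ∧ Real.log 31 < 3.433991 := by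
  have h := dv_lg_aux 31 960 (by norm_num) (by norm_num) (by norm_num)
  have hm : Real.log 960 = 6 * Real.log 2 + 1 * Real.log 3 + 1 * Real.log 5 := by
    rw [show (960:ℝ) = ((2:ℝ)^6) * ((3:ℝ)^1) * ((5:ℝ)^1) by norm_num]
    repeat rw [Real.log_mul (by norm_num) (by norm_num)]
    simp only [Real.log_pow]; norm_num
  rw [hm] at h
  have h2 := Real.log_two_gt_d9
  have h2' := Real.log_two_lt_d9
  have h3 := Real.log_three_gt_d9
  have h3' := Real.log_three_lt_d9
  have h5 := Real.log_five_gt_d9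
  have h5' := Real.log_five_lt_d9
  norm_num at *
  constructor <;> linarith

lemma dvl37 : 3.610914 < Real.log 37 ∧ Real.log 37 < 3.610921 := by
  have h := dv_lg_aux 37 1368 (by norm_num) (by norm_num) (by norm_num)
  have hm : Real.log 1368 = 3 * Real.log 2 + 2 * Real.log 3 + 1 * Real.log 19 := by
    rw [show (1368:ℝ) = ((2:ℝ)^3) * ((3:ℝ)^2) * ((19:ℝ)^1) by norm_num]
    repeat rw [Real.log_mul (by norm_num) (by norm_num)]
    simp only [Real.log_pow]; norm_num
  rw [hm] at h
  have h2 := Real.log_two_gt_d9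
  have h2' := Real.log_two_lt_d9
  have h3 := Real.log_three_gt_d9
  have h3' := Real.log_three_lt_d9
  have h5 := Real.log_five_gt_d9
  have h5' := Real.log_five_lt_d9
  have g19 := dvl19
  norm_num at *
  constructor <;> linarith

lemma dvl41 : 3.713569 < Real.log 41 ∧ Real.log 41 < 3.713576 := by
  have h := dv_lg_aux 41 1680 (by norm_num) (by norm_num) (by norm_num)
  have hm : Real.log 1680 = 4 * Real.log 2 + 1 * Real.log 3 + 1 * Real.log 5 + 1 * Real.log 7 := by
    rw [show (1680:ℝ) = ((2:ℝ)^4) * ((3:ℝ)^1) * ((5:ℝ)^1) * ((7:ℝ)^1) by norm_num]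
    repeat rw [Real.log_mul (by norm_num) (by norm_num)]
    simp only [Real.log_pow]; norm_num
  rw [hm] at h
  have h2 := Real.log_two_gt_d9
  have h2' := Real.log_two_lt_d9
  have h3 := Real.log_three_gt_d9
  have h3' := Real.log_three_lt_d9
  have h5 := Real.log_five_gt_d9
  have h5' := Real.log_five_lt_d9
  have g7 := dvl7
  norm_num at *
  constructor <;> linarith

lemma dvl43 : 3.761197 < Real.log 43 ∧ Real.log 43 < 3.761204 := by
  have h := dv_lg_aux 43 1848 (by norm_num) (by norm_num) (by norm_num)
  have hm : Real.log 1848 = 3 * Real.log 2 + 1 * Real.log 3 + 1 * Real.log 7 + 1 * Real.log 11 := by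
    rw [show (1848:ℝ) = ((2:ℝ)^3) * ((3:ℝ)^1) * ((7:ℝ)^1) * ((11:ℝ)^1) by norm_num]
    repeat rw [Real.log_mul (by norm_num) (by norm_num)]
    simp only [Real.log_pow]; norm_num
  rw [hm] at h
  have h2 := Real.log_two_gt_d9
  have h2' := Real.log_two_lt_d9
  have h3 := Real.log_three_gt_d9
  have h3' := Real.log_three_lt_d9
  have h5 := Real.log_five_gt_d9
  have h5' := Real.log_five_lt_d9
  have g7 := dvl7
  have g11 := dvl11
  norm_num at *
  constructor <;> linarith

lemma dvl47 : 3.850144 < Real.log 47 ∧ Real.log 47 < 3.850151 := by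
  have h := dv_lg_aux 47 2208 (by norm_num) (by norm_num) (by norm_num)
  have hm : Real.log 2208 = 5 * Real.log 2 + 1 * Real.log 3 + 1 * Real.log 23 := by
    rw [show (2208:ℝ) = ((2:ℝ)^5) * ((3:ℝ)^1) * ((23:ℝ)^1) by norm_num]
    repeat rw [Real.log_mul (by norm_num) (by norm_num)]
    simp only [Real.log_pow]; norm_num
  rw [hm] at h
  have h2 := Real.log_two_gt_d9
  have h2' := Real.log_two_lt_d9
  have h3 := Real.log_three_gt_d9
  have h3' := Real.log_three_lt_d9
  have h5 := Real.log_five_gt_d9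
  have h5' := Real.log_five_lt_d9
  have g23 := dvl23
  norm_num at *
  constructor <;> linarith

lemma dvK_bds : 0.15435 < dvK ∧ dvK < 0.15448 := by
  have h1 := dv_harm_ub 49 (by norm_num)
  have h2 := dv_harm_lb 49
  have hH : ((harmonic 49 : ℚ) : ℝ) = 13881256687139135026631/3099044504245996706400 := by
    have : harmonic 49 = 13881256687139135026631/3099044504245996706400 := by
      simp only [harmonic, Finset.sum_range_succ, Finset.sum_range_zero]; norm_num
    rw [this]; norm_num
  rw [hH] at h1 h2
  have e1 : Real.log ((49:ℕ):ℝ) = 2 * Real.log 7 := by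
    rw [show ((49:ℕ):ℝ) = 7 ^ 2 by norm_num, Real.log_pow]; norm_num
  have e2 : Real.log (((49:ℕ):ℝ) + 1 / 2) = 2 * Real.log 3 + Real.log 11 - Real.log 2 := by
    rw [show ((49:ℕ):ℝ) + 1 / 2 = 3 ^ 2 * 11 / 2 by norm_num, Real.log_div (by norm_num) (by norm_num),
      Real.log_mul (by norm_num) (by norm_num), Real.log_pow]; norm_num
  rw [e1] at h1
  rw [e2] at h2
  have h2' := Real.log_two_lt_d9
  have h3 := Real.log_three_gt_d9
  have h7 := dvl7
  have h11 := dvl11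
  unfold dvK
  norm_num at *
  constructor <;> linarith


noncomputable def dvD : ℝ := 3 - 2 * (Real.log 2 + dvK)

lemma dvE_empty (y : ℝ) : dvE ∅ y =
    (∑ n ∈ Finset.Icc 1 ⌊y⌋₊, (n.divisors.card : ℝ)) - y * (Real.log y + dvK) := by
  simp [dvE, dvT, dvM]

lemma dv_hyp_nat (M N : ℕ) (h1 : N * N ≤ M) (h2 : M < (N + 1) * (N + 1)) :
    (∑ n ∈ Finset.Icc 1 M, n.divisors.card) + N * N = 2 * ∑ k ∈ Finset.Icc 1 N, M / k := by
  classical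
  set S : Finset (ℕ × ℕ) := (Finset.Icc 1 M ×ˢ Finset.Icc 1 M).filter (fun z => z.1 * z.2 ≤ M) with hS
  set A : Finset (ℕ × ℕ) := S.filter (fun z => z.1 ≤ N) with hA
  set B : Finset (ℕ × ℕ) := S.filter (fun z => z.2 ≤ N) with hB
  have cS : S.card = ∑ n ∈ Finset.Icc 1 M, n.divisors.card := by
    rw [Finset.card_eq_sum_card_fiberwise (f := fun z => z.1 * z.2) (t := Finset.Icc 1 M)]
    · refine Finset.sum_congr rfl fun n hn => ?_
      simp only [Finset.mem_Icc] at hn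
      refine Finset.card_bij' (fun z _ => z.1) (fun d _ => (d, n / d)) ?_ ?_ ?_ ?_
      · intro z hz
        simp only [Finset.mem_filter] at hz
        rw [Nat.mem_divisors]
        exact ⟨⟨z.2, hz.2.symm⟩, by omega⟩
      · intro d hd
        rw [Nat.mem_divisors] at hd
        have hd0 : 0 < d := Nat.pos_of_dvd_of_pos hd.1 (by omega)
        have hdn : d ≤ n := Nat.le_of_dvd (by omega) hd.1
        have hm : d * (n / d) = n := Nat.mul_div_cancel' hd.1
        have h3 : 0 < n / d := Nat.div_pos hdn hd0
        have h4 : n / d ≤ n := Nat.div_le_self _ _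
        simp only [hS, Finset.mem_filter, Finset.mem_product, Finset.mem_Icc]
        exact ⟨⟨⟨⟨hd0, by omega⟩, ⟨h3, by omega⟩⟩, by rw [hm]; exact hn.2⟩, hm⟩
      · intro z hz
        simp only [hS, Finset.mem_filter, Finset.mem_product, Finset.mem_Icc] at hz
        ext
        · rfl
        · simp only
          rw [← hz.2, Nat.mul_div_cancel_left _ (by omega)]
      · intros; rfl
    · intro z hz
      simp only [hS, Finset.coe_filter, Finset.mem_product, Finset.mem_Icc, Set.mem_ofPred_eq,
        Finset.coe_Icc, Set.mem_Icc] at hz ⊢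
      exact ⟨Nat.mul_pos (by omega) (by omega), hz.2⟩
  have hNM : N ≤ M := le_trans (by nlinarith) h1
  have cA : A.card = ∑ k ∈ Finset.Icc 1 N, M / k := by
    rw [Finset.card_eq_sum_card_fiberwise (f := fun z => z.1) (t := Finset.Icc 1 N)]
    · refine Finset.sum_congr rfl fun k hk => ?_
      simp only [Finset.mem_Icc] at hk
      have : (Finset.Icc 1 (M / k)).card = M / k := by simp
      rw [← this]
      have hk0 : 0 < k := by omega
      refine Finset.card_bij' (fun z _ => z.2) (fun b _ => (k, b)) ?_ ?_ ?_ ?_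
      · intro z hz
        simp only [hA, hS, Finset.mem_filter, Finset.mem_product, Finset.mem_Icc] at hz ⊢
        refine ⟨hz.1.1.1.2.1, ?_⟩
        rw [Nat.le_div_iff_mul_le hk0, mul_comm, ← hz.2]
        exact hz.1.1.2
      · intro b hb
        simp only [Finset.mem_Icc] at hb
        have hb2 := hb.2
        rw [Nat.le_div_iff_mul_le hk0, mul_comm] at hb2
        have : b ≤ M := le_trans hb.2 (Nat.div_le_self _ _)
        simp only [hA, hS, Finset.mem_filter, Finset.mem_product, Finset.mem_Icc]
        exact ⟨⟨⟨⟨⟨hk0, by omega⟩, ⟨hb.1, this⟩⟩, hb2⟩, hk.2⟩, trivial⟩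
      · intro z hz
        simp only [Finset.mem_filter] at hz
        ext
        · exact hz.2.symm
        · rfl
      · intros; rfl
    · intro z hz
      simp only [hA, hS, Finset.coe_filter, Finset.mem_filter, Finset.mem_product, Finset.mem_Icc, Set.mem_ofPred_eq,
        Finset.coe_Icc, Set.mem_Icc] at hz ⊢
      omega
  have cB : B.card = A.card := by
    refine Finset.card_bij' (fun z _ => (z.2, z.1)) (fun z _ => (z.2, z.1)) ?_ ?_ ?_ ?_
    · intro z hz
      simp only [hA, hB, hS, Finset.mem_filter, Finset.mem_product, Finset.mem_Icc] at hz ⊢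
      rw [mul_comm]; tauto
    · intro z hz
      simp only [hA, hB, hS, Finset.mem_filter, Finset.mem_product, Finset.mem_Icc] at hz ⊢
      rw [mul_comm]; tauto
    · intros; rfl
    · intros; rfl
  have hU : A ∪ B = S := by
    ext z
    simp only [hA, hB, Finset.mem_union, Finset.mem_filter]
    constructor
    · tauto
    · intro hz
      have hz' := hz
      simp only [hS, Finset.mem_filter, Finset.mem_product, Finset.mem_Icc] at hz'
      by_contra hc
      have : N + 1 ≤ z.1 ∧ N + 1 ≤ z.2 := by
        constructor <;> by_contra hh <;> apply hc
        · left; exact ⟨hz, by omega⟩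
        · right; exact ⟨hz, by omega⟩
      have := Nat.mul_le_mul this.1 this.2
      omega
  have hI : A ∩ B = Finset.Icc 1 N ×ˢ Finset.Icc 1 N := by
    ext z
    simp only [hA, hB, hS, Finset.mem_inter, Finset.mem_filter, Finset.mem_product, Finset.mem_Icc]
    constructor
    · tauto
    · intro h
      have := Nat.mul_le_mul h.1.2 h.2.2
      have : z.1 * z.2 ≤ M := by omega
      omega
  have hc := Finset.card_union_add_card_inter A B
  rw [hU, hI, cB, cS, cA, Finset.card_product, Nat.card_Icc] at hc
  simp only [Nat.add_sub_cancel] at hc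
  omega

lemma dv_log_q {t : ℝ} (h1 : |t| ≤ 1 / 10) : t - t ^ 2 / (9 / 5) ≤ Real.log (1 + t) := by
  have h := Real.abs_log_sub_add_sum_range_le (x := -t) (by rw [abs_neg]; linarith) 3
  simp only [Finset.sum_range_succ, Finset.sum_range_zero, abs_neg, sub_neg_eq_add] at h
  norm_num at h
  have h2 := (abs_le.1 h).1
  have h3 : |t| ^ 4 / (1 - |t|) ≤ t ^ 2 * (1 / 90) := by
    rw [div_le_iff₀ (by linarith)]
    have e4 : |t| ^ 4 = t ^ 2 * t ^ 2 := by
      rw [show |t| ^ 4 = |t| ^ 2 * |t| ^ 2 by ring, sq_abs]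
    have h5 : t ^ 2 ≤ 1 / 100 := by
      rw [← sq_abs]; nlinarith [abs_nonneg t]
    rw [e4]
    nlinarith [sq_nonneg t]
  have h4 : t ^ 3 ≥ - (t ^ 2 * (1 / 10)) := by
    nlinarith [sq_nonneg t, (abs_le.1 h1).1]
  nlinarith [sq_nonneg t]

lemma dv_harm_eq (N : ℕ) : (harmonic N : ℝ) = ∑ k ∈ Finset.Icc 1 N, 1 / (k : ℝ) := by
  rw [harmonic_eq_sum_Icc]; push_cast
  exact Finset.sum_congr rfl fun k _ => by rw [one_div]

lemma dv_big (y : ℝ) (hy : 25 ≤ y) : |dvE ∅ y| ≤ √y + 0.28 := by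
  have hy0 : 0 < y := by linarith
  set M := ⌊y⌋₊ with hM
  set N := Nat.sqrt M with hN
  set w := √y with hw
  have hww : w * w = y := Real.mul_self_sqrt hy0.le
  have hw5 : 5 ≤ w := by
    rw [hw]; apply Real.le_sqrt_of_sq_le; linarith
  have n1 : N * N ≤ M := Nat.sqrt_le M
  have n2 : M < (N + 1) * (N + 1) := Nat.lt_succ_sqrt M
  have hMy : (M : ℝ) ≤ y := Nat.floor_le hy0.le
  have r1 : (N : ℝ) ≤ w := by
    have : ((N * N : ℕ) : ℝ) ≤ M := by exact_mod_cast n1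
    push_cast at this
    by_contra hc
    push Not at hc
    nlinarith
  have r2 : w < (N : ℝ) + 1 := by
    have h3 : y < M + 1 := Nat.lt_floor_add_one y
    have : ((M + 1 : ℕ) : ℝ) ≤ (((N + 1) * (N + 1) : ℕ) : ℝ) := by exact_mod_cast n2
    push_cast at this
    by_contra hc
    push Not at hc
    nlinarith
  have hN5 : (5 : ℝ) ≤ N := by
    have : (4 : ℝ) < N := by linarith
    have : 4 < N := by exact_mod_cast this
    exact_mod_cast this
  have hyp := dv_hyp_nat M N n1 n2
  have hypR : (∑ n ∈ Finset.Icc 1 M, (n.divisors.card : ℝ)) =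
      2 * ∑ k ∈ Finset.Icc 1 N, ((M / k : ℕ) : ℝ) - N * N := by
    have : (((∑ n ∈ Finset.Icc 1 M, n.divisors.card) + N * N : ℕ) : ℝ) =
      ((2 * ∑ k ∈ Finset.Icc 1 N, M / k : ℕ) : ℝ) := by rw [hyp]
    rw [Nat.cast_add, Nat.cast_mul, Nat.cast_mul, Nat.cast_sum, Nat.cast_sum] at this
    push_cast at this ⊢
    linarith
  have hf : ∀ k : ℕ, M / k = ⌊y / k⌋₊ := fun k => by rw [hM, Nat.floor_div_natCast]
  have hup : ∑ k ∈ Finset.Icc 1 N, ((M / k : ℕ) : ℝ) ≤ y * harmonic N := by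
    rw [dv_harm_eq, Finset.mul_sum]
    refine Finset.sum_le_sum fun k hk => ?_
    rw [hf, mul_one_div]
    exact Nat.floor_le (by positivity)
  have hlo : y * harmonic N - N ≤ ∑ k ∈ Finset.Icc 1 N, ((M / k : ℕ) : ℝ) := by
    have : (N : ℝ) = ∑ k ∈ Finset.Icc 1 N, (1 : ℝ) := by simp
    rw [dv_harm_eq, Finset.mul_sum, this, ← Finset.sum_sub_distrib]
    refine Finset.sum_le_sum fun k hk => ?_
    rw [hf, mul_one_div]
    have := Nat.lt_floor_add_one (y / k)
    linarith
  have hlogy : Real.log y = 2 * Real.log w := by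
    rw [← hww, Real.log_mul (by positivity) (by positivity)]; ring
  obtain ⟨s, hs⟩ : ∃ s, w = N + s := ⟨w - N, by ring⟩
  have hs0 : 0 ≤ s := by linarith
  have hs1 : s ≤ 1 := by linarith
  have hN0 : (0:ℝ) < N := by linarith
  have hN1 : 1 ≤ N := by
    have : (0:ℝ) < (N:ℝ) := hN0
    exact_mod_cast this
  rw [dvE_empty, ← hM, hypR, hlogy, abs_le]
  unfold dvK
  constructor
  · have hH := dv_harm_lb N
    have hw0 : (0:ℝ) < w := by linarith
    set t := (1 / 2 - s) / w with ht
    have htw : t * w = 1 / 2 - s := by rw [ht]; field_simp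
    have hta : |t| ≤ 1 / 10 := by
      rw [ht, abs_div, abs_of_pos hw0, div_le_iff₀ hw0]
      rw [abs_le]; constructor <;> linarith
    have hq := dv_log_q hta
    have he : Real.log (N + 1 / 2) = Real.log w + Real.log (1 + t) := by
      have : (0:ℝ) < 1 + t := by linarith [(abs_le.1 hta).1]
      rw [← Real.log_mul hw0.ne' this.ne']
      congr 1
      rw [mul_add, mul_comm w t, htw, hs]; ring
    have hH2 := mul_le_mul_of_nonneg_left hH hy0.le
    rw [he] at hH2
    have hq2 := mul_le_mul_of_nonneg_left hq hy0.le
    have e1 : y * (t - t ^ 2 / (9 / 5)) = w * (1 / 2 - s) - (1 / 2 - s) ^ 2 / (9 / 5) := by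
      rw [← htw, ← hww]; ring
    rw [e1] at hq2
    have e2 : y - N * N = 2 * w * s - s ^ 2 := by rw [← hww, hs]; ring
    have e3 : (N : ℝ) = w - s := by linarith
    nlinarith [hlo, hH2, hq2, e2, e3, mul_nonneg hs0 (sub_nonneg.2 hs1)]
  · have hH := dv_harm_ub N hN1
    set r := s / N with hr
    have hrN : r * N = s := by rw [hr]; field_simp
    have hr0 : 0 ≤ r := by positivity
    have he : Real.log N = Real.log w - Real.log (1 + r) := by
      have h1r : (0:ℝ) < 1 + r := by linarith
      have : w = N * (1 + r) := by rw [hs, ← hrN]; ring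
      rw [this, Real.log_mul hN0.ne' h1r.ne']; ring
    have hl : r - r ^ 2 / 2 ≤ Real.log (1 + r) := by
      have hr1 : r ≤ 1 := by rw [hr, div_le_one hN0]; linarith
      have := dv_log_lb hr0
      have : r ^ 4 ≤ r ^ 3 := pow_le_pow_of_le_one hr0 hr1 (by norm_num)
      have : 0 ≤ r ^ 3 := by positivity
      linarith
    have hH2 := mul_le_mul_of_nonneg_left hH hy0.le
    rw [he] at hH2
    have hq2 := mul_le_mul_of_nonneg_left hl hy0.le
    have e1 : y * (r - r ^ 2 / 2) = N * s + 3 / 2 * s ^ 2 - s ^ 2 * r ^ 2 / 2 := by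
      rw [← hww, hs, ← hrN]; ring
    rw [e1] at hq2
    have e2 : y - N * N = 2 * N * s + s ^ 2 := by rw [← hww, hs]; ring
    have e3 : y * (1 / (2 * N)) = (N + 2 * s + s * r) / 2 := by
      rw [← hww, hs, ← hrN]; field_simp; ring
    have hr5 : r ≤ s / 5 := by
      rw [hr]; exact div_le_div_of_nonneg_left hs0 (by norm_num) hN5
    have b1 : s * r ≤ s ^ 2 / 5 := by
      have := mul_le_mul_of_nonneg_left hr5 hs0
      linarith
    have b2 : s ^ 2 * r ^ 2 ≤ s ^ 2 / 25 := by
      have h15 : r ≤ 1 / 5 := by linarith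
      have : r ^ 2 ≤ 1 / 25 := by
        have := mul_self_le_mul_self hr0 h15
        linarith
      have := mul_le_mul_of_nonneg_left this (sq_nonneg s)
      linarith
    have b3 := sq_nonneg (s - 2 / 7)
    have e4 : y * (Real.eulerMascheroniConstant + (Real.log w - Real.log (1 + r)) + 1 / (2 * N)) =
      y * Real.eulerMascheroniConstant + y * Real.log w - y * Real.log (1 + r) + (N + 2 * s + s * r) / 2 := by
      rw [← e3]; ring
    rw [e4] at hH2
    have e5 : y * (2 * Real.log w + (2 * Real.eulerMascheroniConstant - 1)) =
      2 * (y * Real.log w) + 2 * (y * Real.eulerMascheroniConstant) - y := by ring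
    rw [e5]
    linarith


lemma dv_f_mono {a b : ℝ} (ha : 1 ≤ a) (hab : a ≤ b) :
    a * (Real.log a + dvK) ≤ b * (Real.log b + dvK) := by
  have h1 := Real.log_le_log (by linarith) hab
  have h2 := Real.log_nonneg ha
  have h3 := dvK_bds.1
  exact mul_le_mul hab (by linarith) (by linarith) (by linarith)

lemma dvD_bds : 1.30474 ≤ dvD ∧ dvD ≤ 1.30501 := by
  have h1 := dvK_bds
  have h2 := Real.log_two_gt_d9
  have h2' := Real.log_two_lt_d9
  unfold dvD
  norm_num at *
  constructor <;> linarith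

lemma dv_rp {r z : ℝ} (hr : 0 ≤ r) (hz : 0 ≤ z) (h : r ^ 12 ≤ z ^ 7) : r ≤ z ^ ((7:ℝ) / 12) := by
  have h1 : r = (r ^ 12) ^ ((1:ℝ) / 12) := by
    rw [← Real.rpow_natCast, ← Real.rpow_mul hr]; norm_num
  rw [h1, show (7:ℝ)/12 = ((7:ℕ):ℝ) * (1 / 12) by norm_num, Real.rpow_mul hz, Real.rpow_natCast]
  exact Real.rpow_le_rpow (by positivity) h (by norm_num)

lemma dv_fin (n T : ℕ) (a b r : ℝ) (hn : 2 ≤ n) (hT : ∑ i ∈ Finset.Icc 1 n, i.divisors.card = T)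
    (ha : a ≤ Real.log n) (hb : Real.log ((n + 1 : ℕ)) ≤ b) (hr0 : 0 ≤ r) (hr : r ^ 12 ≤ ((n:ℝ) / 2) ^ 7)
    (h1 : (T:ℝ) - n * (a + 0.15435) ≤ 1.30474 * r - 0.105)
    (h2 : (n + 1) * (b + 0.15448) - (T:ℝ) ≤ 1.30474 * r - 0.21) (y : ℝ) (hy : n ≤ y) (hy' : y < n + 1) :
    dvE ∅ y ≤ dvD * (y / 2) ^ ((7:ℝ) / 12) - 0.105 ∧ - dvE ∅ y ≤ dvD * (y / 2) ^ ((7:ℝ) / 12) - 0.21 := by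
  have hn' : (2:ℝ) ≤ n := by exact_mod_cast hn
  have hfl : ⌊y⌋₊ = n := (Nat.floor_eq_iff (by linarith)).2 ⟨hy, hy'⟩
  have hrr : 1.30474 * r ≤ dvD * (y / 2) ^ ((7:ℝ) / 12) := by
    refine mul_le_mul dvD_bds.1 ?_ hr0 (by linarith [dvD_bds.1])
    refine (dv_rp hr0 (by positivity) hr).trans ?_
    exact Real.rpow_le_rpow (by positivity) (by linarith) (by norm_num)
  rw [dvE_empty, hfl, ← Nat.cast_sum, hT]
  have m1 := dv_f_mono (a := n) (b := y) (by linarith) hy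
  have m2 := dv_f_mono (a := y) (b := n + 1) (by linarith) hy'.le
  have k := dvK_bds
  have m3 : (n:ℝ) * (a + 0.15435) ≤ n * (Real.log n + dvK) :=
    mul_le_mul_of_nonneg_left (by linarith) (by linarith)
  have m4 : ((n:ℝ) + 1) * (Real.log (n + 1) + dvK) ≤ (n + 1) * (b + 0.15448) := by
    push_cast at hb
    exact mul_le_mul_of_nonneg_left (by linarith) (by linarith)
  constructor <;> linarith

lemma dvn2 : 0.6930 ≤ Real.log 2 ∧ Real.log 2 ≤ 0.6933 :=
  ⟨by linarith [Real.log_two_gt_d9], by linarith [Real.log_two_lt_d9]⟩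

lemma dvn3 : 1.0985 ≤ Real.log 3 ∧ Real.log 3 ≤ 1.0988 :=
  ⟨by linarith [Real.log_three_gt_d9], by linarith [Real.log_three_lt_d9]⟩

lemma dvn4 : 1.3860 ≤ Real.log 4 ∧ Real.log 4 ≤ 1.3866 := by
  rw [show (4:ℝ) = 2 * 2 by norm_num, Real.log_mul (by norm_num) (by norm_num)]
  exact ⟨by linarith [dvn2.1, dvn2.1], by linarith [dvn2.2, dvn2.2]⟩

lemma dvn5 : 1.6093 ≤ Real.log 5 ∧ Real.log 5 ≤ 1.6096 :=
  ⟨by linarith [Real.log_five_gt_d9], by linarith [Real.log_five_lt_d9]⟩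

lemma dvn6 : 1.7915 ≤ Real.log 6 ∧ Real.log 6 ≤ 1.7921 := by
  rw [show (6:ℝ) = 2 * 3 by norm_num, Real.log_mul (by norm_num) (by norm_num)]
  exact ⟨by linarith [dvn2.1, dvn3.1], by linarith [dvn2.2, dvn3.2]⟩

lemma dvn7 : 1.9458 ≤ Real.log 7 ∧ Real.log 7 ≤ 1.9461 :=
  ⟨by linarith [dvl7.1], by linarith [dvl7.2]⟩

lemma dvn8 : 2.0790 ≤ Real.log 8 ∧ Real.log 8 ≤ 2.0799 := by
  rw [show (8:ℝ) = 2 * 4 by norm_num, Real.log_mul (by norm_num) (by norm_num)]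
  exact ⟨by linarith [dvn2.1, dvn4.1], by linarith [dvn2.2, dvn4.2]⟩

lemma dvn9 : 2.1970 ≤ Real.log 9 ∧ Real.log 9 ≤ 2.1976 := by
  rw [show (9:ℝ) = 3 * 3 by norm_num, Real.log_mul (by norm_num) (by norm_num)]
  exact ⟨by linarith [dvn3.1, dvn3.1], by linarith [dvn3.2, dvn3.2]⟩

lemma dvn10 : 2.3023 ≤ Real.log 10 ∧ Real.log 10 ≤ 2.3029 := by
  rw [show (10:ℝ) = 2 * 5 by norm_num, Real.log_mul (by norm_num) (by norm_num)]
  exact ⟨by linarith [dvn2.1, dvn5.1], by linarith [dvn2.2, dvn5.2]⟩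

lemma dvn11 : 2.3977 ≤ Real.log 11 ∧ Real.log 11 ≤ 2.3980 :=
  ⟨by linarith [dvl11.1], by linarith [dvl11.2]⟩

lemma dvn12 : 2.4845 ≤ Real.log 12 ∧ Real.log 12 ≤ 2.4854 := by
  rw [show (12:ℝ) = 2 * 6 by norm_num, Real.log_mul (by norm_num) (by norm_num)]
  exact ⟨by linarith [dvn2.1, dvn6.1], by linarith [dvn2.2, dvn6.2]⟩

lemma dvn13 : 2.5648 ≤ Real.log 13 ∧ Real.log 13 ≤ 2.5651 :=
  ⟨by linarith [dvl13.1], by linarith [dvl13.2]⟩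

lemma dvn14 : 2.6388 ≤ Real.log 14 ∧ Real.log 14 ≤ 2.6394 := by
  rw [show (14:ℝ) = 2 * 7 by norm_num, Real.log_mul (by norm_num) (by norm_num)]
  exact ⟨by linarith [dvn2.1, dvn7.1], by linarith [dvn2.2, dvn7.2]⟩

lemma dvn15 : 2.7078 ≤ Real.log 15 ∧ Real.log 15 ≤ 2.7084 := by
  rw [show (15:ℝ) = 3 * 5 by norm_num, Real.log_mul (by norm_num) (by norm_num)]
  exact ⟨by linarith [dvn3.1, dvn5.1], by linarith [dvn3.2, dvn5.2]⟩

lemma dvn16 : 2.7720 ≤ Real.log 16 ∧ Real.log 16 ≤ 2.7732 := by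
  rw [show (16:ℝ) = 2 * 8 by norm_num, Real.log_mul (by norm_num) (by norm_num)]
  exact ⟨by linarith [dvn2.1, dvn8.1], by linarith [dvn2.2, dvn8.2]⟩

lemma dvn17 : 2.8331 ≤ Real.log 17 ∧ Real.log 17 ≤ 2.8334 :=
  ⟨by linarith [dvl17.1], by linarith [dvl17.2]⟩

lemma dvn18 : 2.8900 ≤ Real.log 18 ∧ Real.log 18 ≤ 2.8909 := by
  rw [show (18:ℝ) = 2 * 9 by norm_num, Real.log_mul (by norm_num) (by norm_num)]
  exact ⟨by linarith [dvn2.1, dvn9.1], by linarith [dvn2.2, dvn9.2]⟩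

lemma dvn19 : 2.9443 ≤ Real.log 19 ∧ Real.log 19 ≤ 2.9446 :=
  ⟨by linarith [dvl19.1], by linarith [dvl19.2]⟩

lemma dvn20 : 2.9953 ≤ Real.log 20 ∧ Real.log 20 ≤ 2.9962 := by
  rw [show (20:ℝ) = 2 * 10 by norm_num, Real.log_mul (by norm_num) (by norm_num)]
  exact ⟨by linarith [dvn2.1, dvn10.1], by linarith [dvn2.2, dvn10.2]⟩

lemma dvn21 : 3.0443 ≤ Real.log 21 ∧ Real.log 21 ≤ 3.0449 := by
  rw [show (21:ℝ) = 3 * 7 by norm_num, Real.log_mul (by norm_num) (by norm_num)]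
  exact ⟨by linarith [dvn3.1, dvn7.1], by linarith [dvn3.2, dvn7.2]⟩

lemma dvn22 : 3.0907 ≤ Real.log 22 ∧ Real.log 22 ≤ 3.0913 := by
  rw [show (22:ℝ) = 2 * 11 by norm_num, Real.log_mul (by norm_num) (by norm_num)]
  exact ⟨by linarith [dvn2.1, dvn11.1], by linarith [dvn2.2, dvn11.2]⟩

lemma dvn23 : 3.1353 ≤ Real.log 23 ∧ Real.log 23 ≤ 3.1356 :=
  ⟨by linarith [dvl23.1], by linarith [dvl23.2]⟩

lemma dvn24 : 3.1775 ≤ Real.log 24 ∧ Real.log 24 ≤ 3.1787 := by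
  rw [show (24:ℝ) = 2 * 12 by norm_num, Real.log_mul (by norm_num) (by norm_num)]
  exact ⟨by linarith [dvn2.1, dvn12.1], by linarith [dvn2.2, dvn12.2]⟩

lemma dvn25 : 3.2186 ≤ Real.log 25 ∧ Real.log 25 ≤ 3.2192 := by
  rw [show (25:ℝ) = 5 * 5 by norm_num, Real.log_mul (by norm_num) (by norm_num)]
  exact ⟨by linarith [dvn5.1, dvn5.1], by linarith [dvn5.2, dvn5.2]⟩

lemma dv_U_small (n : ℕ) (hn : 3 ≤ n) (hn' : n ≤ 24) (y : ℝ) (hy : n ≤ y) (hy' : y < n + 1) :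
    dvE ∅ y ≤ dvD * (y / 2) ^ ((7:ℝ) / 12) - 0.105 ∧ - dvE ∅ y ≤ dvD * (y / 2) ^ ((7:ℝ) / 12) - 0.21 := by
  interval_cases n
  · exact dv_fin 3 5 1.0985 1.3866 1.266 (by norm_num) (by decide +kernel) (by exact_mod_cast dvn3.1)
      (by exact_mod_cast dvn4.2) (by norm_num) (by norm_num) (by norm_num) (by norm_num) y hy hy'
  · exact dv_fin 4 8 1.3860 1.6096 1.498 (by norm_num) (by decide +kernel) (by exact_mod_cast dvn4.1)
      (by exact_mod_cast dvn5.2) (by norm_num) (by norm_num) (by norm_num) (by norm_num) y hy hy'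
  · exact dv_fin 5 10 1.6093 1.7921 1.706 (by norm_num) (by decide +kernel) (by exact_mod_cast dvn5.1)
      (by exact_mod_cast dvn6.2) (by norm_num) (by norm_num) (by norm_num) (by norm_num) y hy hy'
  · exact dv_fin 6 14 1.7915 1.9461 1.898 (by norm_num) (by decide +kernel) (by exact_mod_cast dvn6.1)
      (by exact_mod_cast dvn7.2) (by norm_num) (by norm_num) (by norm_num) (by norm_num) y hy hy'
  · exact dv_fin 7 16 1.9458 2.0799 2.076 (by norm_num) (by decide +kernel) (by exact_mod_cast dvn7.1)
      (by exact_mod_cast dvn8.2) (by norm_num) (by norm_num) (by norm_num) (by norm_num) y hy hy'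
  · exact dv_fin 8 20 2.0790 2.1976 2.244 (by norm_num) (by decide +kernel) (by exact_mod_cast dvn8.1)
      (by exact_mod_cast dvn9.2) (by norm_num) (by norm_num) (by norm_num) (by norm_num) y hy hy'
  · exact dv_fin 9 23 2.1970 2.3029 2.404 (by norm_num) (by decide +kernel) (by exact_mod_cast dvn9.1)
      (by exact_mod_cast dvn10.2) (by norm_num) (by norm_num) (by norm_num) (by norm_num) y hy hy'
  · exact dv_fin 10 27 2.3023 2.3980 2.557 (by norm_num) (by decide +kernel) (by exact_mod_cast dvn10.1)
      (by exact_mod_cast dvn11.2) (by norm_num) (by norm_num) (by norm_num) (by norm_num) y hy hy'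
  · exact dv_fin 11 29 2.3977 2.4854 2.703 (by norm_num) (by decide +kernel) (by exact_mod_cast dvn11.1)
      (by exact_mod_cast dvn12.2) (by norm_num) (by norm_num) (by norm_num) (by norm_num) y hy hy'
  · exact dv_fin 12 35 2.4845 2.5651 2.843 (by norm_num) (by decide +kernel) (by exact_mod_cast dvn12.1)
      (by exact_mod_cast dvn13.2) (by norm_num) (by norm_num) (by norm_num) (by norm_num) y hy hy'
  · exact dv_fin 13 37 2.5648 2.6394 2.979 (by norm_num) (by decide +kernel) (by exact_mod_cast dvn13.1)
      (by exact_mod_cast dvn14.2) (by norm_num) (by norm_num) (by norm_num) (by norm_num) y hy hy'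
  · exact dv_fin 14 41 2.6388 2.7084 3.111 (by norm_num) (by decide +kernel) (by exact_mod_cast dvn14.1)
      (by exact_mod_cast dvn15.2) (by norm_num) (by norm_num) (by norm_num) (by norm_num) y hy hy'
  · exact dv_fin 15 45 2.7078 2.7732 3.239 (by norm_num) (by decide +kernel) (by exact_mod_cast dvn15.1)
      (by exact_mod_cast dvn16.2) (by norm_num) (by norm_num) (by norm_num) (by norm_num) y hy hy'
  · exact dv_fin 16 50 2.7720 2.8334 3.363 (by norm_num) (by decide +kernel) (by exact_mod_cast dvn16.1)
      (by exact_mod_cast dvn17.2) (by norm_num) (by norm_num) (by norm_num) (by norm_num) y hy hy'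
  · exact dv_fin 17 52 2.8331 2.8909 3.484 (by norm_num) (by decide +kernel) (by exact_mod_cast dvn17.1)
      (by exact_mod_cast dvn18.2) (by norm_num) (by norm_num) (by norm_num) (by norm_num) y hy hy'
  · exact dv_fin 18 58 2.8900 2.9446 3.602 (by norm_num) (by decide +kernel) (by exact_mod_cast dvn18.1)
      (by exact_mod_cast dvn19.2) (by norm_num) (by norm_num) (by norm_num) (by norm_num) y hy hy'
  · exact dv_fin 19 60 2.9443 2.9962 3.718 (by norm_num) (by decide +kernel) (by exact_mod_cast dvn19.1)
      (by exact_mod_cast dvn20.2) (by norm_num) (by norm_num) (by norm_num) (by norm_num) y hy hy'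
  · exact dv_fin 20 66 2.9953 3.0449 3.831 (by norm_num) (by decide +kernel) (by exact_mod_cast dvn20.1)
      (by exact_mod_cast dvn21.2) (by norm_num) (by norm_num) (by norm_num) (by norm_num) y hy hy'
  · exact dv_fin 21 70 3.0443 3.0913 3.941 (by norm_num) (by decide +kernel) (by exact_mod_cast dvn21.1)
      (by exact_mod_cast dvn22.2) (by norm_num) (by norm_num) (by norm_num) (by norm_num) y hy hy'
  · exact dv_fin 22 74 3.0907 3.1356 4.05 (by norm_num) (by decide +kernel) (by exact_mod_cast dvn22.1)
      (by exact_mod_cast dvn23.2) (by norm_num) (by norm_num) (by norm_num) (by norm_num) y hy hy'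
  · exact dv_fin 23 76 3.1353 3.1787 4.156 (by norm_num) (by decide +kernel) (by exact_mod_cast dvn23.1)
      (by exact_mod_cast dvn24.2) (by norm_num) (by norm_num) (by norm_num) (by norm_num) y hy hy'
  · exact dv_fin 24 84 3.1775 3.2192 4.261 (by norm_num) (by decide +kernel) (by exact_mod_cast dvn24.1)
      (by exact_mod_cast dvn25.2) (by norm_num) (by norm_num) (by norm_num) (by norm_num) y hy hy'

lemma dv_U_big (y : ℝ) (hy : 25 ≤ y) : √y + 0.49 ≤ dvD * (y / 2) ^ ((7:ℝ) / 12) := by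
  have hy0 : (0:ℝ) < y := by linarith
  have h1 : (y / 2) ^ ((7:ℝ) / 12) = √(y / 2) * (y / 2) ^ ((1:ℝ) / 12) := by
    rw [Real.sqrt_eq_rpow, ← Real.rpow_add (by positivity)]; norm_num
  have h2 : (1.234:ℝ) ≤ (y / 2) ^ ((1:ℝ) / 12) := by
    have : (1.234:ℝ) = ((1.234:ℝ) ^ 12) ^ ((1:ℝ) / 12) := by
      rw [← Real.rpow_natCast, ← Real.rpow_mul (by norm_num)]; norm_num
    rw [this]
    refine Real.rpow_le_rpow (by norm_num) ?_ (by norm_num)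
    refine le_trans ?_ (show (12.5:ℝ) ≤ y / 2 by linarith)
    norm_num
  have h3 : 0.707 * √y ≤ √(y / 2) := by
    apply Real.le_sqrt_of_sq_le
    rw [mul_pow, Real.sq_sqrt hy0.le]
    linarith
  have h5 : 5 ≤ √y := by apply Real.le_sqrt_of_sq_le; linarith
  have h6 : 0.707 * √y * 1.234 ≤ (y / 2) ^ ((7:ℝ) / 12) := by
    rw [h1]; exact mul_le_mul h3 h2 (by norm_num) (by positivity)
  have h7 : 1.30474 * (0.707 * √y * 1.234) ≤ dvD * (y / 2) ^ ((7:ℝ) / 12) :=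
    mul_le_mul dvD_bds.1 h6 (by positivity) (by linarith [dvD_bds.1])
  linarith

lemma dv_U3 (y : ℝ) (hy : 3 ≤ y) :
    dvE ∅ y ≤ dvD * (y / 2) ^ ((7:ℝ) / 12) - 0.105 ∧ - dvE ∅ y ≤ dvD * (y / 2) ^ ((7:ℝ) / 12) - 0.21 := by
  by_cases h : 25 ≤ y
  · have h1 := abs_le.1 (dv_big y h)
    have h2 := dv_U_big y h
    constructor <;> linarith [h1.1, h1.2]
  · push Not at h
    have h0 : 0 ≤ y := by linarith
    refine dv_U_small ⌊y⌋₊ ?_ ?_ y (Nat.floor_le h0) (Nat.lt_floor_add_one y)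
    · exact Nat.le_floor (by exact_mod_cast hy)
    · have : ⌊y⌋₊ < 25 := (Nat.floor_lt h0).2 (by exact_mod_cast h)
      omega

lemma dv_U2 (y : ℝ) (hy : 2 ≤ y) :
    dvE ∅ y ≤ dvD * (y / 2) ^ ((7:ℝ) / 12) ∧ - dvE ∅ y ≤ dvD * (y / 2) ^ ((7:ℝ) / 12) - 0.21 := by
  by_cases h : 3 ≤ y
  · have := dv_U3 y h
    constructor <;> linarith
  · push Not at h
    have hfl : ⌊y⌋₊ = 2 := (Nat.floor_eq_iff (by linarith)).2 ⟨by exact_mod_cast hy, by norm_num; linarith⟩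
    have h1 : 1 ≤ (y / 2) ^ ((7:ℝ) / 12) := Real.one_le_rpow (by linarith) (by norm_num)
    have h2 : dvD ≤ dvD * (y / 2) ^ ((7:ℝ) / 12) :=
      le_mul_of_one_le_right (by linarith [dvD_bds.1]) h1
    have hT : ∑ i ∈ Finset.Icc 1 2, i.divisors.card = 3 := by decide +kernel
    rw [dvE_empty, hfl, ← Nat.cast_sum, hT]
    have m1 := dv_f_mono (a := 2) (b := y) (by norm_num) hy
    have m2 := dv_f_mono (a := y) (b := 3) (by linarith) h.le
    have k := dvK_bds
    have d := dvD_bds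
    have l := dvn3
    have l2 := dvn2
    have hd : dvD = 3 - 2 * (Real.log 2 + dvK) := rfl
    push_cast
    constructor <;> linarith

lemma dv_U1 (y : ℝ) (hy : 1 ≤ y) (hy2 : y < 2) :
    dvE ∅ y ≤ 1 - dvK ∧ - dvE ∅ y ≤ (1 - dvK) * y ^ ((7:ℝ) / 12) - 0.21 := by
  have hfl : ⌊y⌋₊ = 1 := (Nat.floor_eq_iff (by linarith)).2 ⟨by exact_mod_cast hy, by norm_num; linarith⟩
  have hT : ∑ i ∈ Finset.Icc 1 1, i.divisors.card = 1 := by decide +kernel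
  have k := dvK_bds
  rw [dvE_empty, hfl, ← Nat.cast_sum, hT]
  have m1 := dv_f_mono (a := 1) (b := y) (by norm_num) hy
  have l2 := dvn2
  have l3 := dvn3
  rw [Real.log_one] at m1
  constructor
  · push_cast; linarith
  · by_cases h : y ≤ 1.5
    · have h1 : 1 ≤ y ^ ((7:ℝ) / 12) := Real.one_le_rpow (by linarith) (by norm_num)
      have h2 : 1 - dvK ≤ (1 - dvK) * y ^ ((7:ℝ) / 12) := le_mul_of_one_le_right (by linarith) h1
      have m2 := dv_f_mono (a := y) (b := 1.5) (by linarith) h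
      have : Real.log 1.5 = Real.log 3 - Real.log 2 := by
        rw [← Real.log_div (by norm_num) (by norm_num)]; norm_num
      rw [this] at m2
      push_cast; linarith
    · push Not at h
      have h1 : 1.25 ≤ y ^ ((7:ℝ) / 12) := by
        refine (dv_rp (z := 1.5) (by norm_num) (by norm_num) (by norm_num)).trans ?_
        exact Real.rpow_le_rpow (by norm_num) h.le (by norm_num)
      have h2 : (1 - dvK) * 1.25 ≤ (1 - dvK) * y ^ ((7:ℝ) / 12) :=
        mul_le_mul_of_nonneg_left h1 (by linarith)
      have m2 := dv_f_mono (a := y) (b := 2) (by linarith) hy2.le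
      push_cast; linarith

/-- consequences for admissible constants -/
lemma dv_H1 {C θ : ℝ} (hC : 1 - dvK ≤ C) (hC2 : dvD ≤ C * 2 ^ θ) (hθ : 7 / 12 ≤ θ) (y : ℝ) (hy : 1 ≤ y) :
    dvE ∅ y ≤ C * y ^ θ ∧ - dvE ∅ y ≤ C * y ^ θ - 0.21 ∧ (3 ≤ y → dvE ∅ y ≤ C * y ^ θ - 0.105) := by
  have k := dvK_bds
  by_cases h : y < 2
  · have := dv_U1 y hy h
    have h1 : y ^ ((7:ℝ)/12) ≤ y ^ θ := Real.rpow_le_rpow_of_exponent_le hy hθ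
    have h0 : 1 ≤ y ^ ((7:ℝ) / 12) := Real.one_le_rpow hy (by norm_num)
    have h2 : (1 - dvK) * y ^ ((7:ℝ) / 12) ≤ C * y ^ θ := mul_le_mul hC h1 (by linarith) (by linarith)
    have h3 : 1 - dvK ≤ (1 - dvK) * y ^ ((7:ℝ) / 12) := le_mul_of_one_le_right (by linarith) h0
    refine ⟨by linarith, by linarith, fun h => by linarith⟩
  · push Not at h
    have h1 : (y / 2) ^ ((7:ℝ)/12) ≤ (y / 2) ^ θ := Real.rpow_le_rpow_of_exponent_le (by linarith) hθ
    have e : C * y ^ θ = C * 2 ^ θ * (y / 2) ^ θ := by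
      rw [mul_assoc, ← Real.mul_rpow (by norm_num) (by linarith)]
      congr 2; ring
    have h2 : dvD * (y / 2) ^ ((7:ℝ)/12) ≤ C * y ^ θ := by
      rw [e]
      exact mul_le_mul hC2 h1 (by positivity) (by linarith [dvD_bds.1])
    have u := dv_U2 y h
    refine ⟨by linarith, by linarith, fun h => ?_⟩
    have u3 := dv_U3 y h
    linarith


lemma dv_exc {a B c y : ℝ} (ha : 0 < a) (hB : 0 ≤ B) (h : 1 ≤ a * Real.exp (1 + a * c) * B) (hy : 0 < y) :
    y * (-Real.log y - c) ≤ B * y ^ (1 - a) := by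
  set t := -Real.log y with ht
  by_cases htc : t - c ≤ 0
  · exact le_trans (mul_nonpos_of_nonneg_of_nonpos hy.le htc) (by positivity)
  push Not at htc
  have e1 : y ^ (1 - a) = y * Real.exp (a * t) := by
    rw [Real.rpow_def_of_pos hy, ← Real.exp_log hy, Real.log_exp, ← Real.exp_add]
    congr 1; rw [ht]; ring
  rw [e1]
  have h1 : a * (t - c) * Real.exp (1 + a * c) ≤ Real.exp (a * t) := by
    have := Real.add_one_le_exp (a * t - (1 + a * c))
    rw [Real.exp_sub, le_div_iff₀ (Real.exp_pos _)] at this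
    calc _ = (a * t - (1 + a * c) + 1) * Real.exp (1 + a * c) := by ring
      _ ≤ _ := this
  have h2 : t - c ≤ B * Real.exp (a * t) := by
    calc t - c ≤ (t - c) * (a * Real.exp (1 + a * c) * B) := le_mul_of_one_le_right htc.le h
      _ = B * (a * (t - c) * Real.exp (1 + a * c)) := by ring
      _ ≤ _ := mul_le_mul_of_nonneg_left h1 hB
  calc y * (t - c) ≤ y * (B * Real.exp (a * t)) := mul_le_mul_of_nonneg_left h2 hy.le
    _ = _ := by ring

lemma dvE_lt1 {y : ℝ} (hy : y < 1) : dvE ∅ y = - (y * (Real.log y + dvK)) := by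
  rw [dvE_empty, Nat.floor_eq_zero.2 hy]; simp

lemma dv_exp_lb {v : ℝ} (hv : 0 ≤ v) : 2.7182 * (1 + v + v ^ 2 / 2) ≤ Real.exp (1 + v) := by
  rw [Real.exp_add]
  exact mul_le_mul (by linarith [Real.exp_one_gt_d9]) (Real.quadratic_le_exp_of_nonneg hv) (by positivity) (Real.exp_pos _).le

lemma dv_lt1_neg {y θ C : ℝ} (hy0 : 0 < y) (hy : y < 1) (hθ : θ ≤ 1) (hC : 1 - dvK ≤ C) :
    - dvE ∅ y ≤ C * y ^ θ := by
  rw [dvE_lt1 hy]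
  have k := dvK_bds
  have h1 : y ≤ y ^ θ := by
    have := Real.rpow_le_rpow_of_exponent_ge hy0 hy.le hθ
    rwa [Real.rpow_one] at this
  have h2 := Real.log_nonpos hy0.le hy.le
  have h3 : y * (Real.log y + dvK) ≤ y * C := mul_le_mul_of_nonneg_left (by linarith) hy0.le
  have h4 : C * y ≤ C * y ^ θ := mul_le_mul_of_nonneg_left h1 (by linarith)
  linarith

lemma dv_lt1_pos {y : ℝ} (hy0 : 0 < y) (hy : y < 1) : dvE ∅ y ≤ (1 - dvK) * y ^ ((7:ℝ) / 12) := by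
  rw [dvE_lt1 hy]
  have k := dvK_bds
  have := dv_exc (a := 5 / 12) (B := 1 - dvK) (c := dvK) (by norm_num) (by linarith) ?_ hy0
  · rw [show (1:ℝ) - 5 / 12 = 7 / 12 by norm_num] at this
    linarith
  · have h1 := dv_exp_lb (v := 5 / 12 * 0.15435) (by norm_num)
    have h2 : Real.exp (1 + 5 / 12 * 0.15435) ≤ Real.exp (1 + 5 / 12 * dvK) :=
      Real.exp_le_exp.2 (by linarith)
    have h3 : 2.89 ≤ Real.exp (1 + 5 / 12 * dvK) := by
      refine le_trans ?_ (h1.trans h2)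
      norm_num
    have h4 : 2.89 * 0.84552 ≤ Real.exp (1 + 5 / 12 * dvK) * (1 - dvK) :=
      mul_le_mul h3 (by linarith) (by norm_num) (by linarith)
    norm_num at h4 ⊢
    linarith

lemma dv_direct {C θ : ℝ} (hC : 1 - dvK ≤ C) (hθ : θ ≤ 7 / 12) (h : ∀ y : ℝ, 1 ≤ y → |dvE ∅ y| ≤ C * y ^ θ)
    (y : ℝ) (hy : 0 < y) : |dvE ∅ y| ≤ C * y ^ θ := by
  by_cases h1 : 1 ≤ y
  · exact h y h1
  · push Not at h1
    have h2 : y ^ ((7:ℝ) / 12) ≤ y ^ θ := Real.rpow_le_rpow_of_exponent_ge hy h1.le hθ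
    have k := dvK_bds
    have h3 : (1 - dvK) * y ^ ((7:ℝ) / 12) ≤ C * y ^ θ := mul_le_mul hC h2 (by positivity) (by linarith)
    have h4 := dv_lt1_pos hy h1
    have h5 := dv_lt1_neg hy h1 (θ := θ) (by linarith) hC
    rw [abs_le]; constructor <;> linarith

lemma dv_712 (y : ℝ) (hy : 0 < y) : |dvE ∅ y| ≤ dvD * (y / 2) ^ ((7:ℝ) / 12) := by
  have k := dvK_bds
  by_cases h2 : 2 ≤ y
  · have := dv_U2 y h2
    rw [abs_le]; constructor <;> linarith
  · push Not at h2
    have e : (1 - dvK) * y ^ ((7:ℝ) / 12) ≤ dvD * (y / 2) ^ ((7:ℝ) / 12) := by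
      have e1 : y ^ ((7:ℝ) / 12) = 2 ^ ((7:ℝ) / 12) * (y / 2) ^ ((7:ℝ) / 12) := by
        rw [← Real.mul_rpow (by norm_num) (by linarith)]; congr 1; ring
      have e2 : (2:ℝ) ^ ((7:ℝ) / 12) ≤ 1.5 := by
        have h : (1.5:ℝ) = ((1.5:ℝ) ^ 12) ^ ((1:ℝ) / 12) := by
          rw [← Real.rpow_natCast, ← Real.rpow_mul (by norm_num)]; norm_num
        rw [h, show (7:ℝ)/12 = ((7:ℕ):ℝ) * (1 / 12) by norm_num, Real.rpow_mul (by norm_num), Real.rpow_natCast]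
        exact Real.rpow_le_rpow (by positivity) (by norm_num) (by norm_num)
      rw [e1, ← mul_assoc]
      refine mul_le_mul_of_nonneg_right ?_ (by positivity)
      have := mul_le_mul (show 1 - dvK ≤ 0.84565 by linarith) e2 (by positivity) (by norm_num)
      linarith [dvD_bds.1]
    by_cases h1 : 1 ≤ y
    · have := dv_U1 y h1 h2
      have h3 : 1 ≤ y ^ ((7:ℝ) / 12) := Real.one_le_rpow h1 (by norm_num)
      have h4 : 1 - dvK ≤ (1 - dvK) * y ^ ((7:ℝ) / 12) := le_mul_of_one_le_right (by linarith) h3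
      rw [abs_le]; constructor <;> linarith
    · push Not at h1
      have h4 := dv_lt1_pos hy h1
      have h5 := dv_lt1_neg hy h1 (θ := 7 / 12) (by norm_num) le_rfl
      rw [abs_le]; constructor <;> linarith

lemma dv_exc84 {u : ℝ} (hu : 0 < u) (hu1 : u < 1) :
    dvE ∅ u ≤ (1 - dvK) * u ^ ((21:ℝ) / 25) + 0.105 := by
  have k := dvK_bds
  rw [dvE_lt1 hu1]
  set t := -Real.log u with ht
  have ht0 : 0 ≤ t := by have := Real.log_nonpos hu.le hu1.le; linarith
  have e1 : u ^ ((21:ℝ) / 25) = u * Real.exp (4 / 25 * t) := by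
    rw [Real.rpow_def_of_pos hu, ← Real.exp_log hu, Real.log_exp, ← Real.exp_add]
    congr 1; rw [ht]; ring
  have e2 : u * Real.exp t = 1 := by
    rw [ht, Real.exp_neg, Real.exp_log hu, mul_inv_cancel₀ hu.ne']
  have h1 : 1 + 4 / 25 * t ≤ Real.exp (4 / 25 * t) := by
    have := Real.add_one_le_exp (4 / 25 * t); linarith
  have h2 : 8.32 * (t - 1.12) ≤ Real.exp t := by
    by_cases hh : t - 1.12 ≤ 0
    · have := Real.exp_pos t; linarith
    push Not at hh
    have := Real.add_one_le_exp (t - 2.12)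
    rw [Real.exp_sub, le_div_iff₀ (Real.exp_pos _)] at this
    have h3 : (8.32:ℝ) ≤ Real.exp 2.12 := by
      rw [show (2.12:ℝ) = 1 + 1 + 0.12 by norm_num, Real.exp_add, Real.exp_add]
      have h4 := Real.exp_one_gt_d9
      have h5 := Real.quadratic_le_exp_of_nonneg (x := 0.12) (by norm_num)
      have h6 : (2.718:ℝ) * 2.718 ≤ Real.exp 1 * Real.exp 1 :=
        mul_le_mul (by linarith) (by linarith) (by norm_num) (by positivity)
      have h7 := mul_le_mul h6 (show (1.127:ℝ) ≤ Real.exp 0.12 by norm_num at *; linarith) (by norm_num) (by positivity)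
      norm_num at *; linarith
    have h8 := mul_le_mul_of_nonneg_left h3 hh.le
    linarith
  have h3 : t - dvK ≤ (1 - dvK) * Real.exp (4 / 25 * t) + 0.105 * Real.exp t := by
    have h4 : 0.84552 * (1 + 4 / 25 * t) ≤ (1 - dvK) * Real.exp (4 / 25 * t) :=
      mul_le_mul (by linarith) h1 (by positivity) (by linarith)
    linarith
  have h4 := mul_le_mul_of_nonneg_left h3 hu.le
  rw [e1]
  have h5 : u * ((1 - dvK) * Real.exp (4 / 25 * t) + 0.105 * Real.exp t) =
    (1 - dvK) * (u * Real.exp (4 / 25 * t)) + 0.105 * (u * Real.exp t) := by ring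
  rw [h5, e2] at h4
  have h6 : Real.log u = -t := by rw [ht]; ring
  rw [h6]
  linarith

lemma dv_base {p : ℕ} (hp : p.Prime) {θ θ0 C ε : ℝ} (hθ : 7 / 12 ≤ θ) (hθ0 : θ ≤ θ0) (h01 : θ0 < 1)
    (hC : 1 - dvK ≤ C) (hC2 : dvD ≤ C * 2 ^ θ) (hε : ε ≤ 0.105) (hε3 : p < 3 → ε ≤ 0)
    (hexc : ∀ u : ℝ, 1 / p ≤ u → u < 1 → dvE ∅ u ≤ (1 - dvK) * u ^ θ0 + ε)
    (N1 : (1 - 1 / (p:ℝ)) ^ 2 ≤ (1 - θ0) * Real.exp (1 + (1 - θ0) * (dvK + 2 * (Real.log p / ((p:ℝ) - 1)))) *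
      ((1 - dvK) * (1 + (p:ℝ) ^ (-θ0)) ^ 2))
    (N2 : (1 - 1 / (p:ℝ)) ^ 2 * (dvK + 2 * (Real.log p / ((p:ℝ) - 1))) ≤ 1 - dvK)
    (y : ℝ) (hy : 0 < y) : |dvE {p} y| ≤ C * (dvP {p} θ * y ^ θ) := by
  have k := dvK_bds
  have hp2 : (2:ℝ) ≤ p := by exact_mod_cast hp.two_le
  have hp0 : (0:ℝ) < p := by linarith
  have hC0 : 0 ≤ C := by linarith
  by_cases hy1 : y < 1
  · -- small y
    have hE : dvE {p} y = - ((1 - 1 / (p:ℝ)) ^ 2 * (y * (Real.log y + (dvK + 2 * (Real.log p / ((p:ℝ) - 1)))))) := by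
      simp only [dvE, dvT, dvM, Nat.floor_eq_zero.2 hy1, Finset.prod_singleton, Finset.sum_singleton]
      simp only [show Finset.Icc 1 0 = (∅ : Finset ℕ) from rfl, Finset.sum_empty]; ring
    set c := dvK + 2 * (Real.log p / ((p:ℝ) - 1)) with hc
    set W := (1 - 1 / (p:ℝ)) ^ 2 with hW
    have hWpos : 0 < W := by
      have : 1 / (p:ℝ) < 1 := by rw [div_lt_one hp0]; linarith
      have : 0 < 1 - 1 / (p:ℝ) := by linarith
      positivity
    have hPP : (1 + (p:ℝ) ^ (-θ0)) ^ 2 ≤ dvP {p} θ := by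
      simp only [dvP, Finset.prod_singleton]
      have : (p:ℝ) ^ (-θ0) ≤ (p:ℝ) ^ (-θ) := Real.rpow_le_rpow_of_exponent_le (by linarith) (by linarith)
      have h0 : 0 ≤ (p:ℝ) ^ (-θ0) := by positivity
      gcongr
    have hyy : y ^ θ0 ≤ y ^ θ := Real.rpow_le_rpow_of_exponent_ge hy hy1.le hθ0
    have hP1 : 1 ≤ (1 + (p:ℝ) ^ (-θ0)) ^ 2 := by
      have h0 : 0 ≤ (p:ℝ) ^ (-θ0) := by positivity
      nlinarith
    have hfin : (1 - dvK) * (1 + (p:ℝ) ^ (-θ0)) ^ 2 * y ^ θ0 ≤ C * (dvP {p} θ * y ^ θ) := by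
      rw [mul_assoc]
      have h1 : (1 + (p:ℝ) ^ (-θ0)) ^ 2 * y ^ θ0 ≤ dvP {p} θ * y ^ θ :=
        mul_le_mul hPP hyy (by positivity) (dvP_pos _ _).le
      exact mul_le_mul hC h1 (by positivity) (by linarith)
    rw [hE, abs_le]
    constructor
    · have hl := Real.log_nonpos hy.le hy1.le
      have h1 : W * (y * (Real.log y + c)) ≤ (1 - dvK) * y := by
        have : W * (Real.log y + c) ≤ W * c := mul_le_mul_of_nonneg_left (by linarith) hWpos.le
        have h2 := mul_le_mul_of_nonneg_right (this.trans N2) hy.le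
        linarith
      have h3 : y ≤ y ^ θ0 := by
        have := Real.rpow_le_rpow_of_exponent_ge hy hy1.le h01.le
        rwa [Real.rpow_one] at this
      have h4 : (1 - dvK) * y ≤ (1 - dvK) * (1 + (p:ℝ) ^ (-θ0)) ^ 2 * y ^ θ0 := by
        rw [mul_assoc]
        refine mul_le_mul_of_nonneg_left ?_ (by linarith)
        calc y ≤ y ^ θ0 := h3
          _ ≤ _ := le_mul_of_one_le_left (by positivity) hP1
      linarith
    · have := dv_exc (a := 1 - θ0) (B := (1 - dvK) * (1 + (p:ℝ) ^ (-θ0)) ^ 2 / W) (c := c) (y := y) (by linarith)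
        (by apply div_nonneg _ hWpos.le; apply mul_nonneg (by linarith); positivity) (by
          rw [← mul_div_assoc, le_div_iff₀ hWpos, one_mul]; exact N1) hy
      rw [show 1 - (1 - θ0) = θ0 by ring, div_mul_eq_mul_div, le_div_iff₀ hWpos] at this
      have h2 : -(W * (y * (Real.log y + c))) = y * (-Real.log y - c) * W := by ring
      rw [h2]; linarith
  push Not at hy1
  have hins := dvE_insert hp ∅ (by simp) (by simp) y hy
  rw [insert_empty_eq] at hins
  have hD : C * (dvP {p} θ * y ^ θ) = C * y ^ θ + 2 * (C * (y / p) ^ θ) + C * (y / (p:ℝ) ^ 2) ^ θ := by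
    rw [dv_pow_div hp.pos hy, dv_pow_div2 hp.pos hy]
    simp only [dvP, Finset.prod_singleton]; ring
  rw [hins, hD]
  have H := dv_H1 hC hC2 hθ
  have Hy := H y hy1
  have cmp : ∀ u : ℝ, 0 < u → u < 1 → (1 - dvK) * u ^ θ0 ≤ C * u ^ θ := fun u h0 h1 =>
    mul_le_mul hC (Real.rpow_le_rpow_of_exponent_ge h0 h1.le hθ0) (by positivity) hC0
  have hup : 0 < y / p := by positivity
  have hup2 : 0 < y / (p:ℝ)^2 := by positivity
  have e2 : y / (p:ℝ) ^ 2 = y / p / p := by rw [div_div, sq]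
  by_cases h1 : y < p
  · have hu1 : y / p < 1 := by rw [div_lt_one hp0]; exact h1
    have hu2 : y / (p:ℝ)^2 < 1 := by rw [div_lt_one (by positivity)]; nlinarith
    have hul : 1 / (p:ℝ) ≤ y / p := by gcongr
    have ex := hexc _ hul hu1
    have cm := cmp _ hup hu1
    have n2 := dv_lt1_neg hup2 hu2 (θ := θ) (by linarith) hC
    rw [abs_le]
    constructor
    · linarith [Hy.2.1]
    · have hB : - 2 * dvE ∅ (y / p) + dvE ∅ (y / (p:ℝ)^2) ≤ 2 * (C * (y / p) ^ θ) := by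
        rw [dvE_lt1 hu1, dvE_lt1 hu2, e2, Real.log_div hup.ne' hp0.ne']
        set u := y / p with hu
        have hl := Real.log_nonpos hup.le hu1.le
        have hlp : Real.log p ≤ p := by linarith [Real.log_le_sub_one_of_pos hp0]
        have h3 : u ≤ u ^ θ := by
          have := Real.rpow_le_rpow_of_exponent_ge hup hu1.le (show θ ≤ 1 by linarith)
          rwa [Real.rpow_one] at this
        have h4 : C * u ≤ C * u ^ θ := mul_le_mul_of_nonneg_left h3 hC0
        have h5 : u * 0.84552 ≤ u * C := mul_le_mul_of_nonneg_left (by linarith) hup.le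
        have h6 : u / p * (Real.log p - Real.log u - dvK) ≤ u * (1 - Real.log u) := by
          rw [div_mul_eq_mul_div, mul_div_assoc]
          refine mul_le_mul_of_nonneg_left ?_ hup.le
          rw [div_le_iff₀ hp0]
          nlinarith
        have h7 : u * Real.log u ≤ 0 := mul_nonpos_of_nonneg_of_nonpos hup.le hl
        have h8 : u * dvK ≤ u * 0.15448 := mul_le_mul_of_nonneg_left (by linarith) hup.le
        linarith
      have hC' : 0 ≤ C * (y / (p:ℝ)^2) ^ θ := by positivity
      linarith [Hy.1]
  · push Not at h1
    have hu1 : 1 ≤ y / p := by rw [le_div_iff₀ hp0]; linarith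
    have Hu := H _ hu1
    by_cases h2 : y < (p:ℝ)^2
    · have hu2 : y / (p:ℝ)^2 < 1 := by rw [div_lt_one (by positivity)]; exact h2
      have hul : 1 / (p:ℝ) ≤ y / (p:ℝ)^2 := by rw [e2]; gcongr
      have ex := hexc _ hul hu2
      have cm := cmp _ hup2 hu2
      have n2 := dv_lt1_neg hup2 hu2 (θ := θ) (by linarith) hC
      have hyε : dvE ∅ y ≤ C * y ^ θ - ε := by
        by_cases h3 : p < 3
        · linarith [hε3 h3, Hy.1]
        · have : (3:ℝ) ≤ p := by exact_mod_cast (not_lt.1 h3)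
          linarith [Hy.2.2 (by linarith)]
      rw [abs_le]
      constructor <;> linarith [Hy.2.1, Hu.1, Hu.2.1]
    · push Not at h2
      have hu2 : 1 ≤ y / (p:ℝ)^2 := by rw [le_div_iff₀ (by positivity)]; linarith
      have Hu2 := H _ hu2
      rw [abs_le]
      constructor <;> linarith [Hy.1, Hy.2.1, Hu.1, Hu.2.1, Hu2.1, Hu2.2.1]


def dvBase (p : ℕ) (θ0 : ℝ) : Prop := ∀ θ C : ℝ, 7 / 12 ≤ θ → θ ≤ θ0 → 1 - dvK ≤ C → dvD ≤ C * 2 ^ θ →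
  ∀ y : ℝ, 0 < y → |dvE {p} y| ≤ C * (dvP {p} θ * y ^ θ)

lemma dv_rneg {r z : ℝ} {n d : ℕ} (hd : 0 < d) (hr : 0 ≤ r) (hz : 0 < z) (h : r ^ d * z ^ n ≤ 1) :
    r ≤ z ^ (-((n:ℝ) / d)) := by
  have hd' : (0:ℝ) < d := by exact_mod_cast hd
  have h1 : r = (r ^ d) ^ ((1:ℝ) / d) := by
    rw [← Real.rpow_natCast, ← Real.rpow_mul hr, mul_one_div_cancel hd'.ne', Real.rpow_one]
  have h2 : z ^ (-((n:ℝ) / d)) = ((z ^ n)⁻¹) ^ ((1:ℝ) / d) := by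
    rw [← Real.rpow_natCast, ← Real.rpow_neg hz.le, ← Real.rpow_mul hz.le]; congr 1; ring
  rw [h1, h2]
  refine Real.rpow_le_rpow (by positivity) ?_ (by positivity)
  rw [← one_div, le_div_iff₀ (by positivity)]; exact h

lemma dv_baseN {p : ℕ} (hp : p.Prime) (n d : ℕ) (hd : 0 < d) (r l h ε : ℝ) (hnd : ((n:ℝ) / d) < 1)
    (hr0 : 0 ≤ r) (hr : r ^ d * (p:ℝ) ^ n ≤ 1) (hl0 : 0 ≤ l) (hl : l ≤ Real.log p) (hh : Real.log p ≤ h)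
    (hε : ε ≤ 0.105) (hε3 : p < 3 → ε ≤ 0)
    (hexc : ∀ u : ℝ, 1 / p ≤ u → u < 1 → dvE ∅ u ≤ (1 - dvK) * u ^ ((n:ℝ) / d) + ε)
    (num1 : (1 - 1 / (p:ℝ)) ^ 2 ≤ (1 - (n:ℝ) / d) * (2.7182 * (1 + (1 - (n:ℝ) / d) * (0.15435 + 2 * (l / ((p:ℝ) - 1))) +
      ((1 - (n:ℝ) / d) * (0.15435 + 2 * (l / ((p:ℝ) - 1)))) ^ 2 / 2)) * (0.84552 * (1 + r) ^ 2))
    (num2 : (1 - 1 / (p:ℝ)) ^ 2 * (0.15448 + 2 * (h / ((p:ℝ) - 1))) ≤ 0.84552) :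
    dvBase p ((n:ℝ) / d) := by
  intro θ C hθ hθ0 hC hC2 y hy
  have k := dvK_bds
  have hp2 : (2:ℝ) ≤ p := by exact_mod_cast hp.two_le
  have hp1 : (0:ℝ) < (p:ℝ) - 1 := by linarith
  have hrr := dv_rneg hd hr0 (by linarith : (0:ℝ) < p) hr
  have hl' : l / ((p:ℝ) - 1) ≤ Real.log p / ((p:ℝ) - 1) := div_le_div_of_nonneg_right hl hp1.le
  have hh' : Real.log p / ((p:ℝ) - 1) ≤ h / ((p:ℝ) - 1) := div_le_div_of_nonneg_right hh hp1.le
  have hl0' : 0 ≤ l / ((p:ℝ) - 1) := by positivity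
  refine dv_base hp hθ hθ0 hnd hC hC2 hε hε3 hexc ?_ ?_ y hy
  · refine num1.trans ?_
    have ha : 0 < 1 - (n:ℝ) / d := by linarith
    refine mul_le_mul (mul_le_mul_of_nonneg_left ?_ ha.le) (mul_le_mul (by linarith) ?_ (by positivity) (by linarith)) (by positivity) (by positivity)
    · refine (dv_exp_lb (v := (1 - (n:ℝ) / d) * (0.15435 + 2 * (l / ((p:ℝ) - 1)))) (by positivity)).trans ?_
      refine Real.exp_le_exp.2 ?_
      have := mul_le_mul_of_nonneg_left (show 0.15435 + 2 * (l / ((p:ℝ) - 1)) ≤ dvK + 2 * (Real.log p / ((p:ℝ) - 1)) by linarith) ha.le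
      linarith
    · gcongr
  · have := mul_le_mul_of_nonneg_left (show dvK + 2 * (Real.log p / ((p:ℝ) - 1)) ≤ 0.15448 + 2 * (h / ((p:ℝ) - 1)) by linarith) (sq_nonneg (1 - 1 / (p:ℝ)))
    linarith

lemma dv_exc84' {u θ : ℝ} (hθ : θ ≤ 21 / 25) (hu : 0 < u) (hu1 : u < 1) :
    dvE ∅ u ≤ (1 - dvK) * u ^ θ + 0.105 := by
  have := dv_exc84 hu hu1
  have h2 : u ^ ((21:ℝ) / 25) ≤ u ^ θ := Real.rpow_le_rpow_of_exponent_ge hu hu1.le hθ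
  have h3 := mul_le_mul_of_nonneg_left h2 (show 0 ≤ 1 - dvK by linarith [dvK_bds.2])
  linarith

lemma dv_exc_lin {u θ ε : ℝ} {p : ℕ} (hp : 0 < p) (hε : 0 ≤ ε) (hθ : θ ≤ 1) (hu : 1 / (p:ℝ) ≤ u) (hu1 : u < 1)
    (hl : Real.log p ≤ 1 + ε) :
    dvE ∅ u ≤ (1 - dvK) * u ^ θ + ε := by
  have hp' : (0:ℝ) < p := by exact_mod_cast hp
  have hu0 : 0 < u := lt_of_lt_of_le (by positivity) hu
  have h1 : - Real.log p ≤ Real.log u := by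
    have := Real.log_le_log (by positivity) hu
    rwa [one_div, Real.log_inv] at this
  have h3 : u ≤ u ^ θ := by
    have := Real.rpow_le_rpow_of_exponent_ge hu0 hu1.le hθ
    rwa [Real.rpow_one] at this
  have h4 := mul_le_mul_of_nonneg_left h3 (show 0 ≤ 1 - dvK by linarith [dvK_bds.2])
  have h5 : u * (-Real.log u - dvK) ≤ u * ((1 - dvK) + ε) := mul_le_mul_of_nonneg_left (by linarith) hu0.le
  have h6 : u * ε ≤ ε := mul_le_of_le_one_left hε hu1.le
  rw [dvE_lt1 hu1]
  linarith

lemma dv_pos_of {p : ℕ} {u : ℝ} (hp : 0 < p) (hu : 1 / (p:ℝ) ≤ u) : 0 < u :=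
  lt_of_lt_of_le (by positivity) hu

lemma dvBase2 : dvBase 2 (9 / 10) := by
  have := dv_baseN (p := 2) (by norm_num) 9 10 (by norm_num) 0.535 0.693 0.694 0 (by norm_num) (by norm_num) (by norm_num)
    (by norm_num) (by push_cast; linarith [Real.log_two_gt_d9]) (by push_cast; linarith [Real.log_two_lt_d9]) (by norm_num) (by norm_num)
    (fun u h1 h2 => dv_exc_lin (p := 2) (by norm_num) (by norm_num) (by norm_num) h1 h2 (by push_cast; linarith [Real.log_two_lt_d9]))
    (by norm_num) (by norm_num)
  exact_mod_cast this

lemma dvBase3 : dvBase 3 (9 / 10) := by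
  have := dv_baseN (p := 3) (by norm_num) 9 10 (by norm_num) 0.372 1.098 1.099 0.105 (by norm_num) (by norm_num) (by norm_num)
    (by norm_num) (by push_cast; linarith [Real.log_three_gt_d9]) (by push_cast; linarith [Real.log_three_lt_d9]) (by norm_num) (by norm_num)
    (fun u h1 h2 => dv_exc_lin (p := 3) (by norm_num) (by norm_num) (by norm_num) h1 h2 (by push_cast; linarith [Real.log_three_lt_d9]))
    (by norm_num) (by norm_num)
  exact_mod_cast this

lemma dvBase5 : dvBase 5 (21 / 25) := by
  have := dv_baseN (p := 5) (by norm_num) 21 25 (by norm_num) 0.258 1.609 1.610 0.105 (by norm_num) (by norm_num) (by norm_num)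
    (by norm_num) (by push_cast; linarith [Real.log_five_gt_d9]) (by push_cast; linarith [Real.log_five_lt_d9]) (by norm_num) (by norm_num)
    (fun u h1 h2 => dv_exc84' (by norm_num) (dv_pos_of (by norm_num) h1) h2)
    (by norm_num) (by norm_num)
  exact_mod_cast this

lemma dvBase7 : dvBase 7 (4 / 5) := by
  have := dv_baseN (p := 7) (by norm_num) 4 5 (by norm_num) 0.21 1.945 1.946 0.105 (by norm_num) (by norm_num) (by norm_num)
    (by norm_num) (by push_cast; linarith [dvl7.1]) (by push_cast; linarith [dvl7.2]) (by norm_num) (by norm_num)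
    (fun u h1 h2 => dv_exc84' (by norm_num) (dv_pos_of (by norm_num) h1) h2)
    (by norm_num) (by norm_num)
  exact_mod_cast this

lemma dvBase11 : dvBase 11 (7 / 10) := by
  have := dv_baseN (p := 11) (by norm_num) 7 10 (by norm_num) 0.186 2.397 2.398 0.105 (by norm_num) (by norm_num) (by norm_num)
    (by norm_num) (by push_cast; linarith [dvl11.1]) (by push_cast; linarith [dvl11.2]) (by norm_num) (by norm_num)
    (fun u h1 h2 => dv_exc84' (by norm_num) (dv_pos_of (by norm_num) h1) h2)
    (by norm_num) (by norm_num)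
  exact_mod_cast this

lemma dvBase13 : dvBase 13 (7 / 10) := by
  have := dv_baseN (p := 13) (by norm_num) 7 10 (by norm_num) 0.166 2.564 2.565 0.105 (by norm_num) (by norm_num) (by norm_num)
    (by norm_num) (by push_cast; linarith [dvl13.1]) (by push_cast; linarith [dvl13.2]) (by norm_num) (by norm_num)
    (fun u h1 h2 => dv_exc84' (by norm_num) (dv_pos_of (by norm_num) h1) h2)
    (by norm_num) (by norm_num)
  exact_mod_cast this

lemma dvBase17 : dvBase 17 (7 / 10) := by
  have := dv_baseN (p := 17) (by norm_num) 7 10 (by norm_num) 0.137 2.833 2.834 0.105 (by norm_num) (by norm_num) (by norm_num)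
    (by norm_num) (by push_cast; linarith [dvl17.1]) (by push_cast; linarith [dvl17.2]) (by norm_num) (by norm_num)
    (fun u h1 h2 => dv_exc84' (by norm_num) (dv_pos_of (by norm_num) h1) h2)
    (by norm_num) (by norm_num)
  exact_mod_cast this

lemma dvBase19 : dvBase 19 (7 / 10) := by
  have := dv_baseN (p := 19) (by norm_num) 7 10 (by norm_num) 0.127 2.944 2.945 0.105 (by norm_num) (by norm_num) (by norm_num)
    (by norm_num) (by push_cast; linarith [dvl19.1]) (by push_cast; linarith [dvl19.2]) (by norm_num) (by norm_num)
    (fun u h1 h2 => dv_exc84' (by norm_num) (dv_pos_of (by norm_num) h1) h2)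
    (by norm_num) (by norm_num)
  exact_mod_cast this



noncomputable def dvDp (θ0 : ℝ) (p : ℕ) : ℝ := 2 * Real.log p / ((p:ℝ) ^ θ0 + 1)
noncomputable def dvUp (θ0 : ℝ) (p : ℕ) : ℝ := 2 * Real.log (1 + (p:ℝ) ^ (-θ0))
noncomputable def dvEl (p : ℕ) : ℝ := Real.log (2 - 2 / (p:ℝ))
noncomputable def dvG (θ0 τ : ℝ) (p : ℕ) : ℝ := θ0 * dvDp θ0 p + (1 + τ) * dvUp θ0 p - dvEl p

lemma dvP_exp (Q : Finset ℕ) (θ : ℝ) : dvP Q θ = Real.exp (∑ p ∈ Q, dvUp θ p) := by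
  rw [Real.exp_sum, dvP]
  refine Finset.prod_congr rfl fun p _ => ?_
  rw [dvUp, two_mul, Real.exp_add, Real.exp_log (by positivity), sq]

lemma dv_two_sub {p : ℕ} (hp : 2 ≤ p) : 1 ≤ 2 - 2 / (p:ℝ) := by
  have hp2 : (2:ℝ) ≤ p := by exact_mod_cast hp
  have : 2 / (p:ℝ) ≤ 1 := by rw [div_le_one (by linarith)]; exact hp2
  linarith

lemma dvc_exp (Q : Finset ℕ) (hQ : ∀ r ∈ Q, r.Prime) : dvc Q = 2 * Real.exp (∑ p ∈ Q, dvEl p) := by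
  rw [Real.exp_sum, dvc]
  congr 1
  refine Finset.prod_congr rfl fun p hp => ?_
  rw [dvEl, Real.exp_log (by linarith [dv_two_sub (hQ p hp).two_le])]

lemma dvP_one_le (Q : Finset ℕ) (θ : ℝ) : 1 ≤ dvP Q θ := by
  refine Finset.one_le_prod fun p _ => ?_
  have : 0 ≤ (p:ℝ) ^ (-θ) := by positivity
  nlinarith

lemma dv_mono1 {p : ℕ} (hp : 2 ≤ p) {θ θ0 : ℝ} :
    dvUp θ0 p ≤ (θ - θ0) * dvDp θ0 p + dvUp θ p := by
  have hp2 : (2:ℝ) ≤ p := by exact_mod_cast hp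
  have hp0 : (0:ℝ) < p := by linarith
  set b := (p:ℝ) ^ (-θ0) with hb
  have hb0 : 0 < b := by positivity
  set δ := (θ - θ0) * Real.log p with hδ
  have e1 : (p:ℝ) ^ (-θ) = b * Real.exp (-δ) := by
    rw [hb, Real.rpow_def_of_pos hp0, Real.rpow_def_of_pos hp0, ← Real.exp_add, hδ]; congr 1; ring
  have e2 : (p:ℝ) ^ θ0 = 1 / b := by rw [hb, Real.rpow_neg hp0.le]; simp
  have e3 : (θ - θ0) * dvDp θ0 p = 2 * (b / (1 + b) * δ) := by
    rw [dvDp, e2, hδ]; field_simp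
  have hc := convexOn_exp.2 (Set.mem_univ (0:ℝ)) (Set.mem_univ (-δ)) (show 0 ≤ 1 / (1 + b) by positivity)
    (show 0 ≤ b / (1 + b) by positivity) (by field_simp)
  simp only [smul_eq_mul, mul_zero, zero_add, Real.exp_zero, mul_one] at hc
  have h1 : (1 + b) * Real.exp (b / (1 + b) * -δ) ≤ 1 + b * Real.exp (-δ) := by
    have := mul_le_mul_of_nonneg_left hc (show 0 ≤ 1 + b by positivity)
    calc _ ≤ _ := this
      _ = _ := by field_simp
  have h2 := Real.log_le_log (by positivity) h1
  rw [Real.log_mul (by positivity) (by positivity), Real.log_exp] at h2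
  rw [e3, dvUp, dvUp, ← hb, e1]
  linarith

lemma dv_mono (Q : Finset ℕ) (hQ : ∀ r ∈ Q, r.Prime) {θ θ0 x : ℝ} (hx : 0 < x) (h : θ0 ≤ θ)
    (hL : ∑ p ∈ Q, dvDp θ0 p ≤ Real.log x) : dvP Q θ0 * x ^ θ0 ≤ dvP Q θ * x ^ θ := by
  rw [dvP_exp, dvP_exp, Real.rpow_def_of_pos hx, Real.rpow_def_of_pos hx, ← Real.exp_add, ← Real.exp_add]
  refine Real.exp_le_exp.2 ?_
  have h1 : ∑ p ∈ Q, dvUp θ0 p ≤ ∑ p ∈ Q, ((θ - θ0) * dvDp θ0 p + dvUp θ p) :=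
    Finset.sum_le_sum fun p hp => dv_mono1 (hQ p hp).two_le
  rw [Finset.sum_add_distrib, ← Finset.mul_sum] at h1
  have h2 := mul_le_mul_of_nonneg_left hL (sub_nonneg.2 h)
  linarith

lemma dv_core (Q : Finset ℕ) (hQ : ∀ r ∈ Q, r.Prime) {θ θ0 x c ρ τ : ℝ} (hx : 1 ≤ x) (h0 : 0 ≤ θ0) (h : θ0 ≤ θ)
    (hc : 0 < c) (hρ0 : 0 < ρ) (hρ : ∀ P : ℝ, 1 ≤ P → P - 1 ≤ ρ * P ^ (1 + τ))
    (hnum : ∑ p ∈ Q, dvG θ0 τ p ≤ Real.log (2 / (c * ρ))) :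
    c * (dvP Q θ0 * x ^ θ0) ≤ c * (dvP Q θ * x ^ θ) + dvc Q := by
  have hx0 : 0 < x := by linarith
  have hcp : 0 ≤ dvc Q := by rw [dvc_exp Q hQ]; positivity
  by_cases hL : ∑ p ∈ Q, dvDp θ0 p ≤ Real.log x
  · have := mul_le_mul_of_nonneg_left (dv_mono Q hQ hx0 h hL) hc.le
    linarith
  push Not at hL
  have h1 : x ^ θ0 ≤ dvP Q θ * x ^ θ := by
    calc x ^ θ0 ≤ x ^ θ := Real.rpow_le_rpow_of_exponent_le hx h
      _ ≤ _ := le_mul_of_one_le_left (by positivity) (dvP_one_le Q θ)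
  have h2 := hρ _ (dvP_one_le Q θ0)
  have h3 : dvP Q θ0 * x ^ θ0 ≤ x ^ θ0 + ρ * ((dvP Q θ0) ^ (1 + τ) * x ^ θ0) := by
    have := mul_le_mul_of_nonneg_right h2 (show 0 ≤ x ^ θ0 by positivity)
    linarith
  have h4 : c * (ρ * ((dvP Q θ0) ^ (1 + τ) * x ^ θ0)) ≤ dvc Q := by
    rw [dvP_exp, dvc_exp Q hQ, ← Real.exp_mul, Real.rpow_def_of_pos hx0, ← Real.exp_add, ← mul_assoc]
    have hn := hnum
    simp only [dvG] at hn
    rw [Finset.sum_sub_distrib, Finset.sum_add_distrib, ← Finset.mul_sum, ← Finset.mul_sum] at hn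
    have h5 : (∑ p ∈ Q, dvUp θ0 p) * (1 + τ) + Real.log x * θ0 ≤ Real.log (2 / (c * ρ)) + ∑ p ∈ Q, dvEl p := by
      have := mul_le_mul_of_nonneg_left hL.le h0
      linarith
    have h6 := Real.exp_le_exp.2 h5
    rw [Real.exp_add (Real.log (2 / (c * ρ))), Real.exp_log (by positivity)] at h6
    have h7 := mul_le_mul_of_nonneg_left h6 (show 0 ≤ c * ρ by positivity)
    calc _ ≤ _ := h7
      _ = _ := by field_simp
  have h5 := mul_le_mul_of_nonneg_left h3 hc.le
  have h6 := mul_le_mul_of_nonneg_left h1 hc.le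
  linarith

lemma dv_sum_S (Q S : Finset ℕ) (g k : ℕ → ℝ) (hk : ∀ p ∈ S, 0 ≤ k p) (h1 : ∀ p ∈ Q, p ∈ S → g p ≤ k p)
    (h2 : ∀ p ∈ Q, p ∉ S → g p ≤ 0) : ∑ p ∈ Q, g p ≤ ∑ p ∈ S, k p := by
  classical
  calc ∑ p ∈ Q, g p ≤ ∑ p ∈ Q, (if p ∈ S then k p else 0) := by
        refine Finset.sum_le_sum fun p hp => ?_
        split_ifs with h
        · exact h1 p hp h
        · exact h2 p hp h
    _ = ∑ p ∈ Q ∩ S, k p := by rw [Finset.sum_ite_mem]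
    _ ≤ _ := Finset.sum_le_sum_of_subset_of_nonneg Finset.inter_subset_right fun p hp _ => hk p hp

lemma dv_rpos {r z : ℝ} {n d : ℕ} (hd : 0 < d) (hr : 0 < r) (hz : 0 < z) (h : r ^ d ≤ z ^ n) :
    r ≤ z ^ ((n:ℝ) / d) := by
  have hd' : (0:ℝ) < d := by exact_mod_cast hd
  have h1 : r = (r ^ d) ^ ((1:ℝ) / d) := by
    rw [← Real.rpow_natCast, ← Real.rpow_mul hr.le, mul_one_div_cancel hd'.ne', Real.rpow_one]
  have h2 : z ^ ((n:ℝ) / d) = (z ^ n) ^ ((1:ℝ) / d) := by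
    rw [← Real.rpow_natCast, ← Real.rpow_mul hz.le]; congr 1; ring
  rw [h1, h2]
  exact Real.rpow_le_rpow (by positivity) h (by positivity)

lemma dv_El_lb {p : ℕ} (hp : 2 ≤ p) : 0.693147 -
    (1 / ((p:ℝ) - 1) - (1 / ((p:ℝ) - 1)) ^ 2 / 2 + (1 / ((p:ℝ) - 1)) ^ 3 / 3) ≤ dvEl p := by
  have hp2 : (2:ℝ) ≤ p := by exact_mod_cast hp
  have hp1 : (0:ℝ) < (p:ℝ) - 1 := by linarith
  have h := dv_log_ub (show 0 ≤ 1 / ((p:ℝ) - 1) by positivity)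
  have e : Real.log (2 - 2 / (p:ℝ)) = Real.log 2 - Real.log (1 + 1 / ((p:ℝ) - 1)) := by
    rw [← Real.log_div (by norm_num) (by positivity)]
    congr 1; field_simp; ring
  rw [dvEl, e]
  linarith [Real.log_two_gt_d9]

lemma dv_El_mono {p q : ℕ} (hp : 2 ≤ p) (hpq : p ≤ q) : dvEl p ≤ dvEl q := by
  have hp2 : (2:ℝ) ≤ p := by exact_mod_cast hp
  have hq : (p:ℝ) ≤ q := by exact_mod_cast hpq
  refine Real.log_le_log (by linarith [dv_two_sub hp]) ?_
  have : 2 / (q:ℝ) ≤ 2 / p := by gcongr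
  linarith

lemma dv_Dp_ub {p n d : ℕ} (hp : 2 ≤ p) (hd : 0 < d) {R h : ℝ} (hR : 0 < R) (hRp : R ^ d ≤ (p:ℝ) ^ n)
    (hh : Real.log p ≤ h) : dvDp ((n:ℝ) / d) p ≤ 2 * h / (R + 1) := by
  have hp2 : (2:ℝ) ≤ p := by exact_mod_cast hp
  have h1 := dv_rpos hd hR (by linarith : (0:ℝ) < p) hRp
  have h2 := Real.log_nonneg (show (1:ℝ) ≤ p by linarith)
  rw [dvDp]
  gcongr
  linarith

lemma dvG_num {p n d : ℕ} (hp : 2 ≤ p) (hd : 0 < d) {R h τ : ℝ} (hτ : 0 ≤ τ) (hR : 0 < R) (hRp : R ^ d ≤ (p:ℝ) ^ n)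
    (hh : Real.log p ≤ h) : dvG ((n:ℝ) / d) τ p ≤ (n:ℝ) / d * (2 * h / (R + 1)) +
      (1 + τ) * (2 * (1 / R - (1 / R) ^ 2 / 2 + (1 / R) ^ 3 / 3)) - (0.693147 -
    (1 / ((p:ℝ) - 1) - (1 / ((p:ℝ) - 1)) ^ 2 / 2 + (1 / ((p:ℝ) - 1)) ^ 3 / 3)) := by
  have hp2 : (2:ℝ) ≤ p := by exact_mod_cast hp
  have h1 := dv_rpos hd hR (by linarith : (0:ℝ) < p) hRp
  have h2 := dv_El_lb hp
  have h3 := mul_le_mul_of_nonneg_left (dv_Dp_ub hp hd hR hRp hh) (show 0 ≤ (n:ℝ) / d by positivity)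
  have h4 : dvUp ((n:ℝ) / d) p ≤ 2 * (1 / R - (1 / R) ^ 2 / 2 + (1 / R) ^ 3 / 3) := by
    have h5 := dv_log_ub (show 0 ≤ 1 / R by positivity)
    have h6 : (p:ℝ) ^ (-((n:ℝ) / d)) ≤ 1 / R := by
      rw [Real.rpow_neg (by linarith), ← one_div]; gcongr
    have h7 := Real.log_le_log (by positivity) (show 1 + (p:ℝ) ^ (-((n:ℝ) / d)) ≤ 1 + 1 / R by linarith)
    rw [dvUp]; linarith
  have h5 := mul_le_mul_of_nonneg_left h4 (show 0 ≤ 1 + τ by positivity)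
  rw [dvG]; linarith

lemma dvG_tail {p P n d : ℕ} (hP : 2 ≤ P) (hp : P ≤ p) (hd : 0 < d) {R h τ : ℝ} (hτ : 0 ≤ τ) (hR : 0 < R)
    (hRp : R ^ d ≤ (P:ℝ) ^ n) (hh : Real.log P ≤ h)
    (hnum : 2 * ((n:ℝ) / d * h + 1 + τ) / R ≤ 0.693147 -
    (1 / ((P:ℝ) - 1) - (1 / ((P:ℝ) - 1)) ^ 2 / 2 + (1 / ((P:ℝ) - 1)) ^ 3 / 3)) :
    dvG ((n:ℝ) / d) τ p ≤ 0 := by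
  have hP2 : (2:ℝ) ≤ P := by exact_mod_cast hP
  have hpP : (P:ℝ) ≤ p := by exact_mod_cast hp
  have hp0 : (0:ℝ) < p := by linarith
  have hP0 : (0:ℝ) < P := by linarith
  set θ0 := (n:ℝ) / d with hθ
  have hθ0 : 0 ≤ θ0 := by positivity
  have h1 := dv_rpos hd hR hP0 hRp
  have h2 := (dv_El_lb hP).trans (dv_El_mono hP hp)
  have hlp := Real.log_nonneg (show (1:ℝ) ≤ p by linarith)
  have hlP := Real.log_nonneg (show (1:ℝ) ≤ P by linarith)
  have hll := Real.log_le_log hP0 hpP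
  set b := (p:ℝ) ^ (-θ0) with hb
  have hb0 : 0 < b := by positivity
  have h3 : dvDp θ0 p ≤ 2 * Real.log p * b := by
    rw [dvDp, hb, Real.rpow_neg hp0.le, ← div_eq_mul_inv]
    exact div_le_div_of_nonneg_left (by positivity) (by positivity) (by linarith)
  have h4 : dvUp θ0 p ≤ 2 * b := by
    rw [dvUp, ← hb]
    have := Real.log_le_sub_one_of_pos (show 0 < 1 + b by positivity)
    linarith
  have h5 : θ0 * dvDp θ0 p + (1 + τ) * dvUp θ0 p ≤ 2 * ((θ0 * Real.log p + 1 + τ) * b) := by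
    have a1 := mul_le_mul_of_nonneg_left h3 hθ0
    have a2 := mul_le_mul_of_nonneg_left h4 (show 0 ≤ 1 + τ by positivity)
    linarith
  have h6 : (θ0 * Real.log p + 1 + τ) * b ≤ (θ0 * Real.log P + 1 + τ) * (P:ℝ) ^ (-θ0) := by
    have e1 : (P:ℝ) ^ (-θ0) = b * Real.exp (θ0 * Real.log p - θ0 * Real.log P) := by
      rw [hb, Real.rpow_def_of_pos hp0, Real.rpow_def_of_pos hP0, ← Real.exp_add]; congr 1; ring
    rw [e1]
    have e2 := Real.add_one_le_exp (θ0 * Real.log p - θ0 * Real.log P)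
    have e3 : 0 ≤ θ0 * Real.log p - θ0 * Real.log P := by
      rw [← mul_sub]; exact mul_nonneg hθ0 (by linarith)
    have e4 : 0 ≤ θ0 * Real.log P := by positivity
    have e5 : (θ0 * Real.log p + 1 + τ) ≤ (θ0 * Real.log P + 1 + τ) * Real.exp (θ0 * Real.log p - θ0 * Real.log P) := by
      refine le_trans ?_ (mul_le_mul_of_nonneg_left e2 (by positivity))
      nlinarith
    calc _ ≤ _ := mul_le_mul_of_nonneg_right e5 hb0.le
      _ = _ := by ring
  have h7 : (θ0 * Real.log P + 1 + τ) * (P:ℝ) ^ (-θ0) ≤ (θ0 * h + 1 + τ) * (1 / R) := by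
    have e1 : (P:ℝ) ^ (-θ0) ≤ 1 / R := by
      rw [Real.rpow_neg hP0.le, ← one_div]; gcongr
    have e2 := mul_le_mul_of_nonneg_left hh hθ0
    have e4 : 0 ≤ θ0 * Real.log P := by positivity
    exact mul_le_mul (by linarith) e1 (by positivity) (by linarith)
  have h8 : 2 * ((θ0 * h + 1 + τ) * (1 / R)) = 2 * (θ0 * h + 1 + τ) / R := by ring
  rw [dvG]
  linarith


lemma dvl53 : 3.970288 < Real.log 53 ∧ Real.log 53 < 3.970296 := by
  have h := dv_lg_aux 53 2808 (by norm_num) (by norm_num) (by norm_num)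
  have hm : Real.log 2808 = 3 * Real.log 2 + 3 * Real.log 3 + 1 * Real.log 13 := by
    rw [show (2808:ℝ) = ((2:ℝ)^3) * ((3:ℝ)^3) * ((13:ℝ)^1) by norm_num]
    repeat rw [Real.log_mul (by norm_num) (by norm_num)]
    simp only [Real.log_pow]; norm_num
  rw [hm] at h
  have h2 := Real.log_two_gt_d9
  have h2' := Real.log_two_lt_d9
  have h3 := Real.log_three_gt_d9
  have h3' := Real.log_three_lt_d9
  have g13 := dvl13
  norm_num at *
  constructor <;> linarith

lemma dv_rho (P : ℝ) (hP : 1 ≤ P) : P - 1 ≤ 0.4475 * P ^ (1 + (3:ℝ) / 8) := by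
  have h := one_add_mul_self_le_rpow_one_add (s := P / (11 / 3) - 1) (by
    have : 0 ≤ P / (11 / 3) := by positivity
    linarith) (p := 1 + 3 / 8) (by norm_num)
  rw [show 1 + (P / (11 / 3) - 1) = P / (11 / 3) by ring, Real.div_rpow (by linarith) (by norm_num),
    le_div_iff₀ (by positivity)] at h
  have h2 := dv_rpos (r := 5.96) (z := 11 / 3) (n := 11) (d := 8) (by norm_num) (by norm_num) (by norm_num) (by norm_num)
  rw [show ((11:ℕ):ℝ) / ((8:ℕ):ℝ) = 1 + 3 / 8 by norm_num] at h2
  nlinarith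

lemma dv_caseB {p : ℕ} {θ0 θ C τ ρ x : ℝ} (Q : Finset ℕ) (hQ : ∀ r ∈ Q, r.Prime) (hp : p ∈ Q) (hB : dvBase p θ0)
    (h0 : 7 / 10 ≤ θ0) (hθ : 7 / 12 ≤ θ) (hC : 1 - dvK ≤ C) (hC2 : dvD ≤ C * 2 ^ θ) (hx : 1 ≤ x)
    (hρ0 : 0 < ρ) (hρ : ∀ P : ℝ, 1 ≤ P → P - 1 ≤ ρ * P ^ (1 + τ))
    (hnum : ∑ p ∈ Q, dvG θ0 τ p ≤ Real.log (2 / ((1 - dvK) * ρ))) :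
    |dvE Q x| ≤ C * (dvP Q θ * x ^ θ) + dvc Q := by
  have hx0 : 0 < x := by linarith
  have hcp : 0 ≤ dvc Q := by rw [dvc_exp Q hQ]; positivity
  have hk := dvK_bds
  have hpQ : ({p} : Finset ℕ) ⊆ Q := by simpa using hp
  rcases le_total θ θ0 with h | h
  · have := dvE_sub C θ {p} Q hpQ hQ (hB θ C hθ h hC hC2) x hx0
    linarith
  · have h2 : dvD ≤ (1 - dvK) * 2 ^ θ0 := by
      have h3 := dvD_bds
      have h4 : (1.62:ℝ) ≤ 2 ^ θ0 := by
        have := dv_rpos (r := 1.62) (z := 2) (n := 7) (d := 10) (by norm_num) (by norm_num) (by norm_num) (by norm_num)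
        refine this.trans (Real.rpow_le_rpow_of_exponent_le (by norm_num) ?_)
        norm_num; linarith
      nlinarith
    have h3 := dvE_sub (1 - dvK) θ0 {p} Q hpQ hQ (hB θ0 _ (by linarith) le_rfl le_rfl h2) x hx0
    have h4 := dv_core Q hQ hx (by linarith) h (by linarith) hρ0 hρ hnum
    have h5 := mul_le_mul_of_nonneg_right hC (mul_pos (dvP_pos Q θ) (Real.rpow_pos_of_pos hx0 θ)).le
    linarith

lemma dv_num5 (Q : Finset ℕ) (hQ : ∀ r ∈ Q, r.Prime) (hm : ∀ r ∈ Q, 5 ≤ r) :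
    ∑ p ∈ Q, dvG (21 / 25) (3 / 8) p ≤ 1.6 := by
  have e : ((21:ℝ) / 25) = ((21:ℕ):ℝ) / ((25:ℕ):ℝ) := by norm_num
  have g5 : dvG (21 / 25) (3 / 8) 5 ≤ 0.7222 := by
    rw [e]
    refine (dvG_num (p := 5) (n := 21) (d := 25) (R := 3.864) (h := 1.609437913) (by norm_num) (by norm_num) (by norm_num) (by norm_num) (by norm_num) (by exact_mod_cast (Real.log_five_lt_d9.le.trans (by norm_num : (1.6094379126:ℝ) ≤ 1.609437913)))).trans ?_
    norm_num
  have g7 : dvG (21 / 25) (3 / 8) 7 ≤ 0.4857 := by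
    rw [e]
    refine (dvG_num (p := 7) (n := 21) (d := 25) (R := 5.127) (h := 1.945912) (by norm_num) (by norm_num) (by norm_num) (by norm_num) (by norm_num) (by exact_mod_cast dvl7.2.le)).trans ?_
    norm_num
  have g11 : dvG (21 / 25) (3 / 8) 11 ≤ 0.2212 := by
    rw [e]
    refine (dvG_num (p := 11) (n := 21) (d := 25) (R := 7.494) (h := 2.397897) (by norm_num) (by norm_num) (by norm_num) (by norm_num) (by norm_num) (by exact_mod_cast dvl11.2.le)).trans ?_
    norm_num
  have g13 : dvG (21 / 25) (3 / 8) 13 ≤ 0.1365 := by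
    rw [e]
    refine (dvG_num (p := 13) (n := 21) (d := 25) (R := 8.624) (h := 2.564953) (by norm_num) (by norm_num) (by norm_num) (by norm_num) (by norm_num) (by exact_mod_cast dvl13.2.le)).trans ?_
    norm_num
  have g17 : dvG (21 / 25) (3 / 8) 17 ≤ 0.0143 := by
    rw [e]
    refine (dvG_num (p := 17) (n := 21) (d := 25) (R := 10.803) (h := 2.833217) (by norm_num) (by norm_num) (by norm_num) (by norm_num) (by norm_num) (by exact_mod_cast dvl17.2.le)).trans ?_
    norm_num
  have g19 : dvG (21 / 25) (3 / 8) 19 ≤ 0 := by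
    rw [e]
    refine (dvG_num (p := 19) (n := 21) (d := 25) (R := 11.861) (h := 2.944442) (by norm_num) (by norm_num) (by norm_num) (by norm_num) (by norm_num) (by exact_mod_cast dvl19.2.le)).trans ?_
    norm_num
  have h := dv_sum_S Q {5, 7, 11, 13, 17} (dvG (21 / 25) (3 / 8)) (fun p => max (dvG (21 / 25) (3 / 8) p) 0)
    (fun p _ => le_max_right _ _) (fun p _ _ => le_max_left _ _) ?_
  · refine h.trans ?_
    repeat rw [Finset.sum_insert (by decide)]
    rw [Finset.sum_singleton]
    have k5 := max_le g5 (show (0:ℝ) ≤ _ by norm_num)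
    have k7 := max_le g7 (show (0:ℝ) ≤ _ by norm_num)
    have k11 := max_le g11 (show (0:ℝ) ≤ _ by norm_num)
    have k13 := max_le g13 (show (0:ℝ) ≤ _ by norm_num)
    have k17 := max_le g17 (show (0:ℝ) ≤ _ by norm_num)
    linarith
  · intro p hp hS
    have hp1 := hQ p hp
    have hp2 := hm p hp
    rcases lt_or_ge p 23 with h | h
    · interval_cases p <;> first | assumption | (exfalso; revert hS; decide) | (exfalso; revert hp1; norm_num; done)
    · rw [e]
      exact dvG_tail (P := 23) (R := 13.926) (h := 3.135498) (by norm_num) h (by norm_num) (by norm_num) (by norm_num) (by norm_num) (by exact_mod_cast dvl23.2.le) (by norm_num)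

lemma dv_num7 (Q : Finset ℕ) (hQ : ∀ r ∈ Q, r.Prime) (hm : ∀ r ∈ Q, 7 ≤ r) :
    ∑ p ∈ Q, dvG (4 / 5) 0 p ≤ 0.69 := by
  have e : ((4:ℝ) / 5) = ((4:ℕ):ℝ) / ((5:ℕ):ℝ) := by norm_num
  have g7 : dvG (4 / 5) 0 7 ≤ 0.3868 := by
    rw [e]
    refine (dvG_num (p := 7) (n := 4) (d := 5) (R := 4.743) (h := 1.945912) (by norm_num) (by norm_num) (by norm_num) (by norm_num) (by norm_num) (by exact_mod_cast dvl7.2.le)).trans ?_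
    norm_num
  have g11 : dvG (4 / 5) 0 11 ≤ 0.1678 := by
    rw [e]
    refine (dvG_num (p := 11) (n := 4) (d := 5) (R := 6.809) (h := 2.397897) (by norm_num) (by norm_num) (by norm_num) (by norm_num) (by norm_num) (by exact_mod_cast dvl11.2.le)).trans ?_
    norm_num
  have g13 : dvG (4 / 5) 0 13 ≤ 0.0961 := by
    rw [e]
    refine (dvG_num (p := 13) (n := 4) (d := 5) (R := 7.783) (h := 2.564953) (by norm_num) (by norm_num) (by norm_num) (by norm_num) (by norm_num) (by exact_mod_cast dvl13.2.le)).trans ?_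
    norm_num
  have g17 : dvG (4 / 5) 0 17 ≤ 0 := by
    rw [e]
    refine (dvG_num (p := 17) (n := 4) (d := 5) (R := 9.646) (h := 2.833217) (by norm_num) (by norm_num) (by norm_num) (by norm_num) (by norm_num) (by exact_mod_cast dvl17.2.le)).trans ?_
    norm_num
  have h := dv_sum_S Q {7, 11, 13} (dvG (4 / 5) 0) (fun p => max (dvG (4 / 5) 0 p) 0)
    (fun p _ => le_max_right _ _) (fun p _ _ => le_max_left _ _) ?_
  · refine h.trans ?_
    repeat rw [Finset.sum_insert (by decide)]
    rw [Finset.sum_singleton]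
    have k7 := max_le g7 (show (0:ℝ) ≤ _ by norm_num)
    have k11 := max_le g11 (show (0:ℝ) ≤ _ by norm_num)
    have k13 := max_le g13 (show (0:ℝ) ≤ _ by norm_num)
    linarith
  · intro p hp hS
    have hp1 := hQ p hp
    have hp2 := hm p hp
    rcases lt_or_ge p 19 with h | h
    · interval_cases p <;> first | assumption | (exfalso; revert hS; decide) | (exfalso; revert hp1; norm_num; done)
    · rw [e]
      exact dvG_tail (P := 19) (R := 10.543) (h := 2.944442) (by norm_num) h (by norm_num) (by norm_num) (by norm_num) (by norm_num) (by exact_mod_cast dvl19.2.le) (by norm_num)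

lemma dv_num11 (Q : Finset ℕ) (hQ : ∀ r ∈ Q, r.Prime) (hm : ∀ r ∈ Q, 11 ≤ r) :
    ∑ p ∈ Q, dvG (7 / 10) 0 p ≤ 0.69 := by
  have e : ((7:ℝ) / 10) = ((7:ℕ):ℝ) / ((10:ℕ):ℝ) := by norm_num
  have g11 : dvG (7 / 10) 0 11 ≤ 0.2732 := by
    rw [e]
    refine (dvG_num (p := 11) (n := 7) (d := 10) (R := 5.357) (h := 2.397897) (by norm_num) (by norm_num) (by norm_num) (by norm_num) (by norm_num) (by exact_mod_cast dvl11.2.le)).trans ?_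
    norm_num
  have g13 : dvG (7 / 10) 0 13 ≤ 0.2059 := by
    rw [e]
    refine (dvG_num (p := 13) (n := 7) (d := 10) (R := 6.022) (h := 2.564953) (by norm_num) (by norm_num) (by norm_num) (by norm_num) (by norm_num) (by exact_mod_cast dvl13.2.le)).trans ?_
    norm_num
  have g17 : dvG (7 / 10) 0 17 ≤ 0.1054 := by
    rw [e]
    refine (dvG_num (p := 17) (n := 7) (d := 10) (R := 7.266) (h := 2.833217) (by norm_num) (by norm_num) (by norm_num) (by norm_num) (by norm_num) (by exact_mod_cast dvl17.2.le)).trans ?_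
    norm_num
  have g19 : dvG (7 / 10) 0 19 ≤ 0.0664 := by
    rw [e]
    refine (dvG_num (p := 19) (n := 7) (d := 10) (R := 7.854) (h := 2.944442) (by norm_num) (by norm_num) (by norm_num) (by norm_num) (by norm_num) (by exact_mod_cast dvl19.2.le)).trans ?_
    norm_num
  have g23 : dvG (7 / 10) 0 23 ≤ 0.0026 := by
    rw [e]
    refine (dvG_num (p := 23) (n := 7) (d := 10) (R := 8.978) (h := 3.135498) (by norm_num) (by norm_num) (by norm_num) (by norm_num) (by norm_num) (by exact_mod_cast dvl23.2.le)).trans ?_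
    norm_num
  have h := dv_sum_S Q {11, 13, 17, 19, 23} (dvG (7 / 10) 0) (fun p => max (dvG (7 / 10) 0 p) 0)
    (fun p _ => le_max_right _ _) (fun p _ _ => le_max_left _ _) ?_
  · refine h.trans ?_
    repeat rw [Finset.sum_insert (by decide)]
    rw [Finset.sum_singleton]
    have k11 := max_le g11 (show (0:ℝ) ≤ _ by norm_num)
    have k13 := max_le g13 (show (0:ℝ) ≤ _ by norm_num)
    have k17 := max_le g17 (show (0:ℝ) ≤ _ by norm_num)
    have k19 := max_le g19 (show (0:ℝ) ≤ _ by norm_num)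
    have k23 := max_le g23 (show (0:ℝ) ≤ _ by norm_num)
    linarith
  · intro p hp hS
    have hp1 := hQ p hp
    have hp2 := hm p hp
    rcases lt_or_ge p 29 with h | h
    · interval_cases p <;> first | assumption | (exfalso; revert hS; decide) | (exfalso; revert hp1; norm_num; done)
    · rw [e]
      exact dvG_tail (P := 29) (R := 10.560) (h := 3.367299) (by norm_num) h (by norm_num) (by norm_num) (by norm_num) (by norm_num) (by exact_mod_cast dvl29.2.le) (by norm_num)

lemma dv_num23 (Q : Finset ℕ) (hQ : ∀ r ∈ Q, r.Prime) (hm : ∀ r ∈ Q, 23 ≤ r) :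
    ∑ p ∈ Q, dvG (7 / 12) 0 p ≤ 0.4 := by
  have e : ((7:ℝ) / 12) = ((7:ℕ):ℝ) / ((12:ℕ):ℝ) := by norm_num
  have g23 : dvG (7 / 12) 0 23 ≤ 0.1557 := by
    rw [e]
    refine (dvG_num (p := 23) (n := 7) (d := 12) (R := 6.227) (h := 3.135498) (by norm_num) (by norm_num) (by norm_num) (by norm_num) (by norm_num) (by exact_mod_cast dvl23.2.le)).trans ?_
    norm_num
  have g29 : dvG (7 / 12) 0 29 ≤ 0.0880 := by
    rw [e]
    refine (dvG_num (p := 29) (n := 7) (d := 12) (R := 7.129) (h := 3.367299) (by norm_num) (by norm_num) (by norm_num) (by norm_num) (by norm_num) (by exact_mod_cast dvl29.2.le)).trans ?_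
    norm_num
  have g31 : dvG (7 / 12) 0 31 ≤ 0.0692 := by
    rw [e]
    refine (dvG_num (p := 31) (n := 7) (d := 12) (R := 7.412) (h := 3.433991) (by norm_num) (by norm_num) (by norm_num) (by norm_num) (by norm_num) (by exact_mod_cast dvl31.2.le)).trans ?_
    norm_num
  have g37 : dvG (7 / 12) 0 37 ≤ 0.0211 := by
    rw [e]
    refine (dvG_num (p := 37) (n := 7) (d := 12) (R := 8.218) (h := 3.610921) (by norm_num) (by norm_num) (by norm_num) (by norm_num) (by norm_num) (by exact_mod_cast dvl37.2.le)).trans ?_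
    norm_num
  have g41 : dvG (7 / 12) 0 41 ≤ 0 := by
    rw [e]
    refine (dvG_num (p := 41) (n := 7) (d := 12) (R := 8.725) (h := 3.713576) (by norm_num) (by norm_num) (by norm_num) (by norm_num) (by norm_num) (by exact_mod_cast dvl41.2.le)).trans ?_
    norm_num
  have g43 : dvG (7 / 12) 0 43 ≤ 0 := by
    rw [e]
    refine (dvG_num (p := 43) (n := 7) (d := 12) (R := 8.971) (h := 3.761204) (by norm_num) (by norm_num) (by norm_num) (by norm_num) (by norm_num) (by exact_mod_cast dvl43.2.le)).trans ?_
    norm_num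
  have g47 : dvG (7 / 12) 0 47 ≤ 0 := by
    rw [e]
    refine (dvG_num (p := 47) (n := 7) (d := 12) (R := 9.449) (h := 3.850151) (by norm_num) (by norm_num) (by norm_num) (by norm_num) (by norm_num) (by exact_mod_cast dvl47.2.le)).trans ?_
    norm_num
  have h := dv_sum_S Q {23, 29, 31, 37} (dvG (7 / 12) 0) (fun p => max (dvG (7 / 12) 0 p) 0)
    (fun p _ => le_max_right _ _) (fun p _ _ => le_max_left _ _) ?_
  · refine h.trans ?_
    repeat rw [Finset.sum_insert (by decide)]
    rw [Finset.sum_singleton]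
    have k23 := max_le g23 (show (0:ℝ) ≤ _ by norm_num)
    have k29 := max_le g29 (show (0:ℝ) ≤ _ by norm_num)
    have k31 := max_le g31 (show (0:ℝ) ≤ _ by norm_num)
    have k37 := max_le g37 (show (0:ℝ) ≤ _ by norm_num)
    linarith
  · intro p hp hS
    have hp1 := hQ p hp
    have hp2 := hm p hp
    rcases lt_or_ge p 53 with h | h
    · interval_cases p <;> first | assumption | (exfalso; revert hS; decide) | (exfalso; revert hp1; norm_num; done)
    · rw [e]
      exact dvG_tail (P := 53) (R := 10.135) (h := 3.970296) (by norm_num) h (by norm_num) (by norm_num) (by norm_num) (by norm_num) (by exact_mod_cast dvl53.2.le) (by norm_num)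

lemma dv_rho0 (P : ℝ) (_ : 1 ≤ P) : P - 1 ≤ 1 * P ^ (1 + (0:ℝ)) := by
  simp

lemma dv_logC : 0.69 ≤ Real.log (2 / ((1 - dvK) * 1)) := by
  have hk := dvK_bds
  have h := Real.log_le_log (by norm_num) (show (2:ℝ) ≤ 2 / ((1 - dvK) * 1) by
    rw [le_div_iff₀ (by linarith)]; linarith)
  linarith [Real.log_two_gt_d9]

lemma dv_case5 {θ C x : ℝ} (Q : Finset ℕ) (hQ : ∀ r ∈ Q, r.Prime) (hp : 5 ∈ Q) (hm : ∀ r ∈ Q, 5 ≤ r)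
    (hθ : 7 / 12 ≤ θ) (hC : 1 - dvK ≤ C) (hC2 : dvD ≤ C * 2 ^ θ) (hx : 1 ≤ x) :
    |dvE Q x| ≤ C * (dvP Q θ * x ^ θ) + dvc Q := by
  refine dv_caseB Q hQ hp dvBase5 (by norm_num) hθ hC hC2 hx (by norm_num) dv_rho ((dv_num5 Q hQ hm).trans ?_)
  have hk := dvK_bds
  have h := Real.log_le_log (by norm_num) (show (5:ℝ) ≤ 2 / ((1 - dvK) * 0.4475) by
    rw [le_div_iff₀ (by nlinarith)]; nlinarith)
  linarith [Real.log_five_gt_d9]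

lemma dv_case7 {θ C x : ℝ} (Q : Finset ℕ) (hQ : ∀ r ∈ Q, r.Prime) (hp : 7 ∈ Q) (hm : ∀ r ∈ Q, 7 ≤ r)
    (hθ : 7 / 12 ≤ θ) (hC : 1 - dvK ≤ C) (hC2 : dvD ≤ C * 2 ^ θ) (hx : 1 ≤ x) :
    |dvE Q x| ≤ C * (dvP Q θ * x ^ θ) + dvc Q :=
  dv_caseB Q hQ hp dvBase7 (by norm_num) hθ hC hC2 hx (by norm_num) dv_rho0 ((dv_num7 Q hQ hm).trans dv_logC)

lemma dv_case11 {p : ℕ} (hB : dvBase p (7 / 10)) {θ C x : ℝ} (Q : Finset ℕ) (hQ : ∀ r ∈ Q, r.Prime) (hp : p ∈ Q) (hm : ∀ r ∈ Q, 11 ≤ r)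
    (hθ : 7 / 12 ≤ θ) (hC : 1 - dvK ≤ C) (hC2 : dvD ≤ C * 2 ^ θ) (hx : 1 ≤ x) :
    |dvE Q x| ≤ C * (dvP Q θ * x ^ θ) + dvc Q :=
  dv_caseB Q hQ hp hB (by norm_num) hθ hC hC2 hx (by norm_num) dv_rho0 ((dv_num11 Q hQ hm).trans dv_logC)

lemma dv_case23 {θ C x : ℝ} (Q : Finset ℕ) (hQ : ∀ r ∈ Q, r.Prime) (hm : ∀ r ∈ Q, 23 ≤ r)
    (hθ : 7 / 12 ≤ θ) (hC2 : dvD ≤ C * 2 ^ θ) (hx : 2 ≤ x) :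
    |dvE Q x| ≤ C * (dvP Q θ * x ^ θ) + dvc Q := by
  have hx0 : 0 < x := by linarith
  have hD := dvD_bds
  have h1 := dvE_sub (dvD * (1 / 2) ^ ((7:ℝ) / 12)) (7 / 12) ∅ Q (by simp) hQ (by
    intro y hy
    refine (dv_712 y hy).trans (le_of_eq ?_)
    rw [show y / 2 = (1 / 2) * y by ring, Real.mul_rpow (by norm_num) hy.le]
    simp [dvP]; ring) x hx0
  have h2 := dv_core Q hQ (x := x / 2) (c := dvD) (ρ := 1) (τ := 0) (by linarith) (by norm_num) hθ (by linarith) (by norm_num) dv_rho0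
    ((dv_num23 Q hQ hm).trans (by
      have h := Real.log_le_log (by norm_num) (show (3 / 2:ℝ) ≤ 2 / (dvD * 1) by
        rw [le_div_iff₀ (by linarith)]; linarith)
      rw [Real.log_div (by norm_num) (by norm_num)] at h
      linarith [Real.log_three_gt_d9, Real.log_two_lt_d9]))
  have h3 : dvD * (dvP Q θ * (x / 2) ^ θ) ≤ C * (dvP Q θ * x ^ θ) := by
    have e : x ^ θ = 2 ^ θ * (x / 2) ^ θ := by
      rw [← Real.mul_rpow (by norm_num) (by linarith)]; congr 1; ring
    have := mul_le_mul_of_nonneg_right hC2 (mul_pos (dvP_pos Q θ) (Real.rpow_pos_of_pos (half_pos hx0) θ)).le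
    rw [e]; linarith
  have e2 : (x / 2) ^ ((7:ℝ) / 12) = (1 / 2) ^ ((7:ℝ) / 12) * x ^ ((7:ℝ) / 12) := by
    rw [← Real.mul_rpow (by norm_num) hx0.le]; congr 1; ring
  rw [e2] at h2
  linarith


noncomputable def dvB (p : ℕ) : ℝ :=
  53 / 43 * dvDp (9 / 10) p + 2 / 4.3 * (Real.log p / ((p:ℝ) - 1)) + dvEl p - 2 * Real.log 2
noncomputable def dvCc (p : ℕ) : ℝ := 53 / 43 * dvDp (9 / 10) p - dvEl p

lemma dv_El_ub {p : ℕ} (hp : 2 ≤ p) : dvEl p ≤ Real.log 2 - 1 / (p:ℝ) := by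
  have hp2 : (2:ℝ) ≤ p := by exact_mod_cast hp
  have h1 := dv_two_sub hp
  have e : 2 - 2 / (p:ℝ) = 2 * (1 - 1 / (p:ℝ)) := by ring
  have h2 : 0 < 1 - 1 / (p:ℝ) := by linarith
  rw [dvEl, e, Real.log_mul (by norm_num) h2.ne']
  have := Real.log_le_sub_one_of_pos h2
  linarith

lemma dv_El_nonneg {p : ℕ} (hp : 2 ≤ p) : 0 ≤ dvEl p := Real.log_nonneg (dv_two_sub hp)

lemma dv_Dp_nonneg {p : ℕ} (θ0 : ℝ) (hp : 2 ≤ p) : 0 ≤ dvDp θ0 p := by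
  have hp2 : (2:ℝ) ≤ p := by exact_mod_cast hp
  have := Real.log_nonneg (show (1:ℝ) ≤ p by linarith)
  rw [dvDp]; positivity

lemma dv_MC (r : Finset ℕ) (hr : ∀ p ∈ r, p.Prime) {x W A : ℝ} (hx : 3 ≤ x)
    (hL : Real.log x ≤ ∑ p ∈ r, dvDp (9 / 10) p + W)
    (hn : ∑ p ∈ r, dvB p + 53 / 43 * W - A ≤ 0.198) : dvM r x ≤ dvc r * Real.exp A := by
  have hx0 : 0 < x := by linarith
  have hk := dvK_bds
  have hlx : 0 < Real.log x := Real.log_pos (by linarith)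
  set SS := ∑ p ∈ r, Real.log p / ((p:ℝ) - 1) with hS
  have hS0 : 0 ≤ SS := by
    refine Finset.sum_nonneg fun p hp => ?_
    have : (2:ℝ) ≤ p := by exact_mod_cast (hr p hp).two_le
    exact div_nonneg (Real.log_nonneg (by linarith)) (by linarith)
  have e1 : ∏ p ∈ r, (1 - 1 / (p:ℝ)) = Real.exp (∑ p ∈ r, (dvEl p - Real.log 2)) := by
    rw [Real.exp_sum]
    refine Finset.prod_congr rfl fun p hp => ?_
    have h2 := dv_two_sub (hr p hp).two_le
    rw [Real.exp_sub, dvEl, Real.exp_log (by linarith), Real.exp_log (by norm_num)]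
    ring
  set Y := Real.log x + dvK + 2 * SS with hY
  have hY0 : 0 < Y := by linarith
  have hlY : Real.log Y ≤ Real.log 4.3 - 1 + Y / 4.3 := by
    have := Real.log_le_sub_one_of_pos (show 0 < Y / 4.3 by positivity)
    rw [Real.log_div hY0.ne' (by norm_num)] at this
    linarith
  have hl43 : Real.log 4.3 ≤ 1.45862 := by
    rw [show (4.3:ℝ) = 43 / (2 * 5) by norm_num, Real.log_div (by norm_num) (by norm_num),
      Real.log_mul (by norm_num) (by norm_num)]
    linarith [dvl43.2, Real.log_two_gt_d9, Real.log_five_gt_d9]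
  have e2 : dvM r x = Real.exp (2 * ∑ p ∈ r, (dvEl p - Real.log 2) + Real.log x + Real.log Y) := by
    rw [Real.exp_add, Real.exp_add, Real.exp_log hx0, Real.exp_log hY0, two_mul, Real.exp_add, ← e1, dvM, ← hS, ← hY]
    ring
  have e3 : dvc r * Real.exp A = Real.exp (Real.log 2 + ∑ p ∈ r, dvEl p + A) := by
    rw [Real.exp_add, Real.exp_add, Real.exp_log (by norm_num), dvc_exp r hr]
  rw [e2, e3]
  refine Real.exp_le_exp.2 ?_
  have hn' := hn
  simp only [dvB] at hn'
  rw [Finset.sum_sub_distrib, Finset.sum_add_distrib, Finset.sum_add_distrib, ← Finset.mul_sum, ← Finset.mul_sum,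
    ← hS, Finset.sum_const] at hn'
  rw [Finset.sum_sub_distrib, Finset.sum_const]
  simp only [nsmul_eq_mul] at hn' ⊢
  have := Real.log_two_gt_d9
  have hYe : Y / 4.3 = (Real.log x + dvK + 2 * SS) / 4.3 := by rw [hY]
  norm_num at hn' hlY hYe hl43 ⊢
  linarith

lemma dvT_anti (r Q : Finset ℕ) (h : r ⊆ Q) (x : ℝ) : dvT Q x ≤ dvT r x := by
  unfold dvT
  refine Finset.sum_le_sum fun n _ => ?_
  split_ifs with h1 h2 h2
  · exact le_rfl
  · exact absurd (fun p hp => h1 p (h hp)) h2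
  · positivity
  · exact le_rfl

lemma dvT_nonneg (Q : Finset ℕ) (x : ℝ) : 0 ≤ dvT Q x := by
  unfold dvT
  refine Finset.sum_nonneg fun n _ => ?_
  split_ifs <;> positivity

lemma dvM_nonneg (Q : Finset ℕ) (hQ : ∀ p ∈ Q, p.Prime) {x : ℝ} (hx : 1 ≤ x) : 0 ≤ dvM Q x := by
  have hk := dvK_bds
  have := Real.log_nonneg hx
  have hS0 : 0 ≤ ∑ p ∈ Q, Real.log p / ((p:ℝ) - 1) := by
    refine Finset.sum_nonneg fun p hp => ?_
    have : (2:ℝ) ≤ p := by exact_mod_cast (hQ p hp).two_le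
    exact div_nonneg (Real.log_nonneg (by linarith)) (by linarith)
  unfold dvM
  exact mul_nonneg (sq_nonneg _) (mul_nonneg (by linarith) (by linarith))

lemma dvP_subset (r Q : Finset ℕ) (h : r ⊆ Q) (θ : ℝ) : dvP r θ ≤ dvP Q θ := by
  rw [dvP_exp, dvP_exp]
  refine Real.exp_le_exp.2 (Finset.sum_le_sum_of_subset_of_nonneg h fun p _ _ => ?_)
  have : 0 ≤ (p:ℝ) ^ (-θ) := by positivity
  have := Real.log_nonneg (show 1 ≤ 1 + (p:ℝ) ^ (-θ) by linarith)
  rw [dvUp]; linarith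

lemma dv_main23 {b : ℕ} {θ C x : ℝ} (Q : Finset ℕ) (hQ : ∀ r ∈ Q, r.Prime) (hb : b ∈ Q) (hB : dvBase b (9 / 10))
    (hθ : 7 / 12 ≤ θ) (hC : 1 - dvK ≤ C) (hC2 : dvD ≤ C * 2 ^ θ) (hx : 3 ≤ x)
    (hDb : dvDp (9 / 10) b ≤ Real.log 3)
    (n1 : ∑ p ∈ Q, dvB p ≤ 0.198)
    (n2 : ∀ r ⊆ Q, b ∈ r → ∀ p0 ∈ Q, p0 ∉ r → ∑ p ∈ r, dvB p + dvCc p0 ≤ 0.198) :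
    |dvE Q x| ≤ C * (dvP Q θ * x ^ θ) + dvc Q := by
  classical
  have hx0 : 0 < x := by linarith
  have hcp : 0 ≤ dvc Q := by rw [dvc_exp Q hQ]; positivity
  have hk := dvK_bds
  have hbQ : ({b} : Finset ℕ) ⊆ Q := by simpa using hb
  rcases le_total θ (9 / 10) with h | h
  · have := dvE_sub C θ {b} Q hbQ hQ (hB θ C hθ h hC hC2) x hx0
    linarith
  have h2 : dvD ≤ (1 - dvK) * 2 ^ ((9:ℝ) / 10) := by
    have h3 := dvD_bds
    have h4 : (1.62:ℝ) ≤ 2 ^ ((9:ℝ) / 10) := by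
      exact_mod_cast dv_rpos (r := 1.62) (z := 2) (n := 9) (d := 10) (by norm_num) (by norm_num) (by norm_num) (by norm_num)
    nlinarith
  have key : ∀ r ⊆ Q, b ∈ r → ∑ p ∈ r, dvDp (9 / 10) p ≤ Real.log x → |dvE r x| ≤ C * (dvP Q θ * x ^ θ) := by
    intro r hr hbr hD
    have hr' : ∀ p ∈ r, p.Prime := fun p hp => hQ p (hr hp)
    have h3 := dvE_sub (1 - dvK) (9 / 10) {b} r (by simpa using hbr) hr' (hB (9 / 10) _ (by norm_num) le_rfl le_rfl h2) x hx0
    have h4 := mul_le_mul_of_nonneg_left (dv_mono r hr' hx0 h hD) (show 0 ≤ 1 - dvK by linarith)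
    have h5 := mul_le_mul_of_nonneg_right hC (mul_pos (dvP_pos r θ) (Real.rpow_pos_of_pos hx0 θ)).le
    have h6 := mul_le_mul_of_nonneg_left (mul_le_mul_of_nonneg_right (dvP_subset r Q hr θ) (Real.rpow_pos_of_pos hx0 θ).le)
      (show 0 ≤ C by linarith)
    linarith
  obtain ⟨r, hr, hmax⟩ := Finset.exists_max_image
    (Q.powerset.filter fun r => b ∈ r ∧ ∑ p ∈ r, dvDp (9 / 10) p ≤ Real.log x) Finset.card ⟨{b}, by
      simp only [Finset.mem_filter, Finset.mem_powerset, Finset.mem_singleton, Finset.sum_singleton, true_and]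
      exact ⟨hbQ, hDb.trans (Real.log_le_log (by norm_num) hx)⟩⟩
  simp only [Finset.mem_filter, Finset.mem_powerset] at hr hmax
  obtain ⟨hrQ, hbr, hDr⟩ := hr
  have hEr := key r hrQ hbr hDr
  by_cases hrq : r = Q
  · rw [hrq] at hEr; linarith
  obtain ⟨p0, hp0, hp0r⟩ := Finset.exists_of_ssubset (hrQ.ssubset_of_ne hrq)
  have hins : insert p0 r ⊆ Q := Finset.insert_subset hp0 hrQ
  have hgt : Real.log x < ∑ p ∈ insert p0 r, dvDp (9 / 10) p := by
    by_contra hcon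
    push Not at hcon
    have := hmax (insert p0 r) ⟨hins, Finset.mem_insert_of_mem hbr, hcon⟩
    rw [Finset.card_insert_of_notMem hp0r] at this
    omega
  have hMQ : dvM Q x ≤ dvc Q := by
    have hle : ∑ p ∈ insert p0 r, dvDp (9 / 10) p ≤ ∑ p ∈ Q, dvDp (9 / 10) p :=
      Finset.sum_le_sum_of_subset_of_nonneg hins fun p hp _ => dv_Dp_nonneg _ (hQ p hp).two_le
    have := dv_MC Q hQ (W := 0) (A := 0) hx (by linarith) (by linarith)
    simpa using this
  have hMr : dvM r x ≤ dvc Q := by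
    rw [Finset.sum_insert hp0r] at hgt
    have hr' : ∀ p ∈ r, p.Prime := fun p hp => hQ p (hrQ hp)
    have hnn := n2 r hrQ hbr p0 hp0 hp0r
    rw [dvCc] at hnn
    refine (dv_MC r hr' (W := dvDp (9 / 10) p0) (A := dvEl p0) hx (by linarith) (by linarith)).trans ?_
    rw [dvc_exp r hr', dvc_exp Q hQ, mul_assoc, ← Real.exp_add]
    have hle : ∑ p ∈ insert p0 r, dvEl p ≤ ∑ p ∈ Q, dvEl p :=
      Finset.sum_le_sum_of_subset_of_nonneg hins fun p hp _ => dv_El_nonneg (hQ p hp).two_le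
    rw [Finset.sum_insert hp0r] at hle
    have := Real.exp_le_exp.2 (show ∑ p ∈ r, dvEl p + dvEl p0 ≤ ∑ p ∈ Q, dvEl p by linarith)
    linarith
  have t1 := dvT_anti r Q hrQ x
  have t2 := dvT_nonneg Q x
  have t3 := dvM_nonneg Q hQ (show 1 ≤ x by linarith)
  have t4 : dvT r x = dvM r x + dvE r x := by rw [dvE]; ring
  have t5 := le_abs_self (dvE r x)
  have t6 : 0 ≤ C * (dvP Q θ * x ^ θ) := (abs_nonneg _).trans hEr
  rw [abs_le]
  constructor
  · rw [dvE]; linarith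
  · rw [dvE]; linarith

lemma dvD9_tail {p : ℕ} (hp : 17 ≤ p) : dvDp (9 / 10) p ≤ 0.4428 ∧ Real.log p / ((p:ℝ) - 1) ≤ 0.1771 := by
  have hp1 : (17:ℝ) ≤ p := by exact_mod_cast hp
  obtain ⟨h17, h17b⟩ := dvl17
  have hlp := Real.log_nonneg (show (1:ℝ) ≤ p by linarith)
  have hR := dv_rpos (r := 12.8) (z := 17) (n := 9) (d := 10) (by norm_num) (by norm_num) (by norm_num) (by norm_num)
  norm_num at hR
  have he : Real.exp 1 ≤ 17 := by linarith [Real.exp_one_lt_d9]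
  have he2 : Real.exp (9 / 10)⁻¹ ≤ 17 := by
    rw [← Real.le_log_iff_exp_le (by norm_num)]; norm_num; linarith
  constructor
  · have h1 := Real.log_div_self_rpow_antitoneOn (a := 9 / 10) (by norm_num) (show (17:ℝ) ∈ _ from he2) (show (p:ℝ) ∈ _ from he2.trans hp1) hp1
    simp only at h1
    have h2 : Real.log 17 / 17 ^ ((9:ℝ) / 10) ≤ 0.2214 := by
      rw [div_le_iff₀ (by positivity)]; linarith
    have h3 : dvDp (9 / 10) p ≤ 2 * (Real.log p / (p:ℝ) ^ ((9:ℝ) / 10)) := by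
      rw [dvDp, ← mul_div_assoc]
      exact div_le_div_of_nonneg_left (by positivity) (by positivity) (by linarith)
    linarith
  · have h1 := Real.log_div_self_antitoneOn (show (17:ℝ) ∈ _ from he) (show (p:ℝ) ∈ _ from he.trans hp1) hp1
    simp only at h1
    have h2 : Real.log p / ((p:ℝ) - 1) ≤ 17 / 16 * (Real.log p / p) := by
      rw [← mul_div_assoc, div_le_div_iff₀ (by linarith) (by linarith)]
      nlinarith
    have h3 : Real.log 17 / 17 ≤ 0.16666 := by linarith
    linarith

lemma dvB_tail {p : ℕ} (hp : 17 ≤ p) : dvB p ≤ 0 := by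
  obtain ⟨h1, h2⟩ := dvD9_tail hp
  have hp1 : (17:ℝ) ≤ p := by exact_mod_cast hp
  have h3 := dv_El_ub (show 2 ≤ p by omega)
  have h4 : 0 < 1 / (p:ℝ) := by positivity
  rw [dvB]
  linarith [Real.log_two_gt_d9]

lemma dvC_tail {p : ℕ} (hp : 17 ≤ p) : dvCc p ≤ 0 := by
  obtain ⟨h1, h2⟩ := dvD9_tail hp
  have h3 := (dv_El_lb (p := 17) (by norm_num)).trans (dv_El_mono (by norm_num) hp)
  norm_num at h3
  rw [dvCc]
  linarith

lemma dvD9_2 : dvDp (9 / 10) 2 ≤ 2 * 0.6931471808 / (1.8660 + 1) := by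
  have h : Real.log (2:ℝ) ≤ 0.6931471808 := Real.log_two_lt_d9.le.trans (by norm_num)
  have := dv_Dp_ub (p := 2) (n := 9) (d := 10) (R := 1.8660) (h := 0.6931471808) (by norm_num) (by norm_num) (by norm_num) (by norm_num) (by exact_mod_cast h)
  exact_mod_cast this

lemma dvB_2 : dvB 2 ≤ -0.467 := by
  have hD := dvD9_2
  have hE : dvEl 2 = 0 := by rw [dvEl]; norm_num
  have a2 := Real.log_two_gt_d9
  have a3 := Real.log_two_lt_d9
  have a4 := Real.log_three_gt_d9
  have a5 := Real.log_three_lt_d9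
  have a6 := Real.log_five_gt_d9
  have a7 := Real.log_five_lt_d9
  have a8 := dvl7
  rw [dvB]
  norm_num at *
  linarith

lemma dvD9_3 : dvDp (9 / 10) 3 ≤ 2 * 1.0986122888 / (2.6878 + 1) := by
  have h : Real.log (3:ℝ) ≤ 1.0986122888 := Real.log_three_lt_d9.le.trans (by norm_num)
  have := dv_Dp_ub (p := 3) (n := 9) (d := 10) (R := 2.6878) (h := 1.0986122888) (by norm_num) (by norm_num) (by norm_num) (by norm_num) (by exact_mod_cast h)
  exact_mod_cast this

lemma dvB_3 : dvB 3 ≤ -0.108 := by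
  have hD := dvD9_3
  have hE : dvEl 3 = 2 * Real.log 2 - Real.log 3 := by
    rw [dvEl, show (2 - 2 / ((3:ℕ):ℝ)) = 2 ^ 2 / 3 by norm_num, Real.log_div (by norm_num) (by norm_num), Real.log_pow]
    norm_num
  have a2 := Real.log_two_gt_d9
  have a3 := Real.log_two_lt_d9
  have a4 := Real.log_three_gt_d9
  have a5 := Real.log_three_lt_d9
  have a6 := Real.log_five_gt_d9
  have a7 := Real.log_five_lt_d9
  have a8 := dvl7
  rw [dvB]
  norm_num at *
  linarith

lemma dvC_3 : dvCc 3 ≤ 0.4475 := by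
  have hD := dvD9_3
  have hE : dvEl 3 = 2 * Real.log 2 - Real.log 3 := by
    rw [dvEl, show (2 - 2 / ((3:ℕ):ℝ)) = 2 ^ 2 / 3 by norm_num, Real.log_div (by norm_num) (by norm_num), Real.log_pow]
    norm_num
  have a2 := Real.log_two_gt_d9
  have a3 := Real.log_two_lt_d9
  have a4 := Real.log_three_gt_d9
  have a5 := Real.log_three_lt_d9
  have a6 := Real.log_five_gt_d9
  have a7 := Real.log_five_lt_d9
  have a8 := dvl7
  rw [dvCc]
  norm_num at *
  linarith

lemma dvD9_5 : dvDp (9 / 10) 5 ≤ 2 * 1.609437913 / (4.2566 + 1) := by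
  have h : Real.log (5:ℝ) ≤ 1.609437913 := Real.log_five_lt_d9.le.trans (by norm_num)
  have := dv_Dp_ub (p := 5) (n := 9) (d := 10) (R := 4.2566) (h := 1.609437913) (by norm_num) (by norm_num) (by norm_num) (by norm_num) (by exact_mod_cast h)
  exact_mod_cast this

lemma dvB_5 : dvB 5 ≤ 0.026 := by
  have hD := dvD9_5
  have hE : dvEl 5 = 3 * Real.log 2 - Real.log 5 := by
    rw [dvEl, show (2 - 2 / ((5:ℕ):ℝ)) = 2 ^ 3 / 5 by norm_num, Real.log_div (by norm_num) (by norm_num), Real.log_pow]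
    norm_num
  have a2 := Real.log_two_gt_d9
  have a3 := Real.log_two_lt_d9
  have a4 := Real.log_three_gt_d9
  have a5 := Real.log_three_lt_d9
  have a6 := Real.log_five_gt_d9
  have a7 := Real.log_five_lt_d9
  have a8 := dvl7
  rw [dvB]
  norm_num at *
  linarith

lemma dvC_5 : dvCc 5 ≤ 0.2855 := by
  have hD := dvD9_5
  have hE : dvEl 5 = 3 * Real.log 2 - Real.log 5 := by
    rw [dvEl, show (2 - 2 / ((5:ℕ):ℝ)) = 2 ^ 3 / 5 by norm_num, Real.log_div (by norm_num) (by norm_num), Real.log_pow]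
    norm_num
  have a2 := Real.log_two_gt_d9
  have a3 := Real.log_two_lt_d9
  have a4 := Real.log_three_gt_d9
  have a5 := Real.log_three_lt_d9
  have a6 := Real.log_five_gt_d9
  have a7 := Real.log_five_lt_d9
  have a8 := dvl7
  rw [dvCc]
  norm_num at *
  linarith

lemma dvD9_7 : dvDp (9 / 10) 7 ≤ 2 * 1.945912 / (5.7621 + 1) := by
  have h : Real.log (7:ℝ) ≤ 1.945912 := dvl7.2.le
  have := dv_Dp_ub (p := 7) (n := 9) (d := 10) (R := 5.7621) (h := 1.945912) (by norm_num) (by norm_num) (by norm_num) (by norm_num) (by exact_mod_cast h)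
  exact_mod_cast this

lemma dvB_7 : dvB 7 ≤ 0.0135 := by
  have hD := dvD9_7
  have hE : dvEl 7 = 2 * Real.log 2 + Real.log 3 - Real.log 7 := by
    rw [dvEl, show (2 - 2 / ((7:ℕ):ℝ)) = 2 ^ 2 * 3 / 7 by norm_num, Real.log_div (by norm_num) (by norm_num),
      Real.log_mul (by norm_num) (by norm_num), Real.log_pow]
    norm_num
  have a2 := Real.log_two_gt_d9
  have a3 := Real.log_two_lt_d9
  have a4 := Real.log_three_gt_d9
  have a5 := Real.log_three_lt_d9
  have a6 := Real.log_five_gt_d9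
  have a7 := Real.log_five_lt_d9
  have a8 := dvl7
  rw [dvB]
  norm_num at *
  linarith

lemma dvC_7 : dvCc 7 ≤ 0.1712 := by
  have hD := dvD9_7
  have hE : dvEl 7 = 2 * Real.log 2 + Real.log 3 - Real.log 7 := by
    rw [dvEl, show (2 - 2 / ((7:ℕ):ℝ)) = 2 ^ 2 * 3 / 7 by norm_num, Real.log_div (by norm_num) (by norm_num),
      Real.log_mul (by norm_num) (by norm_num), Real.log_pow]
    norm_num
  have a2 := Real.log_two_gt_d9
  have a3 := Real.log_two_lt_d9
  have a4 := Real.log_three_gt_d9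
  have a5 := Real.log_three_lt_d9
  have a6 := Real.log_five_gt_d9
  have a7 := Real.log_five_lt_d9
  have a8 := dvl7
  rw [dvCc]
  norm_num at *
  linarith

lemma dvD9_11 : dvDp (9 / 10) 11 ≤ 2 * 2.397897 / (8.6547 + 1) := by
  have h : Real.log (11:ℝ) ≤ 2.397897 := dvl11.2.le
  have := dv_Dp_ub (p := 11) (n := 9) (d := 10) (R := 8.6547) (h := 2.397897) (by norm_num) (by norm_num) (by norm_num) (by norm_num) (by exact_mod_cast h)
  exact_mod_cast this

lemma dvB_11 : dvB 11 ≤ 0 := by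
  have hD := dvD9_11
  have hE := dv_El_ub (p := 11) (by norm_num)
  have a2 := Real.log_two_gt_d9
  have a3 := Real.log_two_lt_d9
  have a4 := Real.log_three_gt_d9
  have a5 := Real.log_three_lt_d9
  have a6 := Real.log_five_gt_d9
  have a7 := Real.log_five_lt_d9
  have a8 := dvl7
  have l11 := dvl11
  rw [dvB]
  norm_num at *
  linarith

lemma dvC_11 : dvCc 11 ≤ 0.02 := by
  have hD := dvD9_11
  have hE := dv_El_lb (p := 11) (by norm_num)
  have a2 := Real.log_two_gt_d9
  have a3 := Real.log_two_lt_d9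
  have a4 := Real.log_three_gt_d9
  have a5 := Real.log_three_lt_d9
  have a6 := Real.log_five_gt_d9
  have a7 := Real.log_five_lt_d9
  have a8 := dvl7
  have l11 := dvl11
  rw [dvCc]
  norm_num at *
  linarith

lemma dvD9_13 : dvDp (9 / 10) 13 ≤ 2 * 2.564953 / (10.0588 + 1) := by
  have h : Real.log (13:ℝ) ≤ 2.564953 := dvl13.2.le
  have := dv_Dp_ub (p := 13) (n := 9) (d := 10) (R := 10.0588) (h := 2.564953) (by norm_num) (by norm_num) (by norm_num) (by norm_num) (by exact_mod_cast h)
  exact_mod_cast this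

lemma dvB_13 : dvB 13 ≤ 0 := by
  have hD := dvD9_13
  have hE := dv_El_ub (p := 13) (by norm_num)
  have a2 := Real.log_two_gt_d9
  have a3 := Real.log_two_lt_d9
  have a4 := Real.log_three_gt_d9
  have a5 := Real.log_three_lt_d9
  have a6 := Real.log_five_gt_d9
  have a7 := Real.log_five_lt_d9
  have a8 := dvl7
  have l13 := dvl13
  rw [dvB]
  norm_num at *
  linarith

lemma dvC_13 : dvCc 13 ≤ 0 := by
  have hD := dvD9_13
  have hE := dv_El_lb (p := 13) (by norm_num)
  have a2 := Real.log_two_gt_d9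
  have a3 := Real.log_two_lt_d9
  have a4 := Real.log_three_gt_d9
  have a5 := Real.log_three_lt_d9
  have a6 := Real.log_five_gt_d9
  have a7 := Real.log_five_lt_d9
  have a8 := dvl7
  have l13 := dvl13
  rw [dvCc]
  norm_num at *
  linarith

lemma dvB_np {p : ℕ} (hp : p.Prime) (h5 : p ≠ 5) (h7 : p ≠ 7) : dvB p ≤ 0 := by
  rcases lt_or_ge p 17 with h | h
  · have := hp.two_le
    interval_cases p
    · linarith [dvB_2]
    · linarith [dvB_3]
    all_goals first | exact absurd rfl h5 | exact absurd rfl h7 | exact dvB_11 | exact dvB_13 | (exfalso; revert hp; norm_num)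
  · exact dvB_tail h

lemma dvC_ub {p : ℕ} (hp : p.Prime) (h2 : p ≠ 2) (h5 : p ≠ 5) : dvCc p ≤ 0.4475 ∧ (p ≠ 3 → dvCc p ≤ 0.1712) := by
  rcases lt_or_ge p 17 with h | h
  · have := hp.two_le
    interval_cases p
    · exact absurd rfl h2
    · exact ⟨dvC_3, fun h => absurd rfl h⟩
    all_goals first | exact absurd rfl h5 | (exfalso; revert hp; norm_num; done) | skip
    · constructor <;> intros <;> linarith [dvC_7]
    · constructor <;> intros <;> linarith [dvC_11]
    · constructor <;> intros <;> linarith [dvC_13]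
  · have := dvC_tail h
    constructor <;> intros <;> linarith

lemma dvB_sum {b : ℕ} (r : Finset ℕ) (hr : ∀ p ∈ r, p.Prime) (hb : b ∈ r) :
    ∑ p ∈ r, dvB p ≤ dvB b + 0.0395 ∧ (5 ∉ r → ∑ p ∈ r, dvB p ≤ dvB b + 0.0135) := by
  rw [← Finset.add_sum_erase r dvB hb]
  have m5 := max_le dvB_5 (show (0:ℝ) ≤ _ by norm_num)
  have m7 := max_le dvB_7 (show (0:ℝ) ≤ _ by norm_num)
  constructor
  · have := dv_sum_S (r.erase b) {5, 7} dvB (fun p => max (dvB p) 0) (fun p _ => le_max_right _ _) (fun p _ _ => le_max_left _ _)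
      (fun p hp hS => dvB_np (hr p (Finset.mem_of_mem_erase hp)) (by rintro rfl; exact hS (by decide)) (by rintro rfl; exact hS (by decide)))
    rw [Finset.sum_insert (by decide), Finset.sum_singleton] at this
    linarith
  · intro h5
    have := dv_sum_S (r.erase b) {7} dvB (fun p => max (dvB p) 0) (fun p _ => le_max_right _ _) (fun p _ _ => le_max_left _ _)
      (fun p hp hS => dvB_np (hr p (Finset.mem_of_mem_erase hp)) (by rintro rfl; exact h5 (Finset.mem_of_mem_erase hp)) (by rintro rfl; exact hS (by decide)))
    rw [Finset.sum_singleton] at this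
    linarith

lemma dv_case2 {θ C x : ℝ} (Q : Finset ℕ) (hQ : ∀ r ∈ Q, r.Prime) (hp : 2 ∈ Q)
    (hθ : 7 / 12 ≤ θ) (hC : 1 - dvK ≤ C) (hC2 : dvD ≤ C * 2 ^ θ) (hx : 3 ≤ x) :
    |dvE Q x| ≤ C * (dvP Q θ * x ^ θ) + dvc Q := by
  have b2 := dvB_2
  refine dv_main23 Q hQ hp dvBase2 hθ hC hC2 hx ?_ ?_ ?_
  · have := dvD9_2
    norm_num at this
    linarith [Real.log_three_gt_d9]
  · linarith [(dvB_sum Q hQ hp).1]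
  · intro r hr h2 p0 hp0 hp0r
    have h1 := (dvB_sum r (fun p hp => hQ p (hr hp)) h2).1
    have h3 : dvCc p0 ≤ 0.4475 := by
      by_cases h5 : p0 = 5
      · rw [h5]; linarith [dvC_5]
      · exact (dvC_ub (hQ p0 hp0) (by rintro rfl; exact hp0r h2) h5).1
    linarith

lemma dv_case3 {θ C x : ℝ} (Q : Finset ℕ) (hQ : ∀ r ∈ Q, r.Prime) (hp : 3 ∈ Q) (hn2 : 2 ∉ Q)
    (hθ : 7 / 12 ≤ θ) (hC : 1 - dvK ≤ C) (hC2 : dvD ≤ C * 2 ^ θ) (hx : 3 ≤ x) :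
    |dvE Q x| ≤ C * (dvP Q θ * x ^ θ) + dvc Q := by
  have b3 := dvB_3
  refine dv_main23 Q hQ hp dvBase3 hθ hC hC2 hx ?_ ?_ ?_
  · have := dvD9_3
    norm_num at this
    linarith [Real.log_three_gt_d9]
  · linarith [(dvB_sum Q hQ hp).1]
  · intro r hr h3 p0 hp0 hp0r
    have h1 := dvB_sum r (fun p hp => hQ p (hr hp)) h3
    by_cases h5 : p0 = 5
    · subst h5
      linarith [dvC_5, h1.2 hp0r]
    · have := (dvC_ub (hQ p0 hp0) (by rintro rfl; exact hn2 hp0) h5).2 (by rintro rfl; exact hp0r h3)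
      linarith [h1.1]


lemma dv_all {θ C x : ℝ} (Q : Finset ℕ) (hQ : ∀ r ∈ Q, r.Prime)
    (hC : 1 - dvK ≤ C) (hC2 : dvD ≤ C * 2 ^ θ) (h : ∀ y, 1 ≤ y → |dvE ∅ y| ≤ C * y ^ θ) (hx : 3 ≤ x) :
    |dvE Q x| ≤ C * (dvP Q θ * x ^ θ) + dvc Q := by
  rcases le_total θ (7 / 12) with hθ | hθ
  · have h1 := dvE_sub C θ ∅ Q (by simp) hQ (fun y hy => by
      simpa [dvP] using dv_direct hC hθ h y hy) x (by linarith)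
    have hcp : 0 ≤ dvc Q := by rw [dvc_exp Q hQ]; positivity
    linarith
  by_cases h2 : 2 ∈ Q
  · exact dv_case2 Q hQ h2 hθ hC hC2 hx
  by_cases h3 : 3 ∈ Q
  · exact dv_case3 Q hQ h3 h2 hθ hC hC2 hx
  have up : ∀ m m' : ℕ, (∀ r ∈ Q, m ≤ r) → m ∉ Q → (∀ k, m < k → k < m' → ¬ k.Prime) → ∀ r ∈ Q, m' ≤ r := by
    intro m m' hm hmQ hk r hr
    by_contra hlt
    rcases (hm r hr).eq_or_lt with he | hl
    · exact hmQ (he ▸ hr)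
    · exact hk r hl (by omega) (hQ r hr)
  have m3 := up 2 3 (fun r hr => (hQ r hr).two_le) h2 (by intro k h1 h2; omega)
  have m5 := up 3 5 m3 h3 (by intro k h1 h2; interval_cases k; norm_num)
  by_cases h5 : 5 ∈ Q
  · exact dv_case5 Q hQ h5 m5 hθ hC hC2 (by linarith)
  have m7 := up 5 7 m5 h5 (by intro k h1 h2; interval_cases k; norm_num)
  by_cases h7 : 7 ∈ Q
  · exact dv_case7 Q hQ h7 m7 hθ hC hC2 (by linarith)
  have m11 := up 7 11 m7 h7 (by intro k h1 h2; interval_cases k <;> norm_num)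
  by_cases h11 : 11 ∈ Q
  · exact dv_case11 dvBase11 Q hQ h11 m11 hθ hC hC2 (by linarith)
  have m13 := up 11 13 m11 h11 (by intro k h1 h2; interval_cases k <;> norm_num)
  by_cases h13 : 13 ∈ Q
  · exact dv_case11 dvBase13 Q hQ h13 m11 hθ hC hC2 (by linarith)
  have m17 := up 13 17 m13 h13 (by intro k h1 h2; interval_cases k <;> norm_num)
  by_cases h17 : 17 ∈ Q
  · exact dv_case11 dvBase17 Q hQ h17 m11 hθ hC hC2 (by linarith)
  have m19 := up 17 19 m17 h17 (by intro k h1 h2; interval_cases k <;> norm_num)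
  by_cases h19 : 19 ∈ Q
  · exact dv_case11 dvBase19 Q hQ h19 m11 hθ hC hC2 (by linarith)
  have m23 := up 19 23 m19 h19 (by intro k h1 h2; interval_cases k <;> norm_num)
  exact dv_case23 Q hQ m23 hθ hC2 (by linarith)

theorem stmt_9 (C θ : ℝ) (hC : 0 < C) (hθ : 1 / 4 < θ)
    (hΔ : ∀ x : ℝ, 1 ≤ x →
      |(∑ n ∈ Finset.Icc 1 ⌊x⌋₊, (n.divisors.card : ℝ)) -
        (x * Real.log x + (2 * Real.eulerMascheroniConstant - 1) * x)| ≤ C * x ^ θ)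
    (q : ℕ) (hq : 0 < q) (x : ℝ) (hx : 3 ≤ x) :
    |(∑ n ∈ (Finset.Icc 1 ⌊x⌋₊).filter (fun n => n.Coprime q), (n.divisors.card : ℝ)) -
      ((q.totient : ℝ) / q) ^ 2 * x * Real.log x -
      ((q.totient : ℝ) / q) ^ 2 * (2 * Real.eulerMascheroniConstant +
        2 * ∑ p ∈ q.primeFactors, Real.log p / ((p : ℝ) - 1) - 1) * x| ≤
      C * (∑ d ∈ q.divisors, (ArithmeticFunction.moebius d : ℝ) ^ 2 * (d : ℝ) ^ (-θ)) ^ 2 * x ^ θ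
        + (if q = 1 then 0 else (q.totient : ℝ) / q * 2 ^ (q.primeFactors.card + 1)) := by
  have h : ∀ y, 1 ≤ y → |dvE ∅ y| ≤ C * y ^ θ := by
    intro y hy
    rw [dvE_empty]
    convert hΔ y hy using 2
    rw [dvK]; ring
  have h1 := h 1 le_rfl
  have h2 := h 2 (by norm_num)
  have e2 : ∑ n ∈ Finset.Icc 1 2, (n.divisors.card : ℝ) = 3 := by
    have : ∑ n ∈ Finset.Icc 1 2, n.divisors.card = 3 := by decide
    exact_mod_cast this
  have hC1 : 1 - dvK ≤ C := by
    rw [dvE_empty] at h1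
    have := (le_abs_self _).trans h1
    simp at this
    linarith
  have hC2 : dvD ≤ C * 2 ^ θ := by
    rw [dvE_empty, show ⌊(2:ℝ)⌋₊ = 2 by norm_num, e2] at h2
    have := (le_abs_self _).trans h2
    rw [dvD]; linarith
  refine dv_bridge C θ q hq x ?_
  by_cases hq1 : q = 1
  · subst hq1
    simpa [dvP] using h x (by linarith)
  · rw [if_neg hq1]
    exact dv_all _ (fun r hr => Nat.prime_of_mem_primeFactors hr) hC1 hC2 h hx
end

section
/- Assume the divisor-problem bound |∑_{n ≤ x} τ(n) − x log x − (2γ − 1)x| ≤ 0.397 x^{1/2} for all x ≥ 5560. If q is 1 or a prime number and x > max{exp(q⁸), 355991}, then ∑_{n ≤ x, (n,q)=1} τ(n)² ≤ 0.24 (φ(q)/q)⁴ x log³ x. -/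
lemma aux_pow (u v : ℝ) (hu : 0 ≤ u) (huv : u ≤ v) (k : ℕ) :
    (v - u) * u ^ k ≤ (v ^ (k+1) - u ^ (k+1)) / (k+1) := by
  have hk : (0:ℝ) < k + 1 := by positivity
  rw [le_div_iff₀ hk]
  induction k with
  | zero => simp
  | succ k ih =>
    have ih := ih (by positivity)
    have h1 : u * ((v - u) * u ^ k * (k + 1)) ≤ v * (v ^ (k+1) - u ^ (k+1)) := by
      have h2 : 0 ≤ v ^ (k+1) - u ^ (k+1) := sub_nonneg.2 (pow_le_pow_left₀ hu huv _)
      calc _ ≤ u * (v ^ (k+1) - u ^ (k+1)) := mul_le_mul_of_nonneg_left ih hu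
        _ ≤ _ := mul_le_mul_of_nonneg_right huv h2
    push_cast
    have e1 : (v - u) * u ^ (k+1) * ((k:ℝ)+1+1) = u * ((v - u) * u ^ k * (k + 1)) + (v-u) * u^(k+1) := by ring
    have e2 : v ^ (k+1+1) - u ^ (k+1+1) = v * (v ^ (k+1) - u ^ (k+1)) + (v-u) * u^(k+1) := by ring
    linarith

noncomputable def Hs (f : ℕ → ℝ) (n : ℕ) : ℝ := ∑ a ∈ Finset.Ioc 0 n, f a / a

lemma sum_Ioc_succ' (f : ℕ → ℝ) (n : ℕ) :
    ∑ a ∈ Finset.Ioc 0 (n+1), f a = ∑ a ∈ Finset.Ioc 0 n, f a + f (n+1) :=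
  Finset.sum_Ioc_succ_top (Nat.zero_le n) f

lemma abel_log (f : ℕ → ℝ) (α κ : ℝ) (hα : 0 ≤ α)
    (hH : ∀ n : ℕ, 1 ≤ n → Hs f n ≤ α * Real.log n + κ) (N : ℕ) (k : ℕ) (hN : 1 ≤ N) :
    ∑ a ∈ Finset.Ioc 0 N, f a / a * Real.log (N / a) ^ k ≤
      α * Real.log N ^ (k+1) / (k+1) + κ * Real.log N ^ k := by
  have hN0 : (0:ℝ) < N := by exact_mod_cast hN
  have key : ∀ n : ℕ, 1 ≤ n → n ≤ N →
      ∑ a ∈ Finset.Ioc 0 n, f a / a * Real.log (N / a) ^ k ≤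
      α * (Real.log N ^ (k+1) / (k+1) - Real.log (N / n) ^ (k+1) / (k+1)) + κ * Real.log N ^ k
        + (Hs f n - (α * Real.log n + κ)) * Real.log (N / n) ^ k := by
    intro n hn
    induction n, hn using Nat.le_induction with
    | base => intro _; simp [Hs]; linarith
    | succ n hn ih =>
      intro hnN
      have ih := ih (by omega)
      have hn0 : (0:ℝ) < n := by exact_mod_cast hn
      have hnN' : ((n:ℝ) + 1) ≤ N := by exact_mod_cast hnN
      have hW := hH n hn
      rw [sum_Ioc_succ']
      have hs : Hs f (n+1) = Hs f n + f (n+1) / ((n+1 : ℕ) : ℝ) := sum_Ioc_succ' _ n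
      rw [hs]
      have hu : 0 ≤ Real.log (N / ((n+1 : ℕ):ℝ)) := by
        apply Real.log_nonneg
        rw [le_div_iff₀ (by positivity)]; push_cast; linarith
      have huv : Real.log (N / ((n+1 : ℕ):ℝ)) ≤ Real.log (N / n) := by
        apply Real.log_le_log (by positivity)
        apply div_le_div_of_nonneg_left hN0.le hn0
        push_cast; linarith
      have e : Real.log (N/n) - Real.log (N / ((n+1 : ℕ):ℝ)) = Real.log ((n+1 : ℕ):ℝ) - Real.log n := by
        rw [Real.log_div hN0.ne' hn0.ne', Real.log_div hN0.ne' (by positivity)]; ring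
      have h1 := mul_le_mul_of_nonneg_left (aux_pow _ _ hu huv k) hα
      rw [e] at h1
      have h2 : (Hs f n - (α * Real.log n + κ)) * Real.log (N / n) ^ k ≤
          (Hs f n - (α * Real.log n + κ)) * Real.log (N / ((n+1 : ℕ):ℝ)) ^ k :=
        mul_le_mul_of_nonpos_left (pow_le_pow_left₀ hu huv k) (by linarith)
      rw [sub_div] at h1
      linarith
  have h := key N hN le_rfl
  rw [div_self hN0.ne'] at h
  have h3 := hH N hN
  have h4 : (Hs f N - (α * Real.log N + κ)) * Real.log 1 ^ k ≤ 0 :=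
    mul_nonpos_of_nonpos_of_nonneg (by linarith) (by simp)
  have h5 : α * (Real.log N ^ (k+1) / (k+1) - Real.log 1 ^ (k+1) / (k+1)) = α * Real.log N ^ (k+1) / (k+1) := by
    simp; ring
  linarith

lemma conv_step (f g : ArithmeticFunction ℝ) (α κ P0 P1 P2 C : ℝ) (hα : 0 ≤ α) (hf : ∀ n, 0 ≤ f n)
    (hH : ∀ n : ℕ, 1 ≤ n → Hs f n ≤ α * Real.log n + κ)
    (hf1 : ∀ n : ℕ, ∑ a ∈ Finset.Ioc 0 n, f a ≤ n)
    (h0 : 0 ≤ P0) (h1 : 0 ≤ P1) (h2 : 0 ≤ P2) (hC : 0 ≤ C)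
    (hg : ∀ m : ℕ, 1 ≤ m → ∑ a ∈ Finset.Ioc 0 m, g a ≤
      m * (P2 * Real.log m ^ 2 + P1 * Real.log m + P0) + C)
    (N : ℕ) (hN : 1 ≤ N) :
    ∑ a ∈ Finset.Ioc 0 N, (f * g) a ≤ N * (P2 * (α * Real.log N ^ 3 / 3 + κ * Real.log N ^ 2)
      + P1 * (α * Real.log N ^ 2 / 2 + κ * Real.log N) + P0 * (α * Real.log N + κ) + C) := by
  rw [ArithmeticFunction.sum_Ioc_mul_eq_sum_sum]
  have hN0 : (0:ℝ) < N := by exact_mod_cast hN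
  have a0 := abel_log f α κ hα hH N 0 hN
  have a1 := abel_log f α κ hα hH N 1 hN
  have a2 := abel_log f α κ hα hH N 2 hN
  calc _ ≤ ∑ a ∈ Finset.Ioc 0 N, (N * (P2 * (f a / a * Real.log (N / a) ^ 2) +
            P1 * (f a / a * Real.log (N / a) ^ 1) + P0 * (f a / a * Real.log (N / a) ^ 0)) + C * f a) := by
        apply Finset.sum_le_sum
        intro a ha
        rw [Finset.mem_Ioc] at ha
        have ha0 : (0:ℝ) < a := by exact_mod_cast ha.1
        have hm : 1 ≤ N / a := (Nat.one_le_div_iff ha.1).2 ha.2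
        have hm0 : (1:ℝ) ≤ (N / a : ℕ) := by exact_mod_cast hm
        have hle : ((N / a : ℕ) : ℝ) ≤ N / a := Nat.cast_div_le
        have hl0 : 0 ≤ Real.log (N / a : ℕ) := Real.log_nonneg hm0
        have hl : Real.log (N / a : ℕ) ≤ Real.log (N / a) := Real.log_le_log (by linarith) hle
        have h3 : ∑ a ∈ Finset.Ioc 0 (N/a), g a ≤
            (N/a:ℝ) * (P2 * Real.log (N/a) ^ 2 + P1 * Real.log (N/a) + P0) + C := by
          refine (hg _ hm).trans ?_
          gcongr
        calc _ ≤ f a * ((N/a:ℝ) * (P2 * Real.log (N/a) ^ 2 + P1 * Real.log (N/a) + P0) + C) :=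
              mul_le_mul_of_nonneg_left h3 (hf a)
          _ = _ := by ring
    _ = N * (P2 * ∑ a ∈ Finset.Ioc 0 N, (f a / a * Real.log (N / a) ^ 2) +
            P1 * ∑ a ∈ Finset.Ioc 0 N, (f a / a * Real.log (N / a) ^ 1) +
            P0 * ∑ a ∈ Finset.Ioc 0 N, (f a / a * Real.log (N / a) ^ 0)) + C * ∑ a ∈ Finset.Ioc 0 N, f a := by
        simp only [Finset.sum_add_distrib, ← Finset.mul_sum]
    _ ≤ N * (P2 * (α * Real.log N ^ (2+1) / ((2:ℕ)+1) + κ * Real.log N ^ 2) +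
            P1 * (α * Real.log N ^ (1+1) / ((1:ℕ)+1) + κ * Real.log N ^ 1) +
            P0 * (α * Real.log N ^ (0+1) / ((0:ℕ)+1) + κ * Real.log N ^ 0)) + C * N := by
        have := hf1 N
        gcongr
    _ = _ := by
        push_cast; norm_num; ring

open Classical in
noncomputable def ind (P : ℕ → Prop) : ArithmeticFunction ℝ :=
  ⟨fun n => if n = 0 then 0 else if P n then 1 else 0, by simp⟩

open Classical in
lemma ind_apply (P : ℕ → Prop) (n : ℕ) : ind P n = if n = 0 then 0 else if P n then 1 else 0 := rfl

lemma ind_nonneg (P : ℕ → Prop) (n : ℕ) : 0 ≤ ind P n := by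
  rw [ind_apply]; split_ifs <;> norm_num

lemma ind_le_one (P : ℕ → Prop) (n : ℕ) : ind P n ≤ 1 := by
  rw [ind_apply]; split_ifs <;> norm_num

lemma ind_sum_le (P : ℕ → Prop) (n : ℕ) : ∑ a ∈ Finset.Ioc 0 n, ind P a ≤ n := by
  calc _ ≤ ∑ a ∈ Finset.Ioc 0 n, (1:ℝ) := Finset.sum_le_sum fun a _ => ind_le_one P a
    _ = n := by simp

noncomputable def HH (n : ℕ) : ℝ := ∑ a ∈ Finset.Ioc 0 n, 1 / (a:ℝ)

lemma HH_succ (n : ℕ) : HH (n+1) = HH n + 1 / ((n+1 : ℕ):ℝ) := sum_Ioc_succ' _ n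

lemma HH_ge (n : ℕ) : Real.log (n+1) ≤ HH n := by
  have := log_add_one_le_harmonic n
  rw [harmonic_eq_sum_Icc] at this
  push_cast at this
  have e : Finset.Ioc 0 n = Finset.Icc 1 n := by ext; simp; omega
  simpa [HH, one_div, e] using this

lemma HH_le (n : ℕ) (hn : 1 ≤ n) : HH n ≤ Real.log n + 2/3 + 1/(3*n) := by
  induction n, hn using Nat.le_induction with
  | base => norm_num [HH]
  | succ n hn ih =>
    rw [HH_succ]
    have hn0 : (1:ℝ) ≤ n := by exact_mod_cast hn
    have h : 2 / (2 * (n:ℝ) + 1) ≤ Real.log (1 + 1 / n) := by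
      refine le_trans (le_of_eq ?_) (Real.le_log_one_add_of_nonneg (x := 1/(n:ℝ)) (by positivity))
      field_simp; ring
    have e : Real.log ((n+1:ℕ):ℝ) = Real.log n + Real.log (1 + 1/n) := by
      rw [← Real.log_mul (by positivity) (by positivity)]
      congr 1; push_cast; field_simp
    rw [e]
    have h' : 1 / ((n+1 : ℕ):ℝ) + 1/(3*n) - 1 / (3 * ((n+1 : ℕ):ℝ)) ≤ 2 / (2 * (n:ℝ) + 1) := by
      push_cast
      rw [← sub_nonneg]
      have : 2 / (2 * (n:ℝ) + 1) - (1 / ((n:ℝ)+1) + 1/(3*n) - 1 / (3 * ((n:ℝ)+1))) =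
        (n - 1) / (3 * n * (n+1) * (2*n+1)) := by field_simp; ring
      rw [this]
      apply div_nonneg (by linarith) (by positivity)
    linarith

lemma Hs_ind_dvd (d : ℕ) (hd : 1 ≤ d) (n : ℕ) :
    Hs (ind fun a => ¬ d ∣ a) n = HH n - HH (n/d) / d := by
  induction n with
  | zero => simp [Hs, HH]
  | succ n ih =>
    have hs : Hs (ind fun a => ¬ d ∣ a) (n+1) = Hs (ind fun a => ¬ d ∣ a) n
      + (ind fun a => ¬ d ∣ a) (n+1) / ((n+1 : ℕ) : ℝ) := sum_Ioc_succ' _ n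
    rw [hs, ih, HH_succ, ind_apply]
    by_cases h : d ∣ n + 1
    · obtain ⟨k, hk⟩ := id h
      have h3 : (n+1)/d = k := by rw [hk]; exact Nat.mul_div_cancel_left k hd
      have h4 : n / d + 1 = k := by rw [← h3, Nat.succ_div, if_pos h]
      have h5 : HH ((n+1)/d) = HH (n/d) + 1 / (k:ℝ) := by rw [h3, ← h4, HH_succ]
      have h6 : ((n+1:ℕ):ℝ) = d * k := by rw [hk]; push_cast; rfl
      have : (d:ℝ) ≠ 0 := by positivity
      have : (k:ℝ) ≠ 0 := by
        have : k ≠ 0 := by rintro rfl; simp at hk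
        exact_mod_cast this
      rw [h5, h6]
      simp only [h, not_true, if_false, Nat.succ_ne_zero]
      field_simp; ring
    · have h5 : (n+1)/d = n/d := by rw [Nat.succ_div, if_neg h]; rfl
      rw [h5]
      simp [h]; ring

lemma ind_dvd_count (d : ℕ) (n : ℕ) :
    ∑ a ∈ Finset.Ioc 0 n, (ind fun a => ¬ d ∣ a) a = n - (n/d : ℕ) := by
  induction n with
  | zero => simp
  | succ n ih =>
    rw [sum_Ioc_succ', ih, ind_apply, Nat.succ_div]
    by_cases h : d ∣ n + 1 <;> simp [h] ; ring

lemma log_div_lb (d n : ℕ) (hd : 1 ≤ d) (hn : 1 ≤ n) :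
    Real.log n - Real.log d ≤ HH (n/d) := by
  refine le_trans ?_ (HH_ge _)
  have : (0:ℝ) < d := by exact_mod_cast hd
  have : (0:ℝ) < n := by exact_mod_cast hn
  rw [← Real.log_div (by positivity) (by positivity)]
  apply Real.log_le_log (by positivity)
  rw [div_le_iff₀ (by positivity)]
  have := Nat.lt_div_mul_add (a := n) (b := d) hd
  have h : (n:ℝ) < (n/d:ℕ) * d + d := by exact_mod_cast this
  linarith

lemma mul_mono_dvd (f g f' g' : ArithmeticFunction ℝ) (n : ℕ)
    (hf : ∀ d, d ∣ n → 0 ≤ f d ∧ f d ≤ f' d) (hg : ∀ d, d ∣ n → 0 ≤ g d ∧ g d ≤ g' d) :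
    ∀ d, d ∣ n → 0 ≤ (f * g) d ∧ (f * g) d ≤ (f' * g') d := by
  intro d hd
  have h1 : ∀ p ∈ d.divisorsAntidiagonal, p.1 ∣ n ∧ p.2 ∣ n := by
    intro p hp
    have := (Nat.mem_divisorsAntidiagonal.1 hp).1
    exact ⟨(Dvd.intro _ this).trans hd, (Dvd.intro_left _ this).trans hd⟩
  rw [ArithmeticFunction.mul_apply, ArithmeticFunction.mul_apply]
  constructor
  · exact Finset.sum_nonneg fun p hp => mul_nonneg (hf _ (h1 p hp).1).1 (hg _ (h1 p hp).2).1
  · refine Finset.sum_le_sum fun p hp => ?_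
    have a := hf _ (h1 p hp).1
    have b := hg _ (h1 p hp).2
    exact mul_le_mul a.2 b.2 b.1 (a.1.trans a.2)

lemma mul_nonneg_all (f g : ArithmeticFunction ℝ) (hf : ∀ d, 0 ≤ f d) (hg : ∀ d, 0 ≤ g d) (n : ℕ) :
    0 ≤ (f * g) n := by
  rw [ArithmeticFunction.mul_apply]
  exact Finset.sum_nonneg fun p _ => mul_nonneg (hf _) (hg _)

lemma ind_sqf_mult : (ind Squarefree).IsMultiplicative := by
  rw [ArithmeticFunction.IsMultiplicative.iff_ne_zero]
  constructor
  · simp [ind_apply]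
  · intro m n hm hn h
    simp only [ind_apply, hm, hn, mul_ne_zero hm hn, if_false, Nat.squarefree_mul h]
    by_cases a : Squarefree m <;> by_cases b : Squarefree n <;> simp [a, b]

lemma ind_true_mult : (ind fun _ => True).IsMultiplicative := by
  rw [ArithmeticFunction.IsMultiplicative.iff_ne_zero]
  constructor
  · simp [ind_apply]
  · intro m n hm hn h
    simp [ind_apply, hm, hn]

noncomputable def tau : ArithmeticFunction ℝ := ⟨fun n => (n.divisors.card : ℝ), by simp⟩

lemma tau_eq : tau = (ind fun _ => True) * (ind fun _ => True) := by
  ext n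
  rw [ArithmeticFunction.mul_apply,
    Nat.sum_divisorsAntidiagonal (fun a b => ind (fun _ => True) a * ind (fun _ => True) b)]
  have : ∀ x ∈ n.divisors, (ind fun _ => True) x * (ind fun _ => True) (n / x) = 1 := by
    intro x hx
    have h := Nat.mem_divisors.1 hx
    have h0 : x ≠ 0 := by rintro rfl; simp at h
    have h1 : n / x ≠ 0 := by
      have := Nat.div_pos (Nat.le_of_dvd (Nat.pos_of_ne_zero h.2) h.1) (Nat.pos_of_ne_zero h0)
      omega
    simp [ind_apply, h0, -Nat.div_eq_zero_iff, h1]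
  rw [Finset.sum_congr rfl this]
  simp [tau]

lemma tau_sq (n : ℕ) : (n.divisors.card : ℝ) ^ 2 =
    ((ind fun _ => True) * ((ind Squarefree) * ((ind fun _ => True) * (ind fun _ => True)))) n := by
  have ht : tau.IsMultiplicative := by rw [tau_eq]; exact ind_true_mult.mul ind_true_mult
  have hp : ∀ p k : ℕ, p.Prime → tau (p^k) = k + 1 := by
    intro p k hp
    simp [tau, Nat.divisors_prime_pow hp]
  have main : tau.pmul tau = (ind fun _ => True) * ((ind Squarefree) * tau) := by
    rw [ArithmeticFunction.IsMultiplicative.eq_iff_eq_on_prime_powers _ (ht.pmul ht) _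
      (ind_true_mult.mul (ind_sqf_mult.mul ht))]
    intro p k hpp
    have h1 : ∀ k : ℕ, ((ind Squarefree) * tau) (p ^ k) = 2 * k + 1 := by
      intro k
      rw [ArithmeticFunction.mul_apply, Nat.sum_divisorsAntidiagonal (fun a b => ind Squarefree a * tau b),
        Nat.sum_divisors_prime_pow hpp]
      cases k with
      | zero => simp [ind_apply, tau]
      | succ k =>
        rw [Finset.sum_range_succ', Finset.sum_range_succ']
        have : ∀ i ∈ Finset.range k, ind Squarefree (p ^ (i+1+1)) * tau (p^(k+1) / p ^ (i+1+1)) = 0 := by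
          intro i _
          have : ¬ Squarefree (p ^ (i+1+1)) := by
            rw [Nat.squarefree_pow_iff hpp.ne_one (by omega)]; omega
          simp [ind_apply, this]
        rw [Finset.sum_eq_zero this]
        have e : p ^ (k+1) / p ^ (0+1) = p ^ k := by
          rw [pow_succ, zero_add, pow_one, Nat.mul_div_cancel _ hpp.pos]
        rw [e, hp _ _ hpp]
        simp only [pow_zero, Nat.div_one, hp _ _ hpp]
        have : Squarefree p := hpp.prime.squarefree
        simp [ind_apply, this, hpp.ne_zero]; ring
    rw [ArithmeticFunction.mul_apply, Nat.sum_divisorsAntidiagonal' (fun a b => ind (fun _ => True) a * (ind Squarefree * tau) b),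
        Nat.sum_divisors_prime_pow hpp, ArithmeticFunction.pmul_apply, hp _ _ hpp]
    have : ∀ i ∈ Finset.range (k+1), ind (fun _ => True) (p^k / p^i) * (ind Squarefree * tau) (p^i) = 2 * i + 1 := by
      intro i hi
      rw [Finset.mem_range] at hi
      rw [h1, Nat.pow_div (by omega) hpp.pos]
      simp [ind_apply, hpp.ne_zero]
    rw [Finset.sum_congr rfl this]
    have : ∀ m : ℕ, ∑ i ∈ Finset.range m, (2 * (i:ℝ) + 1) = m * m := by
      intro m
      induction m with
      | zero => simp
      | succ m ih => rw [Finset.sum_range_succ, ih]; push_cast; ring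
    rw [this]; push_cast; ring
  rw [← tau_eq, ← main, ArithmeticFunction.pmul_apply, sq]
  rfl

lemma reduce (q : ℕ) (P Q : ℕ → Prop) (N : ℕ)
    (hP : ∀ n, n.Coprime q → P n) (hQ : ∀ n, n.Coprime q → Squarefree n → Q n) :
    ∑ n ∈ (Finset.Icc 1 N).filter (fun n => n.Coprime q), (n.divisors.card : ℝ) ^ 2 ≤
    ∑ n ∈ Finset.Ioc 0 N, (ind P * (ind Q * (ind P * ind P))) n := by
  have e : Finset.Icc 1 N = Finset.Ioc 0 N := by ext; simp; omega
  rw [e]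
  refine le_trans (Finset.sum_le_sum (g := (ind P * (ind Q * (ind P * ind P)))) ?_)
    (Finset.sum_le_sum_of_subset_of_nonneg (Finset.filter_subset _ _) fun n _ _ =>
      mul_nonneg_all _ _ (ind_nonneg _) (mul_nonneg_all _ _ (ind_nonneg _)
        (mul_nonneg_all _ _ (ind_nonneg _) (ind_nonneg _))) n)
  intro n hn
  rw [Finset.mem_filter] at hn
  rw [tau_sq]
  have hT : ∀ d, d ∣ n → 0 ≤ ind (fun _ => True) d ∧ ind (fun _ => True) d ≤ ind P d := by
    intro d hd
    refine ⟨ind_nonneg _ _, ?_⟩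
    simp [ind_apply, hP d (Nat.Coprime.coprime_dvd_left hd hn.2)]
  have hS : ∀ d, d ∣ n → 0 ≤ ind Squarefree d ∧ ind Squarefree d ≤ ind Q d := by
    intro d hd
    refine ⟨ind_nonneg _ _, ?_⟩
    by_cases h : Squarefree d
    · simp [ind_apply, h, hQ d (Nat.Coprime.coprime_dvd_left hd hn.2) h]
    · refine le_trans (le_of_eq ?_) (ind_nonneg _ _)
      simp [ind_apply, h]
  exact (mul_mono_dvd _ _ _ _ n hT (mul_mono_dvd _ _ _ _ n hS (mul_mono_dvd _ _ _ _ n hT hT))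
    n dvd_rfl).2

lemma Hs_true (n : ℕ) : Hs (ind fun _ => True) n = HH n := by
  apply Finset.sum_congr rfl
  intro a ha
  rw [Finset.mem_Ioc] at ha
  have : a ≠ 0 := by omega
  simp [ind_apply, this]

lemma HH_le_one (n : ℕ) (hn : 1 ≤ n) : HH n ≤ 1 * Real.log n + 1 := by
  have := HH_le n hn
  have hn0 : (1:ℝ) ≤ n := by exact_mod_cast hn
  have : 1 / (3 * (n:ℝ)) ≤ 1/3 := by
    apply div_le_div_of_nonneg_left <;> linarith
  linarith

lemma case_one (N : ℕ) (hN : 1 ≤ N) :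
    ∑ n ∈ Finset.Ioc 0 N, (ind (fun _ => True) * (ind (fun n => ¬ 4 ∣ n) *
      (ind (fun _ => True) * ind (fun _ => True)))) n ≤
    N * (3/8 * (1 * Real.log N ^ 3 / 3 + 1 * Real.log N ^ 2)
      + (8/5) * (1 * Real.log N ^ 2 / 2 + 1 * Real.log N) + (16/15) * (1 * Real.log N + 1) + 0) := by
  have hD : ∀ m : ℕ, 1 ≤ m → ∑ a ∈ Finset.Ioc 0 m, ((ind fun _ => True) * (ind fun _ => True)) a ≤
      m * (0 * Real.log m ^ 2 + 1 * Real.log m + 2/3) + 1/3 := by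
    intro m hm
    rw [ArithmeticFunction.sum_Ioc_mul_eq_sum_sum]
    have hm0 : (0:ℝ) < m := by exact_mod_cast hm
    calc _ ≤ ∑ a ∈ Finset.Ioc 0 m, (m:ℝ) * (1 / a) := by
          apply Finset.sum_le_sum
          intro a ha
          have h1 := ind_sum_le (fun _ => True) (m / a)
          have h2 : ((m/a:ℕ):ℝ) ≤ m/a := Nat.cast_div_le
          have h3 := ind_le_one (fun _ => True) a
          have h4 := ind_nonneg (fun _ => True) a
          have h5 : 0 ≤ ∑ b ∈ Finset.Ioc 0 (m/a), (ind fun _ => True) b :=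
            Finset.sum_nonneg fun _ _ => ind_nonneg _ _
          calc _ ≤ 1 * ∑ b ∈ Finset.Ioc 0 (m/a), (ind fun _ => True) b := by gcongr
            _ ≤ m / a := by linarith
            _ = _ := by ring
      _ = m * HH m := by rw [← Finset.mul_sum]; rfl
      _ ≤ m * (Real.log m + 2/3 + 1/(3*m)) := by
          gcongr; exact HH_le m hm
      _ = _ := by field_simp; ring
  have hW : ∀ n : ℕ, 1 ≤ n → Hs (ind fun n => ¬ 4 ∣ n) n ≤ 3/4 * Real.log n + 11/10 := by
    intro n hn
    rw [Hs_ind_dvd 4 (by norm_num)]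
    have h2 := Real.log_two_lt_d9
    have h2' := Real.log_two_gt_d9
    rcases lt_or_ge n 4 with h | h
    · have h3 : 3 * Real.log 2 ≤ 2 * Real.log 3 := by
        have h8 : Real.log (2^3) ≤ Real.log (3^2) := Real.log_le_log (by norm_num) (by norm_num)
        rw [Real.log_pow, Real.log_pow] at h8
        exact_mod_cast h8
      interval_cases n <;> simp [HH, Finset.sum_Ioc_succ_top] <;> linarith
    · have a := HH_le n hn
      have b := log_div_lb 4 n (by norm_num) hn
      have hn0 : (4:ℝ) ≤ n := by exact_mod_cast h
      have : 1 / (3 * (n:ℝ)) ≤ 1/12 := by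
        apply div_le_div_of_nonneg_left <;> linarith
      have e : Real.log ((4:ℕ):ℝ) = 2 * Real.log 2 := by
        rw [show ((4:ℕ):ℝ) = 2^2 by norm_num, Real.log_pow]; norm_num
      push_cast at *
      linarith
  have hE : ∀ m : ℕ, 1 ≤ m → ∑ a ∈ Finset.Ioc 0 m, (ind (fun n => ¬ 4 ∣ n) *
      (ind (fun _ => True) * ind (fun _ => True))) a ≤
      m * (3/8 * Real.log m ^ 2 + 8/5 * Real.log m + 16/15) + 0 := by
    intro m hm
    have := conv_step _ _ (3/4) (11/10) (2/3) 1 0 (1/3) (by norm_num) (ind_nonneg _) hW (ind_sum_le _)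
      (by norm_num) (by norm_num) (by norm_num) (by norm_num) hD m hm
    refine this.trans (le_of_eq ?_)
    ring
  exact conv_step _ _ 1 1 (16/15) (8/5) (3/8) 0 (by norm_num) (ind_nonneg _)
    (fun n hn => by rw [Hs_true]; exact HH_le_one n hn) (ind_sum_le _)
      (by norm_num) (by norm_num) (by norm_num) (by norm_num) hE N hN

lemma case_prime (q : ℕ) (hq : 2 ≤ q) (δ : ℝ) (hδ : δ = 1 - 1 / q) (N : ℕ) (hN : 1 ≤ N) :
    ∑ n ∈ Finset.Ioc 0 N, (ind (fun n => ¬ q ∣ n) * (ind (fun n => ¬ q ∣ n) *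
      (ind (fun n => ¬ q ∣ n) * ind (fun n => ¬ q ∣ n)))) n ≤
    N * (δ^3/2 * (δ * Real.log N ^ 3 / 3 + 3/2 * Real.log N ^ 2)
      + (3*δ^2+δ) * (δ * Real.log N ^ 2 / 2 + 3/2 * Real.log N)
      + (3/2*(3/2*δ+1)) * (δ * Real.log N + 3/2) + 0) := by
  have hq0 : (2:ℝ) ≤ q := by exact_mod_cast hq
  have hδ0 : 0 ≤ δ := by
    have : 1 / (q:ℝ) ≤ 1 := by rw [div_le_one (by linarith)]; linarith
    linarith
  have hW : ∀ n : ℕ, 1 ≤ n → Hs (ind fun n => ¬ q ∣ n) n ≤ δ * Real.log n + 3/2 := by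
    intro n hn
    rw [Hs_ind_dvd q (by omega)]
    have a := HH_le_one n hn
    have b := log_div_lb q n (by omega) hn
    have c : (Real.log n - Real.log q) / q ≤ HH (n/q) / q := by gcongr
    have d : Real.log q / q ≤ 1/2 := by
      rw [div_le_iff₀ (by linarith)]
      have h1 := Real.log_le_sub_one_of_pos (x := (q:ℝ)/2) (by linarith)
      rw [Real.log_div (by linarith) (by norm_num)] at h1
      have := Real.log_two_lt_d9
      linarith
    rw [sub_div] at c
    rw [hδ]
    have e : (1 - 1 / (q:ℝ)) * Real.log n = Real.log n - Real.log n / q := by ring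
    linarith
  have hD : ∀ m : ℕ, 1 ≤ m → ∑ a ∈ Finset.Ioc 0 m,
      ((ind fun n => ¬ q ∣ n) * (ind fun n => ¬ q ∣ n)) a ≤
      m * (0 * Real.log m ^ 2 + δ^2 * Real.log m + (3/2*δ+1)) + 0 := by
    intro m hm
    rw [ArithmeticFunction.sum_Ioc_mul_eq_sum_sum]
    have hm0 : (0:ℝ) < m := by exact_mod_cast hm
    calc _ ≤ ∑ a ∈ Finset.Ioc 0 m, ((m * δ) * ((ind fun n => ¬ q ∣ n) a / a) + (ind fun n => ¬ q ∣ n) a) := by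
          apply Finset.sum_le_sum
          intro a ha
          have h4 := ind_nonneg (fun n => ¬ q ∣ n) a
          have h1 : ∑ b ∈ Finset.Ioc 0 (m/a), (ind fun n => ¬ q ∣ n) b ≤ δ * (m / a) + 1 := by
            rw [ind_dvd_count]
            have h2 : ((m/a:ℕ):ℝ) ≤ m/a := Nat.cast_div_le
            have h3 := Nat.lt_div_mul_add (a := m / a) (b := q) (by omega)
            have h : ((m/a:ℕ):ℝ) < (m/a/q:ℕ) * q + q := by exact_mod_cast h3
            have h5 : ((m/a:ℕ):ℝ) / q ≤ (m/a/q:ℕ) + 1 := by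
              rw [div_le_iff₀ (by linarith)]; linarith
            have h6 : δ * ((m/a:ℕ):ℝ) ≤ δ * (m / a) := by gcongr
            have h7 : δ * ((m/a:ℕ):ℝ) = ((m/a:ℕ):ℝ) - ((m/a:ℕ):ℝ) / q := by rw [hδ]; ring
            linarith
          calc _ ≤ _ := mul_le_mul_of_nonneg_left h1 h4
            _ = _ := by ring
      _ = m * δ * Hs (ind fun n => ¬ q ∣ n) m + ∑ a ∈ Finset.Ioc 0 m, (ind fun n => ¬ q ∣ n) a := by
          rw [Finset.sum_add_distrib, ← Finset.mul_sum]; rfl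
      _ ≤ m * δ * (δ * Real.log m + 3/2) + m := by
          have := ind_sum_le (fun n => ¬ q ∣ n) m
          have := hW m hm
          gcongr
      _ = _ := by ring
  have hE : ∀ m : ℕ, 1 ≤ m → ∑ a ∈ Finset.Ioc 0 m, (ind (fun n => ¬ q ∣ n) *
      (ind (fun n => ¬ q ∣ n) * ind (fun n => ¬ q ∣ n))) a ≤
      m * (δ^3/2 * Real.log m ^ 2 + (3*δ^2+δ) * Real.log m + (3/2*(3/2*δ+1))) + 0 := by
    intro m hm
    have := conv_step _ _ δ (3/2) (3/2*δ+1) (δ^2) 0 0 hδ0 (ind_nonneg _) hW (ind_sum_le _)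
      (by positivity) (by positivity) (by norm_num) (by norm_num) hD m hm
    refine this.trans (le_of_eq ?_)
    ring
  exact conv_step _ _ δ (3/2) _ _ _ 0 hδ0 (ind_nonneg _) hW (ind_sum_le _)
      (by positivity) (by positivity) (by positivity) (by norm_num) hE N hN

lemma final_one (L : ℝ) (hL : 127/10 ≤ L) :
    (3/8 * (1 * L ^ 3 / 3 + 1 * L ^ 2)
      + (8/5) * (1 * L ^ 2 / 2 + 1 * L) + (16/15) * (1 * L + 1) + 0) ≤ 0.24 * L^3 := by
  obtain ⟨t, rfl⟩ : ∃ t, L = 127/10 + t := ⟨L - 127/10, by ring⟩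
  have ht : 0 ≤ t := by linarith
  have h2 : 0 ≤ t^2 := by positivity
  have h3 : 0 ≤ t^3 := by positivity
  norm_num
  ring_nf
  nlinarith

lemma final_prime (δ L : ℝ) (hδ : 1/2 ≤ δ) (hδ1 : δ ≤ 1) (hL : 256 ≤ L) :
    (δ^3/2 * (δ * L ^ 3 / 3 + 3/2 * L ^ 2)
      + (3*δ^2+δ) * (δ * L ^ 2 / 2 + 3/2 * L)
      + (3/2*(3/2*δ+1)) * (δ * L + 3/2) + 0) ≤ 0.24 * δ^4 * L^3 := by
  obtain ⟨t, ht⟩ : ∃ t, t = δ * L := ⟨_, rfl⟩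
  have ht1 : 128 ≤ t := by nlinarith
  have e : (δ^3/2 * (δ * L ^ 3 / 3 + 3/2 * L ^ 2)
      + (3*δ^2+δ) * (δ * L ^ 2 / 2 + 3/2 * L)
      + (3/2*(3/2*δ+1)) * (δ * L + 3/2) + 0) =
      δ * t^3/6 + 3/4*δ*t^2 + (3*δ+1) * (t^2/2 + 3/2*t) + (3/2*(3/2*δ+1)) * (t + 3/2) := by
    rw [ht]; ring
  have e2 : 0.24 * δ^4 * L^3 = 0.24 * δ * t^3 := by rw [ht]; ring
  rw [e, e2]
  have h1 : (3*δ+1) * (t^2/2 + 3/2*t) ≤ (5 * δ) * (t^2/2 + 3/2*t) := by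
    apply mul_le_mul_of_nonneg_right <;> [linarith; positivity]
  have h2 : (3/2*(3/2*δ+1)) * (t + 3/2) ≤ (6*δ) * (t+3/2) := by
    apply mul_le_mul_of_nonneg_right <;> [linarith; positivity]
  have h3 : t^3/6+3/4*t^2+5*(t^2/2 + 3/2*t) + 6*(t+3/2) ≤ 0.24 * t^3 := by
    have a : 128 * t ≤ t^2 := by nlinarith
    have b : 128 * t^2 ≤ t^3 := by nlinarith
    norm_num
    linarith
  have h4 := mul_le_mul_of_nonneg_left h3 (by linarith : 0 ≤ δ)
  linarith

/-- Bound for `∑_{n ≤ x, (n,q)=1} τ(n)²` for `q` equal to 1 or a prime, assuming the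
divisor-problem bound with constant 0.397 and exponent 1/2. -/
theorem stmt_10
    (hΔ : ∀ x : ℝ, 5560 ≤ x →
      |(∑ n ∈ Finset.Icc 1 ⌊x⌋₊, (n.divisors.card : ℝ)) -
        (x * Real.log x + (2 * Real.eulerMascheroniConstant - 1) * x)| ≤
        0.397 * x ^ ((1 : ℝ) / 2))
    (q : ℕ) (hq : q = 1 ∨ q.Prime) (x : ℝ)
    (hx : x > max (Real.exp ((q : ℝ) ^ 8)) 355991) :
    ∑ n ∈ (Finset.Icc 1 ⌊x⌋₊).filter (fun n => n.Coprime q), (n.divisors.card : ℝ) ^ 2 ≤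
      0.24 * ((q.totient : ℝ) / q) ^ 4 * x * (Real.log x) ^ 3 := by
  have hx1 : Real.exp ((q : ℝ) ^ 8) < x := lt_of_le_of_lt (le_max_left _ _) hx
  have hx2 : 355991 < x := lt_of_le_of_lt (le_max_right _ _) hx
  have hx0 : 0 < x := by linarith
  have hN : 1 ≤ ⌊x⌋₊ := Nat.le_floor (by push_cast; linarith)
  have hN1 : (1:ℝ) ≤ ⌊x⌋₊ := by exact_mod_cast hN
  have hNx : ((⌊x⌋₊ : ℕ) : ℝ) ≤ x := Nat.floor_le hx0.le
  have hl0 : 0 ≤ Real.log (⌊x⌋₊ : ℕ) := Real.log_nonneg hN1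
  have hl : Real.log (⌊x⌋₊ : ℕ) ≤ Real.log x := Real.log_le_log (by linarith) hNx
  rcases hq with rfl | hp
  · have hL : 127/10 ≤ Real.log x := by
      rw [Real.le_log_iff_exp_le hx0]
      have h1 : Real.exp (127/10) ^ 10 = Real.exp 1 ^ 127 := by
        rw [← Real.exp_nat_mul, ← Real.exp_nat_mul]; norm_num
      have h2 : Real.exp 1 ^ 127 ≤ (2.7182818286:ℝ) ^ 127 :=
        pow_le_pow_left₀ (Real.exp_pos 1).le Real.exp_one_lt_d9.le _
      have h3 : (2.7182818286:ℝ) ^ 127 ≤ 355991 ^ 10 := by norm_num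
      have h4 : Real.exp (127/10) ≤ 355991 :=
        le_of_pow_le_pow_left₀ (n := 10) (by norm_num) (by norm_num) (by linarith)
      linarith
    refine (reduce 1 (fun _ => True) (fun n => ¬ 4 ∣ n) _ (fun _ _ => trivial) ?_).trans ?_
    · intro n _ hs hd
      have := Nat.isUnit_iff.1 (hs 2 hd)
      omega
    refine (case_one _ hN).trans ?_
    calc _ ≤ x * (3/8 * (1 * Real.log x ^ 3 / 3 + 1 * Real.log x ^ 2)
      + (8/5) * (1 * Real.log x ^ 2 / 2 + 1 * Real.log x) + (16/15) * (1 * Real.log x + 1) + 0) := by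
          gcongr
      _ ≤ x * (0.24 * Real.log x ^ 3) := by
          gcongr; exact final_one _ hL
      _ = _ := by simp; ring
  · have hq2 : (2:ℝ) ≤ q := by exact_mod_cast hp.two_le
    have hL : 256 ≤ Real.log x := by
      rw [Real.le_log_iff_exp_le hx0]
      refine le_trans (Real.exp_le_exp.2 ?_) hx1.le
      calc (256:ℝ) = 2^8 := by norm_num
        _ ≤ _ := by gcongr
    have hcop : ∀ n : ℕ, n.Coprime q → ¬ q ∣ n := fun n hn =>
      (Nat.Prime.coprime_iff_not_dvd hp).1 hn.symm
    obtain ⟨δ, hδ⟩ : ∃ δ : ℝ, δ = 1 - 1 / q := ⟨_, rfl⟩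
    have hδ' : (q.totient : ℝ) / q = δ := by
      rw [Nat.totient_prime hp, Nat.cast_sub hp.one_lt.le, hδ]
      have : (q:ℝ) ≠ 0 := by linarith
      push_cast
      field_simp
    have h5 : 1 / (q:ℝ) ≤ 1/2 := by
      apply div_le_div_of_nonneg_left <;> linarith
    have h6 : 0 ≤ 1 / (q:ℝ) := by positivity
    have hδ0 : 0 ≤ δ := by linarith
    refine (reduce q (fun n => ¬ q ∣ n) (fun n => ¬ q ∣ n) _ hcop (fun n h _ => hcop n h)).trans ?_
    refine (case_prime q hp.two_le δ hδ _ hN).trans ?_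
    rw [hδ']
    calc _ ≤ x * (δ^3/2 * (δ * Real.log x ^ 3 / 3 + 3/2 * Real.log x ^ 2)
      + (3*δ^2+δ) * (δ * Real.log x ^ 2 / 2 + 3/2 * Real.log x)
      + (3/2*(3/2*δ+1)) * (δ * Real.log x + 3/2) + 0) := by gcongr
      _ ≤ x * (0.24 * δ^4 * Real.log x ^ 3) := by
          gcongr; exact final_prime δ _ (by linarith) (by linarith) hL
      _ = _ := by ring
end
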